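/- Let 1 < p < ∞. There exists a constant C_p depending only on p such that the following holds. For j ∈ ℤ and τ ∈ ℝ define the directional half-plane multiplier H_{τ,j} acting on Schwartz functions f on ℝ² by H_{τ,j} f(x,y) = ∫∫ f̂(ξ,η) 1_{(τ,∞)}(ξ + η 2^{−j}) e^{2πi(xξ + yη)} dξ dη. Then for every τ with |τ| ≤ 10, every finite set F ⊂ ℤ, and every collection (f_j)_{j∈F} of Schwartz functions on ℝ², ‖(Σ_{j∈F} |H_{τ,j} f_j|²)^{1/2}‖_{L^p(ℝ²)} ≤ C_p ‖(Σ_{j∈F} |f_j|²)^{1/2}‖_{L^p(ℝ²)}, with C_p independent of τ. -/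

import Mathlib

open MeasureTheory

/-- The two-dimensional Fourier transform `f̂(ξ,η) = ∫∫ f(x,y) e^{-2πi(xξ+yη)} dx dy`. -/
noncomputable def fourier2 (f : ℝ × ℝ → ℂ) (w : ℝ × ℝ) : ℂ :=
  ∫ p : ℝ × ℝ, f p * Complex.exp (-2 * Real.pi * Complex.I * (p.1 * w.1 + p.2 * w.2))

/-- The directional half-plane multiplier
`H_{τ,j} f(x,y) = ∫∫ f̂(ξ,η) 1_{(τ,∞)}(ξ + η 2^{-j}) e^{2πi(xξ+yη)} dξ dη`. -/
noncomputable def halfPlaneOp (τ : ℝ) (j : ℤ) (f : ℝ × ℝ → ℂ) (q : ℝ × ℝ) : ℂ :=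
  ∫ w : ℝ × ℝ,
    fourier2 f w * (Set.Ioi τ).indicator (fun _ => (1 : ℂ)) (w.1 + w.2 * (2 : ℝ) ^ (-j)) *
      Complex.exp (2 * Real.pi * Complex.I * (q.1 * w.1 + q.2 * w.2))

namespace LacunaryHalfPlane

open ProbabilityTheory ENNReal

/-- The standard Gaussian measure on the line. -/
noncomputable abbrev stdG : Measure ℝ := gaussianReal 0 1

/-- The Gaussian average with variance `v` in the direction `e`, for nonnegative functions. -/
noncomputable def heatL (e : ℝ × ℝ) (v : ℝ) (F : ℝ × ℝ → ℝ≥0∞) (x : ℝ × ℝ) : ℝ≥0∞ :=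
  ∫⁻ s, F (x + (√v * s) • e) ∂stdG

theorem lintegral_stdG_scale (v : ℝ) (hv : 0 ≤ v) {φ : ℝ → ℝ≥0∞} (hφ : Measurable φ) :
    ∫⁻ s, φ (√v * s) ∂stdG = ∫⁻ s, φ s ∂(gaussianReal 0 v.toNNReal) := by
  have h := gaussianReal_map_const_mul (μ := 0) (v := 1) (√v)
  have h2 : (NNReal.mk (√v ^ 2) (sq_nonneg _) * 1 : NNReal) = v.toNNReal := by
    ext; simp [Real.sq_sqrt hv, hv]
  rw [mul_zero, h2] at h
  rw [← h, lintegral_map hφ (by fun_prop)]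

theorem lintegral_stdG_comp_add {u v : ℝ} (hu : 0 ≤ u) (hv : 0 ≤ v) {φ : ℝ → ℝ≥0∞}
    (hφ : Measurable φ) :
    ∫⁻ s, ∫⁻ t, φ (√u * s + √v * t) ∂stdG ∂stdG = ∫⁻ s, φ (√(u + v) * s) ∂stdG := by
  have h := gaussianReal_conv_gaussianReal (m₁ := 0) (m₂ := 0) (v₁ := u.toNNReal)
    (v₂ := v.toNNReal)
  rw [add_zero, ← Real.toNNReal_add hu hv] at h
  rw [lintegral_stdG_scale _ (by positivity) hφ, ← h, Measure.lintegral_conv hφ,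
    ← lintegral_stdG_scale u hu (φ := fun a => ∫⁻ b, φ (a + b) ∂gaussianReal 0 v.toNNReal)
      (Measurable.lintegral_prod_right' (f := fun p : ℝ × ℝ => φ (p.1 + p.2)) (by fun_prop))]
  refine lintegral_congr fun s => ?_
  rw [← lintegral_stdG_scale v hv (φ := fun b => φ (√u * s + b)) (by fun_prop)]

theorem lintegral_stdG_neg {φ : ℝ → ℝ≥0∞} (hφ : Measurable φ) :
    ∫⁻ s, φ (-s) ∂stdG = ∫⁻ s, φ s ∂stdG := by
  have h := gaussianReal_map_neg (μ := 0) (v := 1)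
  rw [neg_zero] at h
  calc ∫⁻ s, φ (-s) ∂stdG = ∫⁻ s, φ s ∂(Measure.map (fun x => -x) (gaussianReal 0 1)) :=
        (lintegral_map hφ (by fun_prop)).symm
    _ = _ := by rw [h]

theorem lintegral_gaussian_density {v : ℝ} (hv : 0 < v) {φ : ℝ → ℝ≥0∞} :
    ∫⁻ s, φ s ∂(gaussianReal 0 v.toNNReal) =
      ∫⁻ s, ENNReal.ofReal ((√(2 * Real.pi * v))⁻¹ * Real.exp (-s ^ 2 / (2 * v))) * φ s := by
  have h0 : v.toNNReal ≠ 0 := by simpa using hv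
  rw [gaussianReal_of_var_ne_zero _ h0,
    lintegral_withDensity_eq_lintegral_mul_non_measurable _ (measurable_gaussianPDF _ _)
      (by simp [gaussianPDF_lt_top])]
  refine lintegral_congr fun s => ?_
  simp [gaussianPDF, gaussianPDFReal, hv.le]

/-- Comparison of two weighted Gaussian integrals from a pointwise comparison of the densities. -/
theorem lintegral_stdG_le_of_density {u v C : ℝ} (hu : 0 < u) (hv : 0 < v) {a : ℝ → ℝ}
    (ha : Measurable a) (hC : 0 ≤ C)
    (h : ∀ s, a s * ((√(2 * Real.pi * u))⁻¹ * Real.exp (-s ^ 2 / (2 * u))) ≤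
      C * ((√(2 * Real.pi * v))⁻¹ * Real.exp (-s ^ 2 / (2 * v))))
    {φ : ℝ → ℝ≥0∞} (hφ : Measurable φ) :
    ∫⁻ s, ENNReal.ofReal (a (√u * s)) * φ (√u * s) ∂stdG ≤
      ENNReal.ofReal C * ∫⁻ s, φ (√v * s) ∂stdG := by
  rw [lintegral_stdG_scale u hu.le (φ := fun s => ENNReal.ofReal (a s) * φ s) (by fun_prop),
    lintegral_stdG_scale v hv.le hφ, lintegral_gaussian_density hu, lintegral_gaussian_density hv,
    ← lintegral_const_mul' _ _ ENNReal.ofReal_ne_top]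
  refine lintegral_mono fun s => ?_
  rw [← mul_assoc, ← mul_assoc, mul_comm (ENNReal.ofReal _) (ENNReal.ofReal (a s)),
    ← ENNReal.ofReal_mul' (by positivity), ← ENNReal.ofReal_mul hC]
  exact mul_le_mul_left (ENNReal.ofReal_le_ofReal (h s)) _

theorem lintegral_stdG_le {u v : ℝ} (hu : 0 < u) (huv : u ≤ v) {φ : ℝ → ℝ≥0∞}
    (hφ : Measurable φ) :
    ∫⁻ s, φ (√u * s) ∂stdG ≤ ENNReal.ofReal (√(v / u)) * ∫⁻ s, φ (√v * s) ∂stdG := by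
  have hv : 0 < v := hu.trans_le huv
  have := lintegral_stdG_le_of_density (a := fun _ => 1) hu hv measurable_const
    (C := √(v / u)) (by positivity) (fun s => ?_) hφ
  · simpa using this
  · have h1 : √(v / u) * (√(2 * Real.pi * v))⁻¹ = (√(2 * Real.pi * u))⁻¹ := by
      rw [← Real.sqrt_inv, ← Real.sqrt_mul (by positivity), ← Real.sqrt_inv]
      congr 1
      field_simp
    rw [one_mul, ← mul_assoc, h1]
    gcongr _ * Real.exp ?_
    rw [neg_div, neg_div, neg_le_neg_iff]
    gcongr

theorem sq_mul_gauss_le {v : ℝ} (hv : 0 < v) (s : ℝ) :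
    s ^ 2 / v * ((√(2 * Real.pi * v))⁻¹ * Real.exp (-s ^ 2 / (2 * v))) ≤
      3 * ((√(2 * Real.pi * (2 * v)))⁻¹ * Real.exp (-s ^ 2 / (2 * (2 * v)))) := by
  have e1 : Real.exp (-s ^ 2 / (2 * v)) =
      Real.exp (-(s ^ 2 / (4 * v))) * Real.exp (-s ^ 2 / (2 * (2 * v))) := by
    rw [← Real.exp_add]; congr 1; field_simp; ring
  have e2 : (√(2 * Real.pi * v))⁻¹ = √2 * (√(2 * Real.pi * (2 * v)))⁻¹ := by
    rw [← Real.sqrt_inv, ← Real.sqrt_inv, ← Real.sqrt_mul (by positivity)]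
    congr 1; field_simp
  set y := s ^ 2 / (4 * v) with hy
  have hy0 : 0 ≤ y := by positivity
  have e3 : s ^ 2 / v = 4 * y := by rw [hy]; field_simp
  have e4 : y * Real.exp (-y) ≤ Real.exp (-1) := by
    have := Real.add_one_le_exp (y - 1)
    have h2 : Real.exp (y - 1) = Real.exp y * Real.exp (-1) := by rw [← Real.exp_add]; rfl
    rw [Real.exp_neg y, mul_inv_le_iff₀ (Real.exp_pos y), mul_comm, ← h2]
    linarith
  have e5 : Real.exp (-1) ≤ 1 / 2 := by
    rw [Real.exp_neg, inv_le_comm₀ (Real.exp_pos _) (by norm_num)]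
    have := Real.add_one_le_exp 1
    norm_num at *; linarith
  have e6 : √2 ≤ 3 / 2 := by
    rw [Real.sqrt_le_left (by norm_num)]; norm_num
  rw [e1, e2, e3]
  calc 4 * y * (√2 * (√(2 * Real.pi * (2 * v)))⁻¹ *
        (Real.exp (-y) * Real.exp (-s ^ 2 / (2 * (2 * v)))))
      = (4 * √2 * (y * Real.exp (-y))) * ((√(2 * Real.pi * (2 * v)))⁻¹ *
        Real.exp (-s ^ 2 / (2 * (2 * v)))) := by ring
    _ ≤ 3 * ((√(2 * Real.pi * (2 * v)))⁻¹ * Real.exp (-s ^ 2 / (2 * (2 * v)))) := by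
        gcongr
        nlinarith [Real.sqrt_nonneg 2, mul_nonneg hy0 (Real.exp_pos (-y)).le]

theorem lintegral_stdG_sq_le {v : ℝ} (hv : 0 < v) {φ : ℝ → ℝ≥0∞} (hφ : Measurable φ) :
    ∫⁻ s, ENNReal.ofReal (s ^ 2) * φ (√v * s) ∂stdG ≤ 3 * ∫⁻ s, φ (√(2 * v) * s) ∂stdG := by
  have := lintegral_stdG_le_of_density (a := fun s => s ^ 2 / v) hv (v := 2 * v) (by positivity)
    (by fun_prop) (C := 3) (by positivity) (sq_mul_gauss_le hv) hφ
  have h3 : ENNReal.ofReal 3 = 3 := by norm_num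
  rw [h3] at this
  refine le_trans (le_of_eq (lintegral_congr fun s => ?_)) this
  rw [mul_pow, Real.sq_sqrt hv.le, mul_div_cancel_left₀ _ hv.ne']

theorem measurable_heatL_aux {e : ℝ × ℝ} {F : ℝ × ℝ → ℝ≥0∞} (hF : Measurable F) :
    Measurable fun p : (ℝ × (ℝ × ℝ)) => heatL e p.1 F p.2 := by
  unfold heatL
  exact Measurable.lintegral_prod_right'
    (f := fun q : (ℝ × (ℝ × ℝ)) × ℝ => F (q.1.2 + (√q.1.1 * q.2) • e)) (by fun_prop)

@[fun_prop]
theorem measurable_heatL {e : ℝ × ℝ} {v : ℝ} {F : ℝ × ℝ → ℝ≥0∞} (hF : Measurable F) :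
    Measurable (heatL e v F) :=
  (measurable_heatL_aux (e := e) hF).comp (by fun_prop : Measurable fun x : ℝ × ℝ => (v, x))

theorem heatL_mono {e : ℝ × ℝ} {v : ℝ} {F G : ℝ × ℝ → ℝ≥0∞} (h : ∀ x, F x ≤ G x) (x : ℝ × ℝ) :
    heatL e v F x ≤ heatL e v G x := lintegral_mono fun _ => h _

theorem heatL_const (e : ℝ × ℝ) (v : ℝ) (c : ℝ≥0∞) (x : ℝ × ℝ) :
    heatL e v (fun _ => c) x = c := by simp [heatL]

theorem heatL_const_mul {e : ℝ × ℝ} {v : ℝ} {F : ℝ × ℝ → ℝ≥0∞} (c : ℝ≥0∞) (hF : Measurable F)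
    (x : ℝ × ℝ) : heatL e v (fun y => c * F y) x = c * heatL e v F x :=
  lintegral_const_mul _ (by fun_prop)

theorem heatL_add {e : ℝ × ℝ} {v : ℝ} {F G : ℝ × ℝ → ℝ≥0∞} (hF : Measurable F)
    (x : ℝ × ℝ) : heatL e v (fun y => F y + G y) x = heatL e v F x + heatL e v G x :=
  lintegral_add_left (by fun_prop) _

theorem heatL_tsum {e : ℝ × ℝ} {v : ℝ} {ι : Type*} [Countable ι] {F : ι → ℝ × ℝ → ℝ≥0∞}
    (hF : ∀ i, Measurable (F i)) (x : ℝ × ℝ) :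
    heatL e v (fun y => ∑' i, F i y) x = ∑' i, heatL e v (F i) x :=
  lintegral_tsum fun i => ((hF i).comp (by fun_prop)).aemeasurable

theorem lintegral_translate (F : ℝ × ℝ → ℝ≥0∞) (y : ℝ × ℝ) :
    ∫⁻ x, F (x + y) = ∫⁻ x, F x := lintegral_add_right_eq_self F y

theorem lintegral_heatL {e : ℝ × ℝ} {v : ℝ} {F : ℝ × ℝ → ℝ≥0∞} (hF : Measurable F) :
    ∫⁻ x, heatL e v F x = ∫⁻ x, F x := by
  unfold heatL
  rw [lintegral_lintegral_swap (by fun_prop)]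
  simp [lintegral_translate]

theorem lintegral_heatL_mul {e : ℝ × ℝ} {v : ℝ} {F K : ℝ × ℝ → ℝ≥0∞} (hF : Measurable F)
    (hK : Measurable K) : ∫⁻ x, heatL e v F x * K x = ∫⁻ x, F x * heatL e v K x := by
  have h1 : ∀ x, heatL e v F x * K x = ∫⁻ s, F (x + (√v * s) • e) * K x ∂stdG := fun x => by
    rw [lintegral_mul_const _ (by fun_prop)]; rfl
  have h2 : ∀ x, F x * heatL e v K x = ∫⁻ s, F x * K (x - (√v * s) • e) ∂stdG := fun x => by
    rw [lintegral_const_mul _ (by fun_prop), ← lintegral_stdG_neg (by fun_prop)]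
    simp [heatL]
  simp_rw [h1, h2]
  rw [lintegral_lintegral_swap (by fun_prop)]
  conv_rhs => rw [lintegral_lintegral_swap (by fun_prop)]
  refine lintegral_congr fun s => ?_
  rw [← lintegral_translate (fun x => F x * K (x - (√v * s) • e)) ((√v * s) • e)]
  simp

theorem heatL_heatL {e : ℝ × ℝ} {u v : ℝ} (hu : 0 ≤ u) (hv : 0 ≤ v) {F : ℝ × ℝ → ℝ≥0∞}
    (hF : Measurable F) (x : ℝ × ℝ) : heatL e u (heatL e v F) x = heatL e (u + v) F x := by
  unfold heatL
  rw [← lintegral_stdG_comp_add hu hv (φ := fun r => F (x + r • e)) (by fun_prop)]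
  simp_rw [add_smul, add_assoc]

theorem heatL_comm {e e' : ℝ × ℝ} {u v : ℝ} {F : ℝ × ℝ → ℝ≥0∞}
    (hF : Measurable F) (x : ℝ × ℝ) :
    heatL e u (heatL e' v F) x = heatL e' v (heatL e u F) x := by
  unfold heatL
  rw [lintegral_lintegral_swap (by fun_prop)]
  simp_rw [add_right_comm]

theorem heatL_le {e : ℝ × ℝ} {u v : ℝ} (hu : 0 < u) (huv : u ≤ v) {F : ℝ × ℝ → ℝ≥0∞}
    (hF : Measurable F) (x : ℝ × ℝ) :
    heatL e u F x ≤ ENNReal.ofReal √(v / u) * heatL e v F x :=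
  lintegral_stdG_le hu huv (φ := fun r => F (x + r • e)) (by fun_prop)

theorem heatL_smul {e : ℝ × ℝ} {v c : ℝ} (hc : 0 ≤ c) (F : ℝ × ℝ → ℝ≥0∞) (x : ℝ × ℝ) :
    heatL (c • e) v F x = heatL e (c ^ 2 * v) F x := by
  unfold heatL
  rw [Real.sqrt_mul (by positivity), Real.sqrt_sq hc]
  simp_rw [smul_smul]
  congr! 5
  ring

theorem heatL_holder {e : ℝ × ℝ} {v : ℝ} {F K : ℝ × ℝ → ℝ≥0∞} (hF : Measurable F)
    (hK : Measurable K) {a b : ℝ} (ha : 0 ≤ a) (hb : 0 ≤ b) (hab : a + b = 1) (x : ℝ × ℝ) :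
    heatL e v (fun y => F y ^ a * K y ^ b) x ≤ heatL e v F x ^ a * heatL e v K x ^ b :=
  ENNReal.lintegral_mul_norm_pow_le (by fun_prop) (by fun_prop) ha hb hab

theorem heatL_rpow_le {e : ℝ × ℝ} {v : ℝ} {F : ℝ × ℝ → ℝ≥0∞} (hF : Measurable F)
    {a : ℝ} (ha : 0 ≤ a) (ha1 : a ≤ 1) (x : ℝ × ℝ) :
    heatL e v (fun y => F y ^ a) x ≤ heatL e v F x ^ a := by
  have := heatL_holder (e := e) (v := v) hF (measurable_const (a := (1 : ℝ≥0∞))) ha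
    (sub_nonneg.2 ha1) (by ring) x
  simpa [heatL_const] using this

theorem rpow_heatL_le {e : ℝ × ℝ} {v : ℝ} {F : ℝ × ℝ → ℝ≥0∞} (hF : Measurable F)
    {a : ℝ} (ha : 1 ≤ a) (x : ℝ × ℝ) :
    heatL e v F x ^ a ≤ heatL e v (fun y => F y ^ a) x := by
  have ha0 : 0 < a := by linarith
  have := heatL_rpow_le (e := e) (v := v) (F := fun y => F y ^ a) (by fun_prop)
    (a := a⁻¹) (by positivity) (inv_le_one_of_one_le₀ ha) x
  simp_rw [← ENNReal.rpow_mul, mul_inv_cancel₀ ha0.ne', ENNReal.rpow_one] at this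
  calc _ ≤ (heatL e v (fun y => F y ^ a) x ^ a⁻¹) ^ a := by gcongr
    _ = _ := by rw [← ENNReal.rpow_mul, inv_mul_cancel₀ ha0.ne', ENNReal.rpow_one]

end LacunaryHalfPlane

namespace LacunaryHalfPlane

open ProbabilityTheory ENNReal

theorem sqrt_gap_le {c : ℝ} (hc : 0 < c) (hc1 : c < 1) {r : ℝ} (hr : 0 < r) :
    min c (1 - c) * (1 - √r) ^ 2 ≤ 1 + c * (r - 1) - r ^ c := by
  set t := √r with ht
  have ht0 : 0 < t := Real.sqrt_pos.2 hr
  have hrt : r = t ^ 2 := (Real.sq_sqrt hr.le).symm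
  have hy : r ^ c = t ^ (2 * c) := by
    rw [hrt, ← Real.rpow_natCast t 2, ← Real.rpow_mul ht0.le]; norm_num
  rw [hy, hrt]
  rcases le_total c (1 / 2) with h | h
  · rw [min_eq_left (by linarith)]
    have := Real.geom_mean_le_arith_mean2_weighted (w₁ := 1 - 2 * c) (w₂ := 2 * c) (p₁ := 1)
      (p₂ := t) (by linarith) (by linarith) zero_le_one ht0.le (by ring)
    rw [Real.one_rpow, one_mul] at this
    nlinarith
  · rw [min_eq_right (by linarith)]
    have := Real.geom_mean_le_arith_mean2_weighted (w₁ := 2 * c - 1) (w₂ := 2 - 2 * c)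
      (p₁ := t ^ 2) (p₂ := t) (by linarith) (by linarith) (by positivity) ht0.le (by ring)
    rw [← Real.rpow_natCast t 2, ← Real.rpow_mul ht0.le, ← Real.rpow_add ht0] at this
    have e : ((2 : ℕ) : ℝ) * (2 * c - 1) + (2 - 2 * c) = 2 * c := by push_cast; ring
    rw [e] at this
    have e2 : t ^ ((2 : ℕ) : ℝ) = t ^ 2 := Real.rpow_natCast t 2
    rw [e2] at this
    nlinarith

theorem rpow_sub_one_mul_le {c : ℝ} (hc : 0 < c) (hc1 : c < 1) {r : ℝ} (hr : 0 < r) :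
    (r ^ c - 1) * (r - 1) ≤ 2 * (1 + r ^ c) * (1 - √r) ^ 2 := by
  set t := √r with ht
  have ht0 : 0 < t := Real.sqrt_pos.2 hr
  have hrt : r = t ^ 2 := (Real.sq_sqrt hr.le).symm
  set y := r ^ c with hy
  have hy0 : 0 < y := Real.rpow_pos_of_pos hr c
  have e : (y - 1) * (t ^ 2 - 1) = ((y - 1) * (t + 1)) * (t - 1) := by ring
  rcases le_total 1 t with h | h
  · have hr1 : 1 ≤ r := by rw [hrt]; nlinarith
    have hyr : y ≤ t ^ 2 := by
      rw [← hrt]; exact Real.rpow_le_self_of_one_le hr1 hc1.le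
    rw [hrt, e]
    have : (y - 1) * (t + 1) ≤ 2 * (1 + y) * (t - 1) := by
      rcases le_total t 3 with h3 | h3
      · nlinarith [mul_nonneg (sub_nonneg.2 hyr) (sub_nonneg.2 h3), pow_nonneg (sub_nonneg.2 h) 3]
      · nlinarith [mul_nonneg hy0.le (sub_nonneg.2 h3)]
    nlinarith [mul_le_mul_of_nonneg_right this (sub_nonneg.2 h)]
  · have hr1 : r ≤ 1 := by rw [hrt]; nlinarith
    have hyr : t ^ 2 ≤ y := by
      rw [← hrt]; exact Real.self_le_rpow_of_le_one hr.le hr1 hc1.le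
    rw [hrt, e]
    have : (1 - y) * (t + 1) ≤ 2 * (1 + y) * (1 - t) := by
      nlinarith [mul_nonneg (sub_nonneg.2 hyr) (sub_nonneg.2 h), sq_nonneg (t - 1)]
    nlinarith [mul_le_mul_of_nonneg_right this (sub_nonneg.2 h)]

/-- The convexity constant of `(f, h) ↦ ‖f‖² h ^ (-c)`. -/
noncomputable def bregC (c : ℝ) : ℝ := min c (1 - c) / (min c (1 - c) + 2 * c)

theorem bregC_pos {c : ℝ} (hc : 0 < c) (hc1 : c < 1) : 0 < bregC c := by
  have : 0 < min c (1 - c) := lt_min hc (by linarith)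
  unfold bregC; positivity

theorem bregC_le_one {c : ℝ} (hc : 0 < c) (hc1 : c < 1) : bregC c ≤ 1 := by
  have : 0 < min c (1 - c) := lt_min hc (by linarith)
  unfold bregC
  rw [div_le_one (by positivity)]; linarith

theorem breg_scalar {c : ℝ} (hc : 0 < c) (hc1 : c < 1) {r : ℝ} (hr : 0 < r) :
    bregC c * (1 - r ^ c + c * r ^ c * (r - 1)) ≤ (1 + r ^ c) * (1 + c * (r - 1) - r ^ c) := by
  have h1 := sqrt_gap_le hc hc1 hr
  have h2 := rpow_sub_one_mul_le hc hc1 hr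
  have hm : 0 < min c (1 - c) := lt_min hc (by linarith)
  unfold bregC
  set m := min c (1 - c)
  set y := r ^ c with hy
  have hy0 : 0 < y := Real.rpow_pos_of_pos hr c
  set t := (1 - √r) ^ 2
  have ht : 0 ≤ t := sq_nonneg _
  set P := 1 + c * (r - 1) - y
  have hP : 0 ≤ P := le_trans (by positivity) h1
  have hQ : 1 - y + c * y * (r - 1) = P + c * ((y - 1) * (r - 1)) := by simp only [P]; ring
  rw [hQ, div_mul_eq_mul_div, div_le_iff₀ (by positivity)]
  have h3 : m * (c * ((y - 1) * (r - 1))) ≤ 2 * c * ((1 + y) * P) := by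
    calc m * (c * ((y - 1) * (r - 1))) ≤ m * (c * (2 * (1 + y) * t)) := by gcongr
      _ = 2 * c * ((1 + y) * (m * t)) := by ring
      _ ≤ _ := by gcongr
  nlinarith [mul_nonneg hm.le (mul_nonneg hy0.le hP)]

theorem breg_nonneg {c : ℝ} (hc : 0 < c) {r : ℝ} (hr : 0 < r) :
    0 ≤ 1 - r ^ c + c * r ^ c * (r - 1) := by
  have h := Real.geom_mean_le_arith_mean2_weighted (w₁ := 1 / (1 + c)) (w₂ := c / (1 + c))
    (p₁ := 1) (p₂ := r ^ (1 + c)) (by positivity) (by positivity) zero_le_one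
    (by positivity) (by field_simp)
  rw [Real.one_rpow, one_mul, ← Real.rpow_mul hr.le, mul_div_cancel₀ _ (by positivity),
    Real.rpow_add hr, Real.rpow_one] at h
  have : (1 + c) * r ^ c ≤ 1 + c * (r * r ^ c) := by
    calc (1 + c) * r ^ c ≤ (1 + c) * (1 / (1 + c) * 1 + c / (1 + c) * (r * r ^ c)) := by gcongr
      _ = _ := by field_simp
  nlinarith

theorem quadratic_form_nonneg {A B C p q z : ℝ} (hA : 0 < A) (h : B ^ 2 ≤ A * C)
    (hz : |z| ≤ p * q) : 0 ≤ A * p ^ 2 + 2 * B * z + C * q ^ 2 := by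
  have h1 : 0 ≤ A * (A * p ^ 2 + 2 * B * z + C * q ^ 2) := by
    have h2 : -(|B| * (p * q)) ≤ B * z := by
      have := neg_abs_le (B * z)
      rw [abs_mul] at this
      nlinarith [mul_le_mul_of_nonneg_left hz (abs_nonneg B)]
    nlinarith [sq_nonneg (A * p - |B| * q), sq_abs B, mul_le_mul_of_nonneg_right h (sq_nonneg q),
      mul_le_mul_of_nonneg_left h2 hA.le]
  exact nonneg_of_mul_nonneg_right h1 hA

theorem bregman {c : ℝ} (hc : 0 < c) (hc1 : c < 1) {h h0 : ℝ} (hh : 0 < h) (hh0 : 0 < h0)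
    (f f0 : ℂ) :
    bregC c * (‖f - f0‖ ^ 2 / (h ^ c + h0 ^ c)) ≤
      ‖f‖ ^ 2 * h ^ (-c) - ‖f0‖ ^ 2 * h0 ^ (-c) - 2 * inner ℝ f0 (f - f0) * h0 ^ (-c)
        + c * ‖f0‖ ^ 2 * h0 ^ (-c) * (h / h0 - 1) := by
  set d := f - f0 with hd
  have hf : f = f0 + d := by simp [hd]
  have hn : ‖f‖ ^ 2 = ‖f0‖ ^ 2 + 2 * inner ℝ f0 d + ‖d‖ ^ 2 := by
    rw [hf, norm_add_sq_real]
  have hz : |inner ℝ f0 d| ≤ ‖d‖ * ‖f0‖ := by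
    rw [mul_comm]; exact abs_real_inner_le_norm f0 d
  obtain ⟨r, hr, rfl⟩ : ∃ r : ℝ, 0 < r ∧ h = r * h0 := ⟨h / h0, by positivity, by field_simp⟩
  have hk := breg_scalar hc hc1 hr
  have hk2 := breg_nonneg hc hr
  have hb := bregC_pos hc hc1
  have hb1 := bregC_le_one hc hc1
  rw [Real.mul_rpow hr.le hh0.le, Real.mul_rpow hr.le hh0.le, Real.rpow_neg hh0.le,
    Real.rpow_neg hr.le, mul_div_cancel_right₀ _ hh0.ne', hn]
  have hY : 0 < h0 ^ c := Real.rpow_pos_of_pos hh0 c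
  have hy : 0 < r ^ c := Real.rpow_pos_of_pos hr c
  generalize h0 ^ c = Y at *
  generalize r ^ c = y at *
  generalize bregC c = κ at *
  generalize inner ℝ f0 d = z at *
  have hA : 0 < (1 + y - κ * y) / (y * (1 + y)) := by
    apply div_pos _ (by positivity)
    nlinarith
  have main := quadratic_form_nonneg (A := (1 + y - κ * y) / (y * (1 + y))) (B := (1 - y) / y)
    (C := (1 - y + c * y * (r - 1)) / y) hA ?_ hz
  · have : ‖d‖ ^ 2 / (y * Y + Y) = ‖d‖ ^ 2 / (1 + y) * Y⁻¹ := by field_simp; ring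
    rw [this, ← sub_nonneg]
    have e : (‖f0‖ ^ 2 + 2 * z + ‖d‖ ^ 2) * (y⁻¹ * Y⁻¹) - ‖f0‖ ^ 2 * Y⁻¹ - 2 * z * Y⁻¹ +
        c * ‖f0‖ ^ 2 * Y⁻¹ * (r - 1) - κ * (‖d‖ ^ 2 / (1 + y) * Y⁻¹) =
        ((1 + y - κ * y) / (y * (1 + y)) * ‖d‖ ^ 2 + 2 * ((1 - y) / y) * z +
          (1 - y + c * y * (r - 1)) / y * ‖f0‖ ^ 2) * Y⁻¹ := by
      field_simp; ring
    rw [e]; positivity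
  · rw [div_mul_div_comm, div_pow, div_le_div_iff₀ (by positivity) (by positivity)]
    nlinarith [mul_le_mul_of_nonneg_left hk (by positivity : 0 ≤ y ^ 3)]

end LacunaryHalfPlane

namespace LacunaryHalfPlane

open ProbabilityTheory ENNReal

section Abstract

variable {α : Type*} [MeasurableSpace α] {μ : Measure α}

theorem lintegral_mul_sq_le {f g : α → ℝ≥0∞} (hf : AEMeasurable f μ) (hg : AEMeasurable g μ) :
    (∫⁻ a, f a * g a ∂μ) ^ 2 ≤ (∫⁻ a, f a ^ 2 ∂μ) * ∫⁻ a, g a ^ 2 ∂μ := by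
  have h := ENNReal.lintegral_mul_norm_pow_le (p := 1 / 2) (q := 1 / 2) (hf.pow_const 2)
    (hg.pow_const 2) (by norm_num) (by norm_num) (by norm_num)
  have e : ∀ x : ℝ≥0∞, (x ^ 2) ^ (1 / 2 : ℝ) = x := fun x => by
    rw [← ENNReal.rpow_natCast, ← ENNReal.rpow_mul]; norm_num
  have e' : ∀ x : ℝ≥0∞, (x ^ (1 / 2 : ℝ)) ^ 2 = x := fun x => by
    rw [← ENNReal.rpow_natCast, ← ENNReal.rpow_mul]; norm_num
  simp_rw [e] at h
  calc _ ≤ ((∫⁻ a, f a ^ 2 ∂μ) ^ (1 / 2 : ℝ) * (∫⁻ a, g a ^ 2 ∂μ) ^ (1 / 2 : ℝ)) ^ 2 := by gcongr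
    _ = _ := by rw [mul_pow, e', e']

theorem lintegral_mul_sq_le_weighted {f g w : α → ℝ≥0∞} (hf : AEMeasurable f μ)
    (hg : AEMeasurable g μ) (hw : AEMeasurable w μ) (h0 : ∀ a, w a ≠ 0) (ht : ∀ a, w a ≠ ⊤) :
    (∫⁻ a, f a * g a ∂μ) ^ 2 ≤ (∫⁻ a, f a ^ 2 * w a ∂μ) * ∫⁻ a, g a ^ 2 * (w a)⁻¹ ∂μ := by
  have e' : ∀ x : ℝ≥0∞, (x ^ (1 / 2 : ℝ)) ^ 2 = x := fun x => by
    rw [← ENNReal.rpow_natCast, ← ENNReal.rpow_mul]; norm_num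
  have e2 : ∀ x : ℝ≥0∞, (x ^ (-(1 / 2) : ℝ)) ^ 2 = x⁻¹ := fun x => by
    rw [← ENNReal.rpow_natCast, ← ENNReal.rpow_mul, ← ENNReal.rpow_neg_one]; norm_num
  have := lintegral_mul_sq_le (hf.mul (hw.pow_const (1 / 2 : ℝ)))
    (hg.mul (hw.pow_const (-(1 / 2) : ℝ)))
  simp_rw [Pi.mul_apply, mul_pow, e', e2] at this
  refine le_trans (le_of_eq ?_) this
  congr 1
  refine lintegral_congr fun a => ?_
  rw [mul_mul_mul_comm, ← ENNReal.rpow_add _ _ (h0 a) (ht a)]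
  simp

theorem enorm_integral_sq_le [IsProbabilityMeasure μ] (φ : α → ℂ) (hφ : AEMeasurable φ μ) :
    ‖∫ a, φ a ∂μ‖ₑ ^ 2 ≤ ∫⁻ a, ‖φ a‖ₑ ^ 2 ∂μ := by
  have := lintegral_mul_sq_le (μ := μ) hφ.enorm (aemeasurable_const (b := (1 : ℝ≥0∞)))
  simp only [mul_one, one_pow, lintegral_const, measure_univ] at this
  refine le_trans ?_ this
  gcongr
  exact enorm_integral_le_lintegral_enorm _

theorem toReal_bounds {ε N : NNReal} (hε : 0 < ε) {h : ℝ≥0∞} (h1 : ε ≤ h) (h2 : h ≤ N) :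
    h ≠ 0 ∧ h ≠ ⊤ ∧ (ε : ℝ) ≤ h.toReal ∧ h.toReal ≤ N ∧ 0 < h.toReal := by
  have ht : h ≠ ⊤ := ne_top_of_le_ne_top ENNReal.coe_ne_top h2
  have h0 : h ≠ 0 := (lt_of_lt_of_le (by simpa using hε) h1).ne'
  lift h to NNReal using ht
  simp only [ENNReal.coe_le_coe, ENNReal.coe_toReal] at *
  refine ⟨h0, by simp, h1, h2, lt_of_lt_of_le hε h1⟩

theorem lintegral_bounds [IsProbabilityMeasure μ] {ε N : ℝ≥0∞} {H : α → ℝ≥0∞}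
    (h1 : ∀ a, ε ≤ H a) (h2 : ∀ a, H a ≤ N) : ε ≤ ∫⁻ a, H a ∂μ ∧ ∫⁻ a, H a ∂μ ≤ N := by
  constructor
  · calc ε = ∫⁻ a, ε ∂μ := by simp
      _ ≤ _ := lintegral_mono h1
  · calc _ ≤ ∫⁻ a, N ∂μ := lintegral_mono h2
      _ = N := by simp

theorem integrable_of_le [IsFiniteMeasure μ] {f : α → ℝ} (hf : Measurable f) {C : ℝ}
    (h : ∀ a, |f a| ≤ C) : Integrable f μ :=
  Integrable.of_bound hf.aestronglyMeasurable C (ae_of_all _ h)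

theorem energy_gap [IsProbabilityMeasure μ] {c : ℝ} (hc : 0 < c) (hc1 : c < 1) {φ : α → ℂ}
    (hφ : Measurable φ) {M : ℝ} (hM : ∀ a, ‖φ a‖ ≤ M) {H : α → ℝ≥0∞} (hH : Measurable H)
    {ε N : NNReal} (hε : 0 < ε) (h1 : ∀ a, ε ≤ H a) (h2 : ∀ a, H a ≤ N) :
    ENNReal.ofReal (bregC c) * ∫⁻ a, ‖φ a - ∫ b, φ b ∂μ‖ₑ ^ 2 *
        (H a ^ c + (∫⁻ b, H b ∂μ) ^ c)⁻¹ ∂μ + ‖∫ b, φ b ∂μ‖ₑ ^ 2 * (∫⁻ b, H b ∂μ) ^ (-c) ≤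
      ∫⁻ a, ‖φ a‖ₑ ^ 2 * H a ^ (-c) ∂μ := by
  set φ0 := ∫ b, φ b ∂μ with hφ0
  set H0 := ∫⁻ b, H b ∂μ with hH0
  obtain ⟨hl, hu⟩ := lintegral_bounds (μ := μ) h1 h2
  obtain ⟨hn0, hnt, -, -, hp0⟩ := toReal_bounds hε hl hu
  have hb := fun a => toReal_bounds hε (h1 a) (h2 a)
  set χ0 := H0.toReal with hχ0
  have hφi : Integrable φ μ := Integrable.of_bound hφ.aestronglyMeasurable M (ae_of_all _ hM)
  have hχi : Integrable (fun a => (H a).toReal) μ := by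
    refine integrable_of_le (by fun_prop) (C := N) fun a => ?_
    rw [abs_of_pos (hb a).2.2.2.2]; exact (hb a).2.2.2.1
  have hχint : ∫ a, (H a).toReal ∂μ = χ0 :=
    integral_toReal hH.aemeasurable (ae_of_all _ fun a => (hb a).2.1.lt_top)
  have hr : ∀ a, (H a).toReal ^ (-c) ≤ (ε : ℝ) ^ (-c) := fun a =>
    Real.rpow_le_rpow_of_nonpos (by exact_mod_cast hε) (hb a).2.2.1 (by linarith)
  have hr0 : ∀ a, 0 ≤ (H a).toReal ^ (-c) := fun a => by positivity
  have hM0 : ∀ a : α, 0 ≤ M := fun a => (norm_nonneg _).trans (hM a)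
  have i1 : Integrable (fun a => ‖φ a‖ ^ 2 * (H a).toReal ^ (-c)) μ := by
    refine integrable_of_le (by fun_prop) (C := M ^ 2 * (ε : ℝ) ^ (-c)) fun a => ?_
    rw [abs_of_nonneg (mul_nonneg (by positivity) (hr0 a))]
    exact mul_le_mul (pow_le_pow_left₀ (norm_nonneg _) (hM a) 2) (hr a) (hr0 a) (sq_nonneg _)
  have i2 : Integrable (fun a => inner ℝ φ0 (φ a - φ0)) μ :=
    (hφi.sub (integrable_const φ0)).const_inner φ0
  have z2 : ∫ a, inner ℝ φ0 (φ a - φ0) ∂μ = 0 := by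
    rw [integral_inner (f := fun a => φ a - φ0) (hφi.sub (integrable_const φ0)), integral_sub hφi (integrable_const _)]
    simp [← hφ0]
  have i3 : Integrable (fun a => (H a).toReal / χ0 - 1) μ :=
    (hχi.div_const _).sub (integrable_const _)
  have z3 : ∫ a, ((H a).toReal / χ0 - 1) ∂μ = 0 := by
    rw [integral_sub (hχi.div_const _) (integrable_const _), integral_div, hχint, div_self hp0.ne']
    simp
  have hA0 : ∀ a, 0 ≤ ‖φ a - φ0‖ ^ 2 / ((H a).toReal ^ c + χ0 ^ c) := fun a => by positivity
  have i4 : Integrable (fun a => ‖φ a - φ0‖ ^ 2 / ((H a).toReal ^ c + χ0 ^ c)) μ := by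
    refine integrable_of_le (by fun_prop) (C := (M + ‖φ0‖) ^ 2 / χ0 ^ c) fun a => ?_
    rw [abs_of_nonneg (hA0 a)]
    have h0 : 0 ≤ (H a).toReal ^ c := by positivity
    have hp : 0 < χ0 ^ c := by positivity
    refine div_le_div₀ (sq_nonneg _) ?_ hp (by linarith)
    exact pow_le_pow_left₀ (norm_nonneg _) ((norm_sub_le _ _).trans (by linarith [hM a])) 2
  have key : bregC c * (∫ a, ‖φ a - φ0‖ ^ 2 / ((H a).toReal ^ c + χ0 ^ c) ∂μ) +
      ‖φ0‖ ^ 2 * χ0 ^ (-c) ≤ ∫ a, ‖φ a‖ ^ 2 * (H a).toReal ^ (-c) ∂μ := by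
    have hmono := integral_mono (i4.const_mul (bregC c))
      (((i1.sub (integrable_const (‖φ0‖ ^ 2 * χ0 ^ (-c)))).sub
        ((i2.const_mul 2).mul_const (χ0 ^ (-c)))).add
        (i3.const_mul (c * ‖φ0‖ ^ 2 * χ0 ^ (-c))))
      (fun a => bregman hc hc1 (hb a).2.2.2.2 hp0 (φ a) φ0)
    simp only [Pi.add_apply, Pi.sub_apply] at hmono
    rw [integral_const_mul, integral_add (by fun_prop) (by fun_prop), integral_sub (by fun_prop)
      (by fun_prop), integral_sub (by fun_prop) (by fun_prop), integral_const_mul,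
      integral_const_mul (c * ‖φ0‖ ^ 2 * χ0 ^ (-c)), integral_mul_const, integral_const_mul 2, z2, z3] at hmono
    simp at hmono
    linarith
  have hbc := (bregC_pos hc hc1).le
  have c1 : ENNReal.ofReal (∫ a, ‖φ a - φ0‖ ^ 2 / ((H a).toReal ^ c + χ0 ^ c) ∂μ) =
      ∫⁻ a, ‖φ a - φ0‖ₑ ^ 2 * (H a ^ c + H0 ^ c)⁻¹ ∂μ := by
    rw [ofReal_integral_eq_lintegral_ofReal i4 (ae_of_all _ hA0)]
    refine lintegral_congr fun a => ?_
    have hpos : 0 < (H a).toReal ^ c + χ0 ^ c := by positivity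
    rw [ENNReal.ofReal_div_of_pos hpos, ENNReal.ofReal_add (by positivity) (by positivity),
      ENNReal.ofReal_pow (norm_nonneg _), ofReal_norm, div_eq_mul_inv,
      ← ENNReal.ofReal_rpow_of_nonneg (by positivity) hc.le,
      ← ENNReal.ofReal_rpow_of_nonneg (by positivity) hc.le, ENNReal.ofReal_toReal (hb a).2.1,
      ENNReal.ofReal_toReal hnt]
  have c2 : ENNReal.ofReal (‖φ0‖ ^ 2 * χ0 ^ (-c)) = ‖φ0‖ₑ ^ 2 * H0 ^ (-c) := by
    rw [ENNReal.ofReal_mul (by positivity), ENNReal.ofReal_pow (norm_nonneg _), ofReal_norm,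
      ← ENNReal.ofReal_rpow_of_pos hp0, ENNReal.ofReal_toReal hnt]
  have c3 : ENNReal.ofReal (∫ a, ‖φ a‖ ^ 2 * (H a).toReal ^ (-c) ∂μ) =
      ∫⁻ a, ‖φ a‖ₑ ^ 2 * H a ^ (-c) ∂μ := by
    rw [ofReal_integral_eq_lintegral_ofReal i1 (ae_of_all _ fun a => by positivity)]
    refine lintegral_congr fun a => ?_
    rw [ENNReal.ofReal_mul (by positivity), ENNReal.ofReal_pow (norm_nonneg _), ofReal_norm,
      ← ENNReal.ofReal_rpow_of_pos (hb a).2.2.2.2, ENNReal.ofReal_toReal (hb a).2.1]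
  rw [← c1, ← c2, ← c3, ← ENNReal.ofReal_mul hbc, ← ENNReal.ofReal_add
    (mul_nonneg hbc (integral_nonneg hA0)) (by positivity)]
  exact ENNReal.ofReal_le_ofReal key

end Abstract

end LacunaryHalfPlane

namespace LacunaryHalfPlane

open ProbabilityTheory ENNReal

/-- Bounded measurable functions. -/
structure BddM (F : ℝ × ℝ → ℂ) : Prop where
  meas : Measurable F
  bdd : ∃ C : ℝ, ∀ x, ‖F x‖ ≤ C

/-- The Gaussian average with variance `v` in the direction `e`. -/
noncomputable def heatC (e : ℝ × ℝ) (v : ℝ) (F : ℝ × ℝ → ℂ) (x : ℝ × ℝ) : ℂ :=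
  ∫ s, F (x + (√v * s) • e) ∂stdG

/-- The normalized derivative of the Gaussian average with variance `v` in the direction `e`. -/
noncomputable def derC (e : ℝ × ℝ) (v : ℝ) (F : ℝ × ℝ → ℂ) (x : ℝ × ℝ) : ℂ :=
  ∫ s, (s : ℂ) * F (x + (√v * s) • e) ∂stdG

theorem measurable_derC_aux {e : ℝ × ℝ} {F : ℝ × ℝ → ℂ} (hF : Measurable F) :
    Measurable fun p : (ℝ × (ℝ × ℝ)) => derC e p.1 F p.2 := by
  have : StronglyMeasurable fun q : (ℝ × (ℝ × ℝ)) × ℝ =>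
      (q.2 : ℂ) * F (q.1.2 + (√q.1.1 * q.2) • e) := Measurable.stronglyMeasurable (by fun_prop)
  exact this.integral_prod_right'.measurable

theorem measurable_heatC_aux {e : ℝ × ℝ} {F : ℝ × ℝ → ℂ} (hF : Measurable F) :
    Measurable fun p : (ℝ × (ℝ × ℝ)) => heatC e p.1 F p.2 := by
  have : StronglyMeasurable fun q : (ℝ × (ℝ × ℝ)) × ℝ =>
      F (q.1.2 + (√q.1.1 * q.2) • e) := Measurable.stronglyMeasurable (by fun_prop)
  exact this.integral_prod_right'.measurable

theorem integrable_id_stdG : Integrable (fun s : ℝ => s) stdG := by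
  have := memLp_id_gaussianReal (μ := 0) (v := 1) 1
  exact (memLp_one_iff_integrable.1 this)

theorem integrable_sq_stdG : Integrable (fun s : ℝ => s ^ 2) stdG := by
  have := memLp_id_gaussianReal (μ := 0) (v := 1) 2
  exact this.integrable_sq

theorem lintegral_sq_stdG : ∫⁻ s, ENNReal.ofReal (s ^ 2) ∂stdG = 1 := by
  have h := variance_id_gaussianReal (μ := 0) (v := 1)
  rw [variance_of_integral_eq_zero aemeasurable_id (by simp)] at h
  rw [← ofReal_integral_eq_lintegral_ofReal integrable_sq_stdG (ae_of_all _ fun s => sq_nonneg s)]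
  simp only [id] at h
  rw [h]; simp

theorem enorm_ofReal_sq (s : ℝ) : ‖(s : ℂ)‖ₑ ^ 2 = ENNReal.ofReal (s ^ 2) := by
  rw [← ofReal_norm, ← ENNReal.ofReal_pow (norm_nonneg _)]
  simp

variable {e e' : ℝ × ℝ} {u v : ℝ} {F K : ℝ × ℝ → ℂ}

theorem integrable_derC_aux (hF : BddM F) (x : ℝ × ℝ) :
    Integrable (fun s : ℝ => (s : ℂ) * F (x + (√v * s) • e)) stdG := by
  obtain ⟨C, hC⟩ := hF.bdd
  have hm := hF.meas
  have h1 : Integrable (fun s : ℝ => (s : ℂ)) stdG := integrable_id_stdG.ofReal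
  exact h1.mul_bdd (c := C) (Measurable.aestronglyMeasurable (by fun_prop)) (ae_of_all _ fun _ => hC _)

theorem integrable_heatC_aux (hF : BddM F) (x : ℝ × ℝ) :
    Integrable (fun s : ℝ => F (x + (√v * s) • e)) stdG := by
  obtain ⟨C, hC⟩ := hF.bdd
  have hm := hF.meas
  exact Integrable.of_bound (Measurable.aestronglyMeasurable (by fun_prop)) C
    (ae_of_all _ fun _ => hC _)

theorem BddM.heatC (hF : BddM F) : BddM (heatC e v F) := by
  refine ⟨(measurable_heatC_aux (e := e) hF.meas).comp (by fun_prop : Measurable fun x : ℝ × ℝ => (v, x)), ?_⟩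
  obtain ⟨C, hC⟩ := hF.bdd
  refine ⟨C, fun x => ?_⟩
  simpa [LacunaryHalfPlane.heatC] using norm_integral_le_of_norm_le_const (μ := stdG)
    (f := fun s => F (x + (√v * s) • e)) (C := C) (ae_of_all _ fun _ => hC _)

theorem BddM.derC (hF : BddM F) : BddM (derC e v F) := by
  refine ⟨(measurable_derC_aux (e := e) hF.meas).comp (by fun_prop : Measurable fun x : ℝ × ℝ => (v, x)), ?_⟩
  obtain ⟨C, hC⟩ := hF.bdd
  refine ⟨∫ s, |s| * C ∂stdG, fun x => ?_⟩
  refine norm_integral_le_of_norm_le (integrable_id_stdG.abs.mul_const C) (ae_of_all _ fun s => ?_)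
  rw [norm_mul, Complex.norm_real, Real.norm_eq_abs]
  gcongr
  exact hC _

theorem enorm_heatC_le (x : ℝ × ℝ) : ‖heatC e v F x‖ₑ ≤ heatL e v (fun y => ‖F y‖ₑ) x :=
  enorm_integral_le_lintegral_enorm _

theorem enorm_derC_sq_le (hF : Measurable F) (hv : 0 < v) (x : ℝ × ℝ) :
    ‖derC e v F x‖ₑ ^ 2 ≤ 3 * heatL e (2 * v) (fun y => ‖F y‖ₑ ^ 2) x := by
  refine (enorm_integral_sq_le _ (by fun_prop)).trans ?_
  simp_rw [enorm_mul, mul_pow, enorm_ofReal_sq]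
  exact lintegral_stdG_sq_le hv (φ := fun r => ‖F (x + r • e)‖ₑ ^ 2) (by fun_prop)

theorem lintegral_stdG_abs_le {v : ℝ} (hv : 0 < v) {φ : ℝ → ℝ≥0∞} (hφ : Measurable φ) :
    ∫⁻ s, ‖(s : ℂ)‖ₑ * φ (√v * s) ∂stdG ≤ 3 * ∫⁻ s, φ (√(2 * v) * s) ∂stdG := by
  have h1 : ∀ s : ℝ, ‖(s : ℂ)‖ₑ ≤ ENNReal.ofReal (1 / 2) + ENNReal.ofReal (1 / 2) * ENNReal.ofReal (s ^ 2) := by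
    intro s
    rw [← ENNReal.ofReal_mul (by norm_num), ← ENNReal.ofReal_add (by norm_num) (by positivity),
      ← ofReal_norm]
    apply ENNReal.ofReal_le_ofReal
    rw [Complex.norm_real, Real.norm_eq_abs]
    nlinarith [sq_nonneg (|s| - 1), sq_abs s]
  have h2 := lintegral_stdG_sq_le hv hφ
  have h3 := lintegral_stdG_le hv (by linarith : v ≤ 2 * v) hφ
  set A := ∫⁻ s, φ (√(2 * v) * s) ∂stdG
  have h4 : ENNReal.ofReal √(2 * v / v) ≤ 3 := by
    rw [mul_div_cancel_right₀ _ hv.ne']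
    have : (3 : ℝ≥0∞) = ENNReal.ofReal 3 := by norm_num
    rw [this]
    apply ENNReal.ofReal_le_ofReal
    rw [Real.sqrt_le_left (by norm_num)]; norm_num
  calc _ ≤ ∫⁻ s, (ENNReal.ofReal (1 / 2) * φ (√v * s) +
        ENNReal.ofReal (1 / 2) * (ENNReal.ofReal (s ^ 2) * φ (√v * s))) ∂stdG := by
        refine lintegral_mono fun s => ?_
        rw [← mul_assoc, ← add_mul]
        exact mul_le_mul_left (h1 s) _
    _ = ENNReal.ofReal (1 / 2) * ∫⁻ s, φ (√v * s) ∂stdG +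
        ENNReal.ofReal (1 / 2) * ∫⁻ s, ENNReal.ofReal (s ^ 2) * φ (√v * s) ∂stdG := by
        rw [lintegral_add_left (by fun_prop), lintegral_const_mul _ (by fun_prop),
          lintegral_const_mul _ (by fun_prop)]
    _ ≤ ENNReal.ofReal (1 / 2) * (3 * A) + ENNReal.ofReal (1 / 2) * (3 * A) := by
        gcongr
        exact h3.trans (mul_le_mul_left h4 _)
    _ = 3 * A := by
        rw [← add_mul, ← ENNReal.ofReal_add (by norm_num) (by norm_num)]; norm_num

theorem enorm_derC_le (hF : Measurable F) (hv : 0 < v) (x : ℝ × ℝ) :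
    ‖derC e v F x‖ₑ ≤ 3 * heatL e (2 * v) (fun y => ‖F y‖ₑ) x := by
  refine (enorm_integral_le_lintegral_enorm _).trans ?_
  simp_rw [enorm_mul]
  exact lintegral_stdG_abs_le hv (φ := fun r => ‖F (x + r • e)‖ₑ) (by fun_prop)

theorem integral_stdG_comp_add {u v : ℝ} (hu : 0 ≤ u) (hv : 0 ≤ v) {φ : ℝ → ℂ}
    (hφ : Measurable φ) {C : ℝ} (hC : ∀ s, ‖φ s‖ ≤ C) :
    ∫ s, ∫ t, φ (√u * s + √v * t) ∂stdG ∂stdG = ∫ s, φ (√(u + v) * s) ∂stdG := by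
  have hmap : (stdG.prod stdG).map (fun p : ℝ × ℝ => √u * p.1 + √v * p.2) =
      stdG.map (fun s => √(u + v) * s) := by
    ext s hs
    have := lintegral_stdG_comp_add hu hv (φ := s.indicator 1) (measurable_one.indicator hs)
    rw [← lintegral_indicator_one hs, ← lintegral_indicator_one hs,
      lintegral_map (measurable_one.indicator hs) (by fun_prop),
      lintegral_map (measurable_one.indicator hs) (by fun_prop), ← this, lintegral_prod]
    exact ((measurable_one.indicator hs).comp (by fun_prop)).aemeasurable
  have hinner : Integrable (fun p : ℝ × ℝ => φ (√u * p.1 + √v * p.2)) (stdG.prod stdG) :=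
    Integrable.of_bound (Measurable.aestronglyMeasurable (by fun_prop)) C (ae_of_all _ fun _ => hC _)
  rw [← integral_prod _ hinner,
    ← integral_map (φ := fun s => √(u + v) * s) (by fun_prop) hφ.aestronglyMeasurable, ← hmap,
    integral_map (by fun_prop) hφ.aestronglyMeasurable]

theorem heatC_heatC (hu : 0 ≤ u) (hv : 0 ≤ v) (hF : BddM F) (x : ℝ × ℝ) :
    heatC e u (heatC e v F) x = heatC e (u + v) F x := by
  obtain ⟨C, hC⟩ := hF.bdd
  have hm := hF.meas
  unfold heatC
  rw [← integral_stdG_comp_add hu hv (φ := fun r => F (x + r • e)) (by fun_prop) (fun _ => hC _)]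
  simp_rw [add_smul, add_assoc]

theorem integral_derC_mul (hF : BddM F) (hK : BddM K) (hi : Integrable K) :
    ∫ x, derC e v F x * K x = -∫ x, F x * derC e v K x := by
  obtain ⟨C, hC⟩ := hF.bdd
  have hm := hF.meas
  have hkm := hK.meas
  have h1 : ∀ x, derC e v F x * K x = ∫ s : ℝ, (s : ℂ) * F (x + (√v * s) • e) * K x ∂stdG :=
    fun x => (integral_mul_const _ _).symm
  have hneg : ∀ φ : ℝ → ℂ, Measurable φ → ∫ s, φ (-s) ∂stdG = ∫ s, φ s ∂stdG := by
    intro φ hφ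
    have h := gaussianReal_map_neg (μ := 0) (v := 1)
    rw [neg_zero] at h
    calc ∫ s, φ (-s) ∂stdG = ∫ s, φ s ∂(Measure.map (fun x => -x) (gaussianReal 0 1)) :=
          (integral_map (by fun_prop) hφ.aestronglyMeasurable).symm
      _ = _ := by rw [h]
  have h2 : ∀ x, F x * derC e v K x = ∫ s : ℝ, -((s : ℂ) * F x * K (x - (√v * s) • e)) ∂stdG := by
    intro x
    rw [derC, ← integral_const_mul, ← hneg _ (by fun_prop)]
    congr 1; ext s
    push_cast
    rw [mul_neg, neg_smul, ← sub_eq_add_neg]; ring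
  simp_rw [h1, h2, integral_neg, neg_neg]
  have hs : Integrable (fun s : ℝ => (s : ℂ)) stdG := integrable_id_stdG.ofReal
  have i1 : Integrable (Function.uncurry fun (x : ℝ × ℝ) (s : ℝ) =>
      (s : ℂ) * F (x + (√v * s) • e) * K x) (volume.prod stdG) := by
    have h := (hi.mul_prod hs).mul_bdd (g := fun p : (ℝ × ℝ) × ℝ => F (p.1 + (√v * p.2) • e)) (c := C)
      (Measurable.aestronglyMeasurable (by fun_prop)) (ae_of_all _ fun _ => hC _)
    refine h.congr (ae_of_all _ fun p => ?_)
    simp only [Function.uncurry]; ring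
  have i2 : Integrable (Function.uncurry fun (x : ℝ × ℝ) (s : ℝ) =>
      (s : ℂ) * F x * K (x - (√v * s) • e)) (volume.prod stdG) := by
    have hmp : MeasurePreserving (fun p : (ℝ × ℝ) × ℝ => (p.1 + (√v * p.2) • e, p.2))
        (volume.prod stdG) (volume.prod stdG) := by
      refine ⟨by fun_prop, ?_⟩
      ext A hA
      rw [Measure.map_apply (by fun_prop) hA, Measure.prod_apply_symm hA,
        Measure.prod_apply_symm (by exact (by fun_prop : Measurable fun p : (ℝ × ℝ) × ℝ =>
          (p.1 + (√v * p.2) • e, p.2)) hA)]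
      refine lintegral_congr fun s => ?_
      exact measure_preimage_add_right volume ((√v * s) • e) ((fun x => (x, s)) ⁻¹' A)
    refine (hmp.integrable_comp (Measurable.aestronglyMeasurable (by
      simp only [Function.uncurry_def]; fun_prop))).1 ?_
    refine i1.congr (ae_of_all _ fun p => ?_)
    simp [Function.uncurry]
  rw [integral_integral_swap i1]
  conv_rhs => rw [integral_integral_swap i2]
  congr 1; ext s
  rw [← integral_add_right_eq_self (fun x => (s : ℂ) * F x * K (x - (√v * s) • e)) ((√v * s) • e)]
  simp

end LacunaryHalfPlane

namespace LacunaryHalfPlane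

open ProbabilityTheory ENNReal

/-- Measurable weights bounded above and below by positive constants. -/
structure Wt (H : ℝ × ℝ → ℝ≥0∞) : Prop where
  meas : Measurable H
  bds : ∃ ε N : NNReal, 0 < ε ∧ (∀ x, ε ≤ H x) ∧ ∀ x, H x ≤ N

variable {e e' : ℝ × ℝ} {u v : ℝ} {F K : ℝ × ℝ → ℂ} {H : ℝ × ℝ → ℝ≥0∞}

theorem Wt.ne_zero (hH : Wt H) (x : ℝ × ℝ) : H x ≠ 0 := by
  obtain ⟨ε, N, hε, h1, h2⟩ := hH.bds
  exact (toReal_bounds hε (h1 x) (h2 x)).1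

theorem Wt.ne_top (hH : Wt H) (x : ℝ × ℝ) : H x ≠ ⊤ := by
  obtain ⟨ε, N, hε, h1, h2⟩ := hH.bds
  exact (toReal_bounds hε (h1 x) (h2 x)).2.1

theorem Wt.heatL (hH : Wt H) : Wt (heatL e v H) := by
  obtain ⟨ε, N, hε, h1, h2⟩ := hH.bds
  have hm := hH.meas
  exact ⟨by fun_prop, ε, N, hε, fun x => (lintegral_bounds (fun _ => h1 _) (fun _ => h2 _)).1,
    fun x => (lintegral_bounds (fun _ => h1 _) (fun _ => h2 _)).2⟩

theorem Wt.inv (hH : Wt H) : Wt (fun x => (H x)⁻¹) := by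
  obtain ⟨ε, N, hε, h1, h2⟩ := hH.bds
  have hm := hH.meas
  have hN : 0 < N := by
    have := (h1 0).trans (h2 0)
    exact hε.trans_le (by exact_mod_cast this)
  refine ⟨by fun_prop, N⁻¹, ε⁻¹, by positivity, fun x => ?_, fun x => ?_⟩
  · rw [ENNReal.coe_inv hN.ne']; exact ENNReal.inv_le_inv.2 (h2 x)
  · rw [ENNReal.coe_inv hε.ne']; exact ENNReal.inv_le_inv.2 (h1 x)

theorem one_step {c : ℝ} (hc : 0 < c) (hc1 : c < 1) (hF : BddM F) (hH : Wt H) (hv : 0 < v)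
    (x : ℝ × ℝ) :
    ENNReal.ofReal (bregC c) * (‖derC e v F x‖ₑ ^ 2 * heatL e (2 * v) H x ^ (-c)) +
      5 * (‖heatC e v F x‖ₑ ^ 2 * heatL e v H x ^ (-c)) ≤
      5 * heatL e v (fun y => ‖F y‖ₑ ^ 2 * H y ^ (-c)) x := by
  obtain ⟨C, hC⟩ := hF.bdd
  have hm := hF.meas
  obtain ⟨ε, N, hε, h1, h2⟩ := hH.bds
  have hHm := hH.meas
  have gap := energy_gap (μ := stdG) hc hc1 (φ := fun s => F (x + (√v * s) • e)) (by fun_prop)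
    (fun _ => hC _) (H := fun s => H (x + (√v * s) • e)) (by fun_prop) hε (fun _ => h1 _)
    (fun _ => h2 _)
  have hφ0 : ∫ s, F (x + (√v * s) • e) ∂stdG = heatC e v F x := rfl
  have hH0 : ∫⁻ s, H (x + (√v * s) • e) ∂stdG = heatL e v H x := rfl
  have hR : ∫⁻ s, ‖F (x + (√v * s) • e)‖ₑ ^ 2 * H (x + (√v * s) • e) ^ (-c) ∂stdG =
    heatL e v (fun y => ‖F y‖ₑ ^ 2 * H y ^ (-c)) x := rfl
  rw [hφ0, hH0, hR] at gap
  set A := ∫⁻ s, ‖F (x + (√v * s) • e) - heatC e v F x‖ₑ ^ 2 *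
    (H (x + (√v * s) • e) ^ c + heatL e v H x ^ c)⁻¹ ∂stdG with hA
  set G := heatL e (2 * v) H x with hG
  have hG0 : G ≠ 0 := hH.heatL.ne_zero x
  have hGt : G ≠ ⊤ := hH.heatL.ne_top x
  have hder : derC e v F x = ∫ s : ℝ, (s : ℂ) * (F (x + (√v * s) • e) - heatC e v F x) ∂stdG := by
    simp_rw [mul_sub]
    rw [integral_sub (integrable_derC_aux hF x) (by
      exact (integrable_id_stdG.ofReal (𝕜 := ℂ)).mul_const _), integral_mul_const]
    have : ∫ s : ℝ, (s : ℂ) ∂stdG = 0 := by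
      have h := integral_ofReal (𝕜 := ℂ) (μ := stdG) (f := fun s : ℝ => s)
      refine h.trans ?_
      simp
    rw [this]; simp [derC]
  have hle : heatL e v H x ≤ 2 * G := by
    refine (heatL_le hv (by linarith : v ≤ 2 * v) hHm x).trans ?_
    gcongr
    rw [mul_div_cancel_right₀ _ hv.ne']
    have : (2 : ℝ≥0∞) = ENNReal.ofReal 2 := by norm_num
    rw [this]
    apply ENNReal.ofReal_le_ofReal
    rw [Real.sqrt_le_left (by norm_num)]; norm_num
  have hw : ∫⁻ s, ‖(s : ℂ)‖ₑ ^ 2 * (H (x + (√v * s) • e) ^ c + heatL e v H x ^ c) ∂stdG ≤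
      5 * G ^ c := by
    simp_rw [mul_add, enorm_ofReal_sq]
    rw [lintegral_add_left (by fun_prop), lintegral_mul_const _ (by fun_prop), lintegral_sq_stdG,
      one_mul]
    have b1 := lintegral_stdG_sq_le hv (φ := fun r => H (x + r • e) ^ c) (by fun_prop)
    have b2 : ∫⁻ s, H (x + (√(2 * v) * s) • e) ^ c ∂stdG ≤ G ^ c :=
      heatL_rpow_le hHm hc.le hc1.le x
    have b3 : heatL e v H x ^ c ≤ 2 * G ^ c := by
      calc _ ≤ (2 * G) ^ c := by gcongr
        _ = 2 ^ c * G ^ c := ENNReal.mul_rpow_of_nonneg _ _ hc.le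
        _ ≤ 2 ^ (1 : ℝ) * G ^ c := by
          gcongr
          norm_num
        _ = _ := by rw [ENNReal.rpow_one]
    calc _ ≤ 3 * G ^ c + 2 * G ^ c := by
          gcongr
          exact b1.trans (by gcongr)
      _ = _ := by rw [← add_mul]; norm_num
  have hH1 := fun s : ℝ => hH.ne_zero (x + (√v * s) • e)
  have hH2 := fun s : ℝ => hH.ne_top (x + (√v * s) • e)
  have cs : ‖derC e v F x‖ₑ ^ 2 ≤ 5 * G ^ c * A := by
    have hhm : Measurable (heatC e v F) := hF.heatC.meas
    have h0 := lintegral_mul_sq_le_weighted (μ := stdG)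
      (f := fun s : ℝ => ‖(s : ℂ)‖ₑ) (g := fun s => ‖F (x + (√v * s) • e) - heatC e v F x‖ₑ)
      (w := fun s => H (x + (√v * s) • e) ^ c + heatL e v H x ^ c) (by fun_prop) (by fun_prop)
      (by fun_prop) (fun s => by simp [hH1 s, hH2 s, hc])
      (fun s => by
        simp [hH1 s, hH2 s, hc.le, hc, (hH.heatL (e := e) (v := v)).ne_top x])
    calc ‖derC e v F x‖ₑ ^ 2 ≤ (∫⁻ s : ℝ, ‖(s : ℂ)‖ₑ *
          ‖F (x + (√v * s) • e) - heatC e v F x‖ₑ ∂stdG) ^ 2 := by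
          rw [hder]
          gcongr
          refine (enorm_integral_le_lintegral_enorm _).trans (le_of_eq ?_)
          simp_rw [enorm_mul]
      _ ≤ _ := h0
      _ ≤ _ := by
        gcongr
  calc _ ≤ ENNReal.ofReal (bregC c) * (5 * G ^ c * A * G ^ (-c)) +
        5 * (‖heatC e v F x‖ₑ ^ 2 * heatL e v H x ^ (-c)) := by gcongr
    _ = 5 * (ENNReal.ofReal (bregC c) * A + ‖heatC e v F x‖ₑ ^ 2 * heatL e v H x ^ (-c)) := by
        have : G ^ c * G ^ (-c) = 1 := by rw [← ENNReal.rpow_add _ _ hG0 hGt]; simp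
        calc _ = 5 * (ENNReal.ofReal (bregC c) * A * (G ^ c * G ^ (-c)) +
              ‖heatC e v F x‖ₑ ^ 2 * heatL e v H x ^ (-c)) := by ring
          _ = _ := by rw [this, mul_one]
    _ ≤ _ := by gcongr

theorem one_step_integral {c : ℝ} (hc : 0 < c) (hc1 : c < 1) (hF : BddM F) (hH : Wt H)
    (hv : 0 < v) :
    ENNReal.ofReal (bregC c) * (∫⁻ x, ‖derC e v F x‖ₑ ^ 2 * heatL e (2 * v) H x ^ (-c)) +
      5 * (∫⁻ x, ‖heatC e v F x‖ₑ ^ 2 * heatL e v H x ^ (-c)) ≤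
      5 * ∫⁻ x, ‖F x‖ₑ ^ 2 * H x ^ (-c) := by
  have hm := hF.meas
  have hHm := hH.meas
  have m1 : Measurable (derC e v F) := hF.derC.meas
  have m2 : Measurable (heatC e v F) := hF.heatC.meas
  have := lintegral_mono (μ := volume) fun x => one_step (e := e) hc hc1 hF hH hv x
  rwa [lintegral_add_left (by fun_prop), lintegral_const_mul _ (by fun_prop),
    lintegral_const_mul _ (by fun_prop), lintegral_const_mul _ (by fun_prop),
    lintegral_heatL (by fun_prop)] at this

/-- The building block of the square function. -/
noncomputable def sqB (e : ℝ × ℝ) (v : ℝ) (F : ℝ × ℝ → ℂ) : ℝ × ℝ → ℂ :=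
  derC e (3 * v) (heatC e v F)

theorem BddM.sqB (hF : BddM F) : BddM (sqB e v F) := hF.heatC.derC

theorem sum_range_sqB_le {c : ℝ} (hc : 0 < c) (hc1 : c < 1) (hF : BddM F) (hH : Wt H)
    (hv : 0 < v) (n : ℕ) :
    ENNReal.ofReal (bregC c) * (∑ k ∈ Finset.range n, ∫⁻ x, ‖sqB e (4 ^ k * v) F x‖ₑ ^ 2 *
        heatL e (7 * (4 ^ k * v)) H x ^ (-c)) +
      5 * (∫⁻ x, ‖heatC e (4 ^ n * v) F x‖ₑ ^ 2 * heatL e (4 ^ n * v) H x ^ (-c)) ≤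
      5 * ∫⁻ x, ‖F x‖ₑ ^ 2 * H x ^ (-c) := by
  induction n with
  | zero =>
    have := one_step_integral (e := e) hc hc1 hF hH hv
    simp only [Finset.range_zero, Finset.sum_empty, mul_zero, zero_add, pow_zero, one_mul]
    exact le_trans le_add_self this
  | succ n ih =>
    refine le_trans ?_ ih
    rw [Finset.sum_range_succ, mul_add, add_assoc]
    gcongr
    have hw : 0 < 4 ^ n * v := by positivity
    set w := 4 ^ n * v with hw'
    have h4 : 4 ^ (n + 1) * v = 3 * w + w := by rw [hw']; ring
    have := one_step_integral (e := e) hc hc1 (hF.heatC (e := e) (v := w))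
      (hH.heatL (e := e) (v := w)) (v := 3 * w) (by positivity)
    simp_rw [heatL_heatL (by positivity : 0 ≤ 2 * (3 * w)) hw.le hH.meas,
      heatL_heatL (by positivity : 0 ≤ 3 * w) hw.le hH.meas,
      heatC_heatC (by positivity : 0 ≤ 3 * w) hw.le hF] at this
    rw [h4]
    have h7 : 7 * w = 2 * (3 * w) + w := by ring
    rw [h7]
    exact this

/-- The constant in the square function estimates. -/
noncomputable def sqConst (c : ℝ) : ℝ≥0∞ := 5 / ENNReal.ofReal (bregC c)

theorem sqConst_ne_top {c : ℝ} (hc : 0 < c) (hc1 : c < 1) : sqConst c ≠ ⊤ :=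
  ENNReal.div_ne_top (by norm_num) (by simpa using bregC_pos hc hc1)

theorem tsum_sqB_le {c : ℝ} (hc : 0 < c) (hc1 : c < 1) (hF : BddM F) (hH : Wt H) (hv : 0 < v) :
    ∑' k : ℤ, ∫⁻ x, ‖sqB e (4 ^ k * v) F x‖ₑ ^ 2 * heatL e (7 * (4 ^ k * v)) H x ^ (-c) ≤
      sqConst c * ∫⁻ x, ‖F x‖ₑ ^ 2 * H x ^ (-c) := by
  set T : ℤ → ℝ≥0∞ := fun k =>
    ∫⁻ x, ‖sqB e (4 ^ k * v) F x‖ₑ ^ 2 * heatL e (7 * (4 ^ k * v)) H x ^ (-c)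
  refine ENNReal.summable.tsum_le_of_sum_le fun s => ?_
  obtain ⟨n, hn⟩ : ∃ n : ℕ, s ⊆ Finset.Ico (-(n : ℤ)) n := by
    refine ⟨(∑ i ∈ s, i.natAbs) + 1, fun i hi => ?_⟩
    have := Finset.single_le_sum (f := Int.natAbs) (fun _ _ => Nat.zero_le _) hi
    generalize ∑ i ∈ s, i.natAbs = M at *
    rw [Finset.mem_Ico]
    omega
  calc ∑ k ∈ s, T k ≤ ∑ k ∈ Finset.Ico (-(n : ℤ)) n, T k := Finset.sum_le_sum_of_subset hn
    _ = ∑ k ∈ Finset.range (2 * n), T (k - n) := by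
      symm
      refine Finset.sum_bij (fun k _ => (k : ℤ) - n) ?_ ?_ ?_ ?_
      · intro a ha; simp at *; omega
      · intro a _ b _ h; omega
      · intro b hb
        simp at hb
        exact ⟨(b + n).toNat, by simp; omega, by omega⟩
      · intros; rfl
    _ ≤ _ := by
      have h := sum_range_sqB_le (e := e) hc hc1 hF hH (v := 4 ^ (-(n : ℤ)) * v) (by positivity)
        (2 * n)
      have h' := le_trans le_self_add h
      have hb : ENNReal.ofReal (bregC c) ≠ 0 := by simpa using bregC_pos hc hc1
      rw [mul_comm, ← ENNReal.le_div_iff_mul_le (.inl hb) (.inl ENNReal.ofReal_ne_top)] at h'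
      refine le_trans (le_of_eq ?_) (h'.trans (le_of_eq ?_))
      · refine Finset.sum_congr rfl fun k _ => ?_
        have : (4 : ℝ) ^ k * (4 ^ (-(n : ℤ)) * v) = 4 ^ ((k : ℤ) - n) * v := by
          rw [sub_eq_add_neg, zpow_add₀ (by norm_num), zpow_natCast, mul_assoc]
        rw [this]
      · rw [sqConst, div_eq_mul_inv, div_eq_mul_inv]; ring

theorem measurable_sqB_aux (hF : Measurable F) :
    Measurable fun p : ℝ × (ℝ × ℝ) => sqB e p.1 F p.2 := by
  have h1 := measurable_heatC_aux (e := e) hF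
  have : StronglyMeasurable fun q : (ℝ × (ℝ × ℝ)) × ℝ =>
      (q.2 : ℂ) * heatC e q.1.1 F (q.1.2 + (√(3 * q.1.1) * q.2) • e) := by
    apply Measurable.stronglyMeasurable
    refine Measurable.mul (by fun_prop) ?_
    exact h1.comp (f := fun q : (ℝ × (ℝ × ℝ)) × ℝ => (q.1.1, q.1.2 + (√(3 * q.1.1) * q.2) • e))
      (by fun_prop)
  exact this.integral_prod_right'.measurable

theorem lintegral_real_eq_tsum {φ : ℝ → ℝ≥0∞} {L : ℝ} (hL : 0 < L) :
    ∫⁻ t, φ t = ∑' k : ℤ, ∫⁻ t in Set.Ioc 0 L, φ (k * L + t) := by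
  have h := iUnion_Ioc_add_zsmul hL 0
  rw [← setLIntegral_univ, ← h, lintegral_iUnion (fun _ => measurableSet_Ioc)
    (Set.pairwise_disjoint_Ioc_add_zsmul 0 L)]
  congr 1 with k
  have := (measurePreserving_add_left volume ((k : ℝ) * L)).setLIntegral_comp_preimage_emb
    (measurableEmbedding_addLeft _) φ (Set.Ioc (0 + k • L) (0 + (k + 1) • L))
  rw [← this]
  congr 2
  ext t
  simp only [zsmul_eq_mul, Set.mem_preimage, Set.mem_Ioc]
  push_cast
  constructor <;> rintro ⟨h1, h2⟩ <;> constructor <;> linarith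

theorem lintegral_sqB_le {c : ℝ} (hc : 0 < c) (hc1 : c < 1) (hF : BddM F) (hH : Wt H) :
    ∫⁻ t : ℝ, ∫⁻ x, ‖sqB e (Real.exp t) F x‖ₑ ^ 2 * heatL e (7 * Real.exp t) H x ^ (-c) ≤
      ENNReal.ofReal (Real.log 4) * sqConst c * ∫⁻ x, ‖F x‖ₑ ^ 2 * H x ^ (-c) := by
  have hL : 0 < Real.log 4 := Real.log_pos (by norm_num)
  have m1 := measurable_sqB_aux (e := e) hF.meas
  have m2 := measurable_heatL_aux (e := e) hH.meas
  have hm : Measurable fun t : ℝ =>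
      ∫⁻ x, ‖sqB e (Real.exp t) F x‖ₑ ^ 2 * heatL e (7 * Real.exp t) H x ^ (-c) := by
    apply Measurable.lintegral_prod_right'
      (f := fun q : ℝ × (ℝ × ℝ) => ‖sqB e (Real.exp q.1) F q.2‖ₑ ^ 2 *
        heatL e (7 * Real.exp q.1) H q.2 ^ (-c))
    have a1 := m1.comp (f := fun q : ℝ × (ℝ × ℝ) => (Real.exp q.1, q.2)) (by fun_prop)
    have a2 := m2.comp (f := fun q : ℝ × (ℝ × ℝ) => (7 * Real.exp q.1, q.2)) (by fun_prop)
    exact (a1.enorm.pow_const 2).mul (a2.pow_const _)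
  rw [lintegral_real_eq_tsum hL, ← lintegral_tsum (fun k => by fun_prop)]
  calc _ ≤ ∫⁻ _ in Set.Ioc 0 (Real.log 4), sqConst c * ∫⁻ x, ‖F x‖ₑ ^ 2 * H x ^ (-c) := by
        refine lintegral_mono fun t => ?_
        refine le_trans (le_of_eq ?_) (tsum_sqB_le (e := e) hc hc1 hF hH (Real.exp_pos t))
        congr 1 with k
        have : Real.exp (k * Real.log 4 + t) = 4 ^ k * Real.exp t := by
          rw [Real.exp_add, mul_comm (k : ℝ), Real.exp_mul, Real.exp_log (by norm_num),
            Real.rpow_intCast]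
        rw [this]
    _ = _ := by
        rw [setLIntegral_const, Real.volume_Ioc, sub_zero]; ring

end LacunaryHalfPlane

namespace LacunaryHalfPlane

open ProbabilityTheory ENNReal

variable {e e' : ℝ × ℝ} {u v : ℝ} {F : ℝ × ℝ → ℂ} {V : ℝ × ℝ → ℝ≥0∞} {K : ℝ≥0∞}

theorem heatL_translate_le {w y C : ℝ} (hv : 0 < v) (hw : 0 < w) (hC : 0 ≤ C)
    (h : ∀ z, (√(2 * Real.pi * v))⁻¹ * Real.exp (-(z - y) ^ 2 / (2 * v)) ≤
      C * ((√(2 * Real.pi * w))⁻¹ * Real.exp (-z ^ 2 / (2 * w)))) (hV : Measurable V)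
    (x : ℝ × ℝ) : heatL e v V (x + y • e) ≤ ENNReal.ofReal C * heatL e w V x := by
  have e1 : heatL e v V (x + y • e) = ∫⁻ z, ENNReal.ofReal ((√(2 * Real.pi * v))⁻¹ *
      Real.exp (-(z - y) ^ 2 / (2 * v))) * V (x + z • e) := by
    rw [heatL]
    simp_rw [add_assoc, ← add_smul]
    rw [lintegral_stdG_scale v hv.le (φ := fun r => V (x + (y + r) • e)) (by fun_prop),
      lintegral_gaussian_density hv]
    conv_rhs => rw [← lintegral_add_right_eq_self _ y]
    simp [add_comm]
  have e2 : heatL e w V x = ∫⁻ z, ENNReal.ofReal ((√(2 * Real.pi * w))⁻¹ *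
      Real.exp (-z ^ 2 / (2 * w))) * V (x + z • e) := by
    rw [heatL, lintegral_stdG_scale w hw.le (φ := fun r => V (x + r • e)) (by fun_prop),
      lintegral_gaussian_density hw]
  rw [e1, e2, ← lintegral_const_mul' _ _ ENNReal.ofReal_ne_top]
  refine lintegral_mono fun z => ?_
  rw [← mul_assoc, ← ENNReal.ofReal_mul hC]
  exact mul_le_mul_left (ENNReal.ofReal_le_ofReal (h z)) _

theorem gauss_translate_le_aux {w y D : ℝ} (hv : 0 < v) (hw : 0 < w)
    (h : ∀ z, z ^ 2 / (2 * w) ≤ (z - y) ^ 2 / (2 * v) + D) (z : ℝ) :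
    (√(2 * Real.pi * v))⁻¹ * Real.exp (-(z - y) ^ 2 / (2 * v)) ≤
      (√(w / v) * Real.exp D) * ((√(2 * Real.pi * w))⁻¹ * Real.exp (-z ^ 2 / (2 * w))) := by
  have h1 : √(w / v) * (√(2 * Real.pi * w))⁻¹ = (√(2 * Real.pi * v))⁻¹ := by
    rw [← Real.sqrt_inv, ← Real.sqrt_mul (by positivity), ← Real.sqrt_inv]
    congr 1
    field_simp
  calc _ ≤ (√(2 * Real.pi * v))⁻¹ * Real.exp (D + -z ^ 2 / (2 * w)) := by
        gcongr
        have := h z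
        rw [neg_div, neg_div]
        linarith
    _ = _ := by rw [← h1, Real.exp_add]; ring

/-- The Muckenhoupt `A₁` condition for the Gaussian averages in the direction `e`. -/
def A1 (e : ℝ × ℝ) (K : ℝ≥0∞) (V : ℝ × ℝ → ℝ≥0∞) : Prop :=
  ∀ v, 0 < v → ∀ x, heatL e v V x ≤ K * V x

theorem A1.heatL (h : A1 e K V) (hV : Measurable V) : A1 e K (heatL e' v V) := fun w hw x => by
  rw [heatL_comm hV, ← heatL_const_mul _ hV]
  exact heatL_mono (fun y => h w hw y) x

theorem heatL_mul_inv_le (h : A1 e K V) (hV : Wt V) (hv : 0 < v) (r : ℝ) (x : ℝ × ℝ) :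
    heatL e v V x * (V (x + r • e))⁻¹ ≤ ENNReal.ofReal (Real.exp 1 * (2 + r ^ 2 / v)) * K := by
  have h0 := hV.ne_zero (x + r • e)
  have ht := hV.ne_top (x + r • e)
  have hm := hV.meas
  have hw : 0 < 2 * v + r ^ 2 := by positivity
  have h1 := heatL_translate_le (e := e) (y := -r) hv hw (by positivity)
    (gauss_translate_le_aux (D := 1) hv hw fun z => by
      have : z ^ 2 / (2 * (2 * v + r ^ 2)) ≤ (2 * (z - -r) ^ 2 + 2 * r ^ 2) / (2 * (2 * v + r ^ 2)) := by
        gcongr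
        nlinarith [sq_nonneg (z + 2 * r)]
      refine this.trans ?_
      rw [add_div]
      refine add_le_add ?_ ?_
      · calc 2 * (z - -r) ^ 2 / (2 * (2 * v + r ^ 2)) ≤ 2 * (z - -r) ^ 2 / (2 * (2 * v + 0)) := by
              gcongr; positivity
          _ = _ := by rw [add_zero]; exact mul_div_mul_left _ _ two_ne_zero
      · rw [div_le_one (by positivity)]; linarith) hm (x + r • e)
  have h2 : x + r • e + -r • e = x := by rw [add_assoc, ← add_smul]; simp
  rw [h2] at h1
  have h3 := h1.trans (mul_le_mul_right (h _ hw _) _)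
  rw [← div_eq_mul_inv, ENNReal.div_le_iff h0 ht]
  refine h3.trans ?_
  rw [← mul_assoc]
  rw [mul_comm (Real.exp 1)]
  gcongr
  rw [show (2 * v + r ^ 2) / v = 2 + r ^ 2 / v by field_simp]
  refine Real.sqrt_le_iff.2 ⟨by positivity, ?_⟩
  have : 0 ≤ r ^ 2 / v := by positivity
  nlinarith

/-- The constant in the `A₂` estimate. -/
noncomputable def tailC (K : ℝ≥0∞) : ℝ≥0∞ := 3 * ENNReal.ofReal (Real.exp 1) * K

theorem heatL_inv_mul_le (h : A1 e K V) (hV : Wt V) (hu : 0 < u) (huv : u ≤ v) (x : ℝ × ℝ) :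
    heatL e u (fun y => (V y)⁻¹) x * heatL e v V x ≤ tailC K := by
  have hv := hu.trans_le huv
  have hm := hV.meas
  rw [heatL, ← lintegral_mul_const _ (by fun_prop)]
  calc _ ≤ ∫⁻ s, ENNReal.ofReal (Real.exp 1) * (2 + ENNReal.ofReal (s ^ 2)) * K ∂stdG := by
        refine lintegral_mono fun s => ?_
        rw [mul_comm]
        refine (heatL_mul_inv_le h hV hv _ x).trans ?_
        rw [ENNReal.ofReal_mul (by positivity), ENNReal.ofReal_add (by norm_num) (by positivity)]
        gcongr
        · simp
        · rw [mul_pow, Real.sq_sqrt hu.le, div_le_iff₀ hv, mul_comm]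
          gcongr
    _ = _ := by
        rw [lintegral_mul_const _ (by fun_prop), lintegral_const_mul _ (by fun_prop),
          lintegral_add_left (by fun_prop), lintegral_sq_stdG, tailC]
        simp
        ring_nf

theorem heatL_rpow_neg_le (h : A1 e K V) (hV : Wt V) (hu : 0 < u) (huv : u ≤ v) {a : ℝ}
    (ha : 0 ≤ a) (x : ℝ × ℝ) :
    heatL e u (fun y => (V y)⁻¹) x ^ a ≤ tailC K ^ a * heatL e v V x ^ (-a) := by
  have h0 := (hV.heatL (e := e) (v := v)).ne_zero x
  have ht := (hV.heatL (e := e) (v := v)).ne_top x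
  rw [ENNReal.rpow_neg, ← div_eq_mul_inv, ← ENNReal.div_rpow_of_nonneg _ _ ha]
  gcongr
  rw [ENNReal.le_div_iff_mul_le (.inl h0) (.inl ht)]
  exact heatL_inv_mul_le h hV hu huv x

theorem heatL_rpow_le_inv (h : A1 e K V) (hV : Wt V) (hu : 0 < u) (huv : u ≤ v) {a : ℝ}
    (ha : 0 ≤ a) (x : ℝ × ℝ) :
    heatL e v V x ^ a ≤ tailC K ^ a * heatL e u (fun y => (V y)⁻¹) x ^ (-a) := by
  have h0 := (hV.inv.heatL (e := e) (v := u)).ne_zero x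
  have ht := (hV.inv.heatL (e := e) (v := u)).ne_top x
  rw [ENNReal.rpow_neg, ← div_eq_mul_inv, ← ENNReal.div_rpow_of_nonneg _ _ ha]
  gcongr
  rw [ENNReal.le_div_iff_mul_le (.inl h0) (.inl ht), mul_comm]
  exact heatL_inv_mul_le h hV hu huv x

/-- The constant in the square function estimates with continuous time. -/
noncomputable def negC (a : ℝ) : ℝ≥0∞ := ENNReal.ofReal (Real.log 4) * sqConst a

/-- The constant in the square function estimates with positive powers of a weight. -/
noncomputable def posC (a : ℝ) (K : ℝ≥0∞) : ℝ≥0∞ := tailC K ^ a * negC a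

theorem negC_ne_top {a : ℝ} (ha : 0 < a) (ha1 : a < 1) : negC a ≠ ⊤ :=
  ENNReal.mul_ne_top ENNReal.ofReal_ne_top (sqConst_ne_top ha ha1)

theorem tailC_ne_top (hK : K ≠ ⊤) : tailC K ≠ ⊤ :=
  ENNReal.mul_ne_top (ENNReal.mul_ne_top (by norm_num) ENNReal.ofReal_ne_top) hK

theorem posC_ne_top {a : ℝ} (ha : 0 < a) (ha1 : a < 1) (hK : K ≠ ⊤) : posC a K ≠ ⊤ :=
  ENNReal.mul_ne_top (ENNReal.rpow_ne_top_of_nonneg ha.le (tailC_ne_top hK)) (negC_ne_top ha ha1)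

theorem lintegral_sqB_pos_le {a : ℝ} (ha : 0 < a) (ha1 : a < 1) (h : A1 e K V) (hV : Wt V)
    (hK : K ≠ ⊤) (hF : BddM F) :
    ∫⁻ t : ℝ, ∫⁻ x, ‖sqB e (Real.exp t) F x‖ₑ ^ 2 * heatL e (9 * Real.exp t) V x ^ a ≤
      posC a K * ∫⁻ x, ‖F x‖ₑ ^ 2 * V x ^ a := by
  have hC : tailC K ^ a ≠ ⊤ := ENNReal.rpow_ne_top_of_nonneg ha.le (tailC_ne_top hK)
  have := lintegral_sqB_le (e := e) ha ha1 hF hV.inv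
  calc _ ≤ ∫⁻ t : ℝ, ∫⁻ x, tailC K ^ a * (‖sqB e (Real.exp t) F x‖ₑ ^ 2 *
        heatL e (7 * Real.exp t) (fun y => (V y)⁻¹) x ^ (-a)) := by
        refine lintegral_mono fun t => lintegral_mono fun x => ?_
        rw [mul_left_comm]
        gcongr
        exact heatL_rpow_le_inv h hV (by positivity) (by gcongr; norm_num) ha.le x
    _ = tailC K ^ a * ∫⁻ t : ℝ, ∫⁻ x, ‖sqB e (Real.exp t) F x‖ₑ ^ 2 *
        heatL e (7 * Real.exp t) (fun y => (V y)⁻¹) x ^ (-a) := by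
        simp_rw [lintegral_const_mul' _ _ hC]
    _ ≤ tailC K ^ a * _ := mul_le_mul_right this _
    _ = _ := by
        rw [posC, negC, mul_assoc]
        simp_rw [ENNReal.rpow_neg, ENNReal.inv_rpow, inv_inv]
        ring

theorem measurable_sqB_exp (hF : Measurable F) :
    Measurable fun q : ℝ × (ℝ × ℝ) => sqB e (Real.exp q.1) F q.2 :=
  (measurable_sqB_aux hF).comp (f := fun q : ℝ × (ℝ × ℝ) => (Real.exp q.1, q.2)) (by fun_prop)

theorem measurable_heatL_exp (hV : Measurable V) (c : ℝ) :
    Measurable fun q : ℝ × (ℝ × ℝ) => heatL e (c * Real.exp q.1) V q.2 :=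
  (measurable_heatL_aux hV).comp (f := fun q : ℝ × (ℝ × ℝ) => (c * Real.exp q.1, q.2))
    (by fun_prop)

/-- Joint measurability of `derC` for a family of functions. -/
theorem measurable_derC_family {Φ : ℝ → ℝ × ℝ → ℂ} (c : ℝ)
    (hΦ : Measurable fun q : ℝ × (ℝ × ℝ) => Φ q.1 q.2) :
    Measurable fun q : ℝ × (ℝ × ℝ) => derC e (c * Real.exp q.1) (Φ q.1) q.2 := by
  have : StronglyMeasurable fun q : (ℝ × (ℝ × ℝ)) × ℝ =>
      (q.2 : ℂ) * Φ q.1.1 (q.1.2 + (√(c * Real.exp q.1.1) * q.2) • e) := by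
    apply Measurable.stronglyMeasurable
    refine Measurable.mul (by fun_prop) ?_
    exact hΦ.comp (f := fun q : (ℝ × (ℝ × ℝ)) × ℝ =>
      (q.1.1, q.1.2 + (√(c * Real.exp q.1.1) * q.2) • e)) (by fun_prop)
  exact this.integral_prod_right'.measurable

theorem lintegral_derC_sq_mul_le (hv : 0 < v) (hF : Measurable F) (hV : Measurable V) :
    ∫⁻ x, ‖derC e v F x‖ₑ ^ 2 * V x ≤ 3 * ∫⁻ x, ‖F x‖ₑ ^ 2 * heatL e (2 * v) V x := by
  rw [← lintegral_heatL_mul (by fun_prop) hV, ← lintegral_const_mul' _ _ (by norm_num)]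
  refine lintegral_mono fun x => ?_
  rw [← mul_assoc]
  exact mul_le_mul_left (enorm_derC_sq_le hF hv x) _

/-- The bilinear estimate behind the weighted bound for the directional Hilbert transform. -/
theorem bilinear_sqB_le {a : ℝ} (ha : 0 < a) (ha1 : a < 1) (h : A1 e K V) (hV : Wt V)
    (hK : K ≠ ⊤) {f k : ℝ × ℝ → ℂ} (hf : BddM f) (hk : BddM k) :
    (∫⁻ t : ℝ, ∫⁻ x, ‖sqB e (Real.exp t) f x‖ₑ *
      ‖derC e (Real.exp t) (sqB e (Real.exp t) k) x‖ₑ) ^ 2 ≤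
      (negC a * ∫⁻ x, ‖f x‖ₑ ^ 2 * V x ^ (-a)) *
        (3 * (posC a K * ∫⁻ x, ‖k x‖ₑ ^ 2 * V x ^ a)) := by
  have m1 := measurable_sqB_exp (e := e) hf.meas
  have m2 : Measurable fun q : ℝ × (ℝ × ℝ) =>
      derC e (Real.exp q.1) (sqB e (Real.exp q.1) k) q.2 := by
    simpa using measurable_derC_family (e := e) (Φ := fun t => sqB e (Real.exp t) k) 1
      (measurable_sqB_exp (e := e) hk.meas)
  have m3 := measurable_heatL_exp (e := e) hV.meas 7
  have hw : ∀ (t : ℝ) x, heatL e (7 * Real.exp t) V x ≠ 0 := fun t => hV.heatL.ne_zero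
  have hw' : ∀ (t : ℝ) x, heatL e (7 * Real.exp t) V x ≠ ⊤ := fun t => hV.heatL.ne_top
  rw [← lintegral_prod (fun q : ℝ × (ℝ × ℝ) => ‖sqB e (Real.exp q.1) f q.2‖ₑ *
      ‖derC e (Real.exp q.1) (sqB e (Real.exp q.1) k) q.2‖ₑ)
    (m1.enorm.mul m2.enorm).aemeasurable]
  refine (lintegral_mul_sq_le_weighted (w := fun q => heatL e (7 * Real.exp q.1) V q.2 ^ (-a))
    m1.enorm.aemeasurable m2.enorm.aemeasurable (m3.pow_const _).aemeasurable
    (fun q => by simp [hw, hw', ha])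
    (fun q => by simp [hw, hw', ha])).trans ?_
  have m5 : Measurable fun q : ℝ × (ℝ × ℝ) => ‖sqB e (Real.exp q.1) f q.2‖ₑ ^ 2 *
      heatL e (7 * Real.exp q.1) V q.2 ^ (-a) := (m1.enorm.pow_const 2).mul (m3.pow_const _)
  have m6 : Measurable fun q : ℝ × (ℝ × ℝ) =>
      ‖derC e (Real.exp q.1) (sqB e (Real.exp q.1) k) q.2‖ₑ ^ 2 *
        (heatL e (7 * Real.exp q.1) V q.2 ^ (-a))⁻¹ :=
    (m2.enorm.pow_const 2).mul (m3.pow_const _).inv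
  rw [lintegral_prod _ m5.aemeasurable, lintegral_prod _ m6.aemeasurable]
  refine mul_le_mul' (lintegral_sqB_le ha ha1 hf hV) ?_
  refine le_trans ?_ (mul_le_mul_right (lintegral_sqB_pos_le ha ha1 h hV hK hk) 3)
  rw [← lintegral_const_mul' _ _ (by norm_num)]
  refine lintegral_mono fun t => ?_
  have m4 := hV.meas
  simp only
  simp_rw [← ENNReal.rpow_neg, neg_neg]
  refine (lintegral_derC_sq_mul_le (Real.exp_pos t) hk.sqB.meas (by fun_prop)).trans ?_
  gcongr with x
  refine (heatL_rpow_le (by fun_prop) ha.le ha1.le x).trans ?_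
  rw [heatL_heatL (by positivity) (by positivity) m4]
  exact le_of_eq (by ring_nf)

end LacunaryHalfPlane

namespace LacunaryHalfPlane

open ProbabilityTheory ENNReal

variable {e e' : ℝ × ℝ} {u v : ℝ} {F : ℝ × ℝ → ℂ} {V : ℝ × ℝ → ℝ≥0∞} {K : ℝ≥0∞}

theorem finset_sum_mul_sq_le {ι : Type*} (s : Finset ι) {Q A B : ι → ℝ≥0∞}
    (h : ∀ i ∈ s, Q i ^ 2 ≤ A i * B i) : (∑ i ∈ s, Q i) ^ 2 ≤ (∑ i ∈ s, A i) * ∑ i ∈ s, B i := by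
  have e1 : ∀ x : ℝ≥0∞, (x ^ (1 / 2 : ℝ)) ^ (2 : ℝ) = x := fun x => by
    rw [← ENNReal.rpow_mul]; norm_num
  have h1 : ∑ i ∈ s, Q i ≤ ∑ i ∈ s, A i ^ (1 / 2 : ℝ) * B i ^ (1 / 2 : ℝ) := by
    refine Finset.sum_le_sum fun i hi => ?_
    rw [← ENNReal.mul_rpow_of_nonneg _ _ (by norm_num)]
    refine le_trans (le_of_eq ?_) (ENNReal.rpow_le_rpow (h i hi) (by norm_num))
    rw [← ENNReal.rpow_natCast, ← ENNReal.rpow_mul]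
    norm_num
  have h2 := ENNReal.inner_le_Lp_mul_Lq s (fun i => A i ^ (1 / 2 : ℝ))
    (fun i => B i ^ (1 / 2 : ℝ)) Real.HolderConjugate.two_two
  simp_rw [e1] at h2
  calc _ ≤ _ := pow_le_pow_left' (h1.trans h2) 2
    _ = _ := by
      rw [← ENNReal.rpow_natCast, ENNReal.mul_rpow_of_nonneg _ _ (by norm_num)]
      norm_num [e1]

theorem lintegral_lintegral_mul_sq_le_weighted {f g w : ℝ → ℝ × ℝ → ℝ≥0∞}
    (hf : Measurable fun q : ℝ × (ℝ × ℝ) => f q.1 q.2)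
    (hg : Measurable fun q : ℝ × (ℝ × ℝ) => g q.1 q.2)
    (hw : Measurable fun q : ℝ × (ℝ × ℝ) => w q.1 q.2) (h0 : ∀ t x, w t x ≠ 0)
    (ht : ∀ t x, w t x ≠ ⊤) :
    (∫⁻ t, ∫⁻ x, f t x * g t x) ^ 2 ≤
      (∫⁻ t, ∫⁻ x, f t x ^ 2 * w t x) * ∫⁻ t, ∫⁻ x, g t x ^ 2 * (w t x)⁻¹ := by
  have m1 : Measurable fun q : ℝ × (ℝ × ℝ) => f q.1 q.2 * g q.1 q.2 := hf.mul hg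
  have m2 : Measurable fun q : ℝ × (ℝ × ℝ) => f q.1 q.2 ^ 2 * w q.1 q.2 := (hf.pow_const 2).mul hw
  have m3 : Measurable fun q : ℝ × (ℝ × ℝ) => g q.1 q.2 ^ 2 * (w q.1 q.2)⁻¹ :=
    (hg.pow_const 2).mul hw.inv
  have c := lintegral_mul_sq_le_weighted
    (μ := (volume : Measure ℝ).prod (volume : Measure (ℝ × ℝ))) hf.aemeasurable hg.aemeasurable
    hw.aemeasurable (fun q => h0 q.1 q.2) (fun q => ht q.1 q.2)
  rwa [lintegral_prod _ m1.aemeasurable, lintegral_prod _ m2.aemeasurable,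
    lintegral_prod _ m3.aemeasurable] at c

/-- The dilated direction `2⁻ʲ e`. -/
noncomputable def sdir (e : ℝ × ℝ) (j : ℤ) : ℝ × ℝ := ((2 : ℝ) ^ (-j)) • e

theorem derC_smul {c : ℝ} (hc : 0 ≤ c) (F : ℝ × ℝ → ℂ) (x : ℝ × ℝ) :
    derC (c • e) v F x = derC e (c ^ 2 * v) F x := by
  unfold derC
  rw [Real.sqrt_mul (by positivity), Real.sqrt_sq hc]
  simp_rw [smul_smul]
  congr! 6 with s
  ring

theorem heatC_smul {c : ℝ} (hc : 0 ≤ c) (F : ℝ × ℝ → ℂ) (x : ℝ × ℝ) :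
    heatC (c • e) v F x = heatC e (c ^ 2 * v) F x := by
  unfold heatC
  rw [Real.sqrt_mul (by positivity), Real.sqrt_sq hc]
  simp_rw [smul_smul]
  congr! 5 with s
  ring

theorem two_zpow_sq (j : ℤ) : ((2 : ℝ) ^ (-j)) ^ 2 = 4 ^ (-j) := by
  rw [← zpow_natCast, ← zpow_mul, mul_comm, zpow_mul]; norm_num

theorem sqB_sdir (j : ℤ) : sqB (sdir e j) v F = sqB e (4 ^ (-j) * v) F := by
  have h1 : heatC (sdir e j) v F = heatC e (4 ^ (-j) * v) F := by
    ext x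
    rw [sdir, heatC_smul (by positivity), two_zpow_sq]
  ext x
  rw [sqB, sqB, h1, sdir, derC_smul (by positivity), two_zpow_sq, mul_left_comm]

theorem heatL_sdir (j : ℤ) : heatL (sdir e j) v V = heatL e (4 ^ (-j) * v) V := by
  ext x
  rw [sdir, heatL_smul (by positivity), two_zpow_sq]

theorem A1.sdir (h : A1 e K V) (j : ℤ) : A1 (sdir e j) K V := fun v hv x => by
  rw [heatL_sdir]
  exact h _ (by positivity) x

theorem heatL_rpow_neg_le_of_le (hV : Measurable V) (hu : 0 < u) (huv : u ≤ v)
    (h4 : v ≤ 4 * u) {a : ℝ} (ha : 0 ≤ a) (x : ℝ × ℝ) :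
    heatL e v V x ^ (-a) ≤ 2 ^ a * heatL e u V x ^ (-a) := by
  have h1 : heatL e u V x ≤ 2 * heatL e v V x := by
    refine (heatL_le hu huv hV x).trans ?_
    gcongr
    have : (2 : ℝ≥0∞) = ENNReal.ofReal 2 := by norm_num
    rw [this]
    apply ENNReal.ofReal_le_ofReal
    rw [Real.sqrt_le_left (by norm_num), div_le_iff₀ hu]
    linarith
  rw [ENNReal.rpow_neg, ENNReal.rpow_neg, ← ENNReal.inv_rpow, ← ENNReal.inv_rpow,
    ← ENNReal.mul_rpow_of_nonneg _ _ ha]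
  gcongr
  rw [← inv_inv (2 : ℝ≥0∞), ← ENNReal.mul_inv (by norm_num) (by norm_num), ENNReal.inv_le_inv]
  rw [mul_comm, ← div_eq_mul_inv]
  refine ENNReal.div_le_of_le_mul ?_
  rwa [mul_comm]

/-- The constant in the estimate for the sector square functions with frozen time. -/
noncomputable def secC (a : ℝ) (K : ℝ≥0∞) : ℝ≥0∞ := 3 * (tailC K ^ a * 2 ^ a) * sqConst a

theorem secC_ne_top {a : ℝ} (ha : 0 < a) (ha1 : a < 1) (hK : K ≠ ⊤) : secC a K ≠ ⊤ := by
  refine ENNReal.mul_ne_top (ENNReal.mul_ne_top (by norm_num) (ENNReal.mul_ne_top ?_ ?_))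
    (sqConst_ne_top ha ha1)
  · exact ENNReal.rpow_ne_top_of_nonneg ha.le (tailC_ne_top hK)
  · exact ENNReal.rpow_ne_top_of_nonneg ha.le (by norm_num)

theorem sum_derC_sqB_le {a : ℝ} (ha : 0 < a) (ha1 : a < 1) (h : A1 e K V) (hV : Wt V)
    (hF : BddM F) (hv : 0 < v) (s : Finset ℤ) :
    ∑ j ∈ s, ∫⁻ x, ‖derC (sdir e j) (4 * v) (sqB (sdir e j) v F) x‖ₑ ^ 2 * V x ^ (-a) ≤
      secC a K * ∫⁻ x, ‖F x‖ₑ ^ 2 * V x ^ (-a) := by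
  have hm := hV.meas
  have h2 : ∀ j, ∫⁻ x, ‖derC (sdir e j) (4 * v) (sqB (sdir e j) v F) x‖ₑ ^ 2 * V x ^ (-a) ≤
      3 * (tailC K ^ a * 2 ^ a) * ∫⁻ x, ‖sqB e (4 ^ (-j) * v) F x‖ₑ ^ 2 *
        heatL e (7 * (4 ^ (-j) * v)) V x ^ (-a) := fun j => by
    refine (lintegral_derC_sq_mul_le (by positivity) hF.sqB.meas (by fun_prop)).trans ?_
    rw [mul_assoc]
    gcongr
    have m1 : Measurable (sqB e (4 ^ (-j) * v) F) := hF.sqB.meas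
    rw [← lintegral_const_mul _ (by fun_prop)]
    refine lintegral_mono fun x => ?_
    rw [sqB_sdir, mul_left_comm (tailC K ^ a * 2 ^ a)]
    refine mul_le_mul_right ?_ _
    have h3 : ∀ y, V y ^ (-a) = (V y)⁻¹ ^ a := fun y => by
      rw [ENNReal.rpow_neg, ENNReal.inv_rpow]
    simp_rw [h3]
    refine (heatL_rpow_le (by fun_prop) ha.le ha1.le x).trans ?_
    refine (heatL_rpow_neg_le (h.sdir j) hV (by positivity) le_rfl ha.le x).trans ?_
    rw [mul_assoc]
    gcongr
    refine (heatL_rpow_neg_le_of_le hm (u := 7 * v) (by positivity) (by linarith) (by linarith)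
      ha.le x).trans ?_
    rw [heatL_sdir, mul_left_comm]
  refine (Finset.sum_le_sum fun j _ => h2 j).trans ?_
  rw [← Finset.mul_sum, secC, mul_assoc _ (sqConst a)]
  refine mul_le_mul_right ?_ _
  refine le_trans ?_ (tsum_sqB_le (e := e) ha ha1 hF hV hv)
  rw [← (Equiv.neg ℤ).tsum_eq]
  exact ENNReal.sum_le_tsum s

theorem measurable_sqB_family {Φ : ℝ → ℝ × ℝ → ℂ}
    (hΦ : Measurable fun q : ℝ × (ℝ × ℝ) => Φ q.1 q.2) :
    Measurable fun q : ℝ × (ℝ × ℝ) => sqB e (Real.exp q.1) (Φ q.1) q.2 := by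
  have h1 : Measurable fun q : ℝ × (ℝ × ℝ) => heatC e (Real.exp q.1) (Φ q.1) q.2 := by
    have : StronglyMeasurable fun q : (ℝ × (ℝ × ℝ)) × ℝ =>
        Φ q.1.1 (q.1.2 + (√(Real.exp q.1.1) * q.2) • e) := by
      apply Measurable.stronglyMeasurable
      exact hΦ.comp (f := fun q : (ℝ × (ℝ × ℝ)) × ℝ =>
        (q.1.1, q.1.2 + (√(Real.exp q.1.1) * q.2) • e)) (by fun_prop)
    exact this.integral_prod_right'.measurable
  exact measurable_derC_family (Φ := fun t => heatC e (Real.exp t) (Φ t)) 3 h1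

/-- The bilinear estimate behind the weighted square function bound for the sector operators. -/
theorem bilinear_sector_le {a : ℝ} (ha : 0 < a) (ha1 : a < 1) (h : A1 e K V) (h' : A1 e' K V)
    (hV : Wt V) (hK : K ≠ ⊤) {w : ℝ × ℝ → ℂ} (hb : BddM w) {k : ℤ → ℝ × ℝ → ℂ}
    (hk : ∀ j, BddM (k j)) (s : Finset ℤ) :
    (∑ j ∈ s, ∫⁻ t : ℝ, ∫⁻ x, ‖derC (sdir e' j) (4 * Real.exp t)
        (sqB (sdir e' j) (Real.exp t) (sqB e (Real.exp t) w)) x‖ₑ *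
          ‖sqB e (Real.exp t) (k j) x‖ₑ) ^ 2 ≤
      (secC a K * 2 ^ a * negC a * ∫⁻ x, ‖w x‖ₑ ^ 2 * V x ^ (-a)) *
        (posC a K * ∑ j ∈ s, ∫⁻ x, ‖k j x‖ₑ ^ 2 * V x ^ a) := by
  have hVm := hV.meas
  have m0 := measurable_sqB_exp (e := e) hb.meas
  have m1 : ∀ j, Measurable fun q : ℝ × (ℝ × ℝ) => derC (sdir e' j) (4 * Real.exp q.1)
      (sqB (sdir e' j) (Real.exp q.1) (sqB e (Real.exp q.1) w)) q.2 := fun j =>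
    measurable_derC_family (Φ := fun t => sqB (sdir e' j) (Real.exp t) (sqB e (Real.exp t) w)) 4
      (measurable_sqB_family (Φ := fun t => sqB e (Real.exp t) w) m0)
  have m2 : ∀ j, Measurable fun q : ℝ × (ℝ × ℝ) => sqB e (Real.exp q.1) (k j) q.2 := fun j =>
    measurable_sqB_exp (hk j).meas
  have m3 := measurable_heatL_exp (e := e) hVm 9
  have hw : ∀ (t : ℝ) x, heatL e (9 * Real.exp t) V x ≠ 0 := fun t => hV.heatL.ne_zero
  have hw' : ∀ (t : ℝ) x, heatL e (9 * Real.exp t) V x ≠ ⊤ := fun t => hV.heatL.ne_top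
  have m5 : ∀ j, Measurable fun q : ℝ × (ℝ × ℝ) => ‖derC (sdir e' j) (4 * Real.exp q.1)
      (sqB (sdir e' j) (Real.exp q.1) (sqB e (Real.exp q.1) w)) q.2‖ₑ ^ 2 *
      heatL e (9 * Real.exp q.1) V q.2 ^ (-a) := fun j =>
    ((m1 j).enorm.pow_const 2).mul (m3.pow_const _)
  have m6 : ∀ j, Measurable fun q : ℝ × (ℝ × ℝ) => ‖sqB e (Real.exp q.1) (k j) q.2‖ₑ ^ 2 *
      (heatL e (9 * Real.exp q.1) V q.2 ^ (-a))⁻¹ := fun j =>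
    ((m2 j).enorm.pow_const 2).mul (m3.pow_const _).inv
  refine (finset_sum_mul_sq_le s (A := fun j => ∫⁻ t : ℝ, ∫⁻ x, ‖derC (sdir e' j)
      (4 * Real.exp t) (sqB (sdir e' j) (Real.exp t) (sqB e (Real.exp t) w)) x‖ₑ ^ 2 *
        heatL e (9 * Real.exp t) V x ^ (-a))
    (B := fun j => ∫⁻ t : ℝ, ∫⁻ x, ‖sqB e (Real.exp t) (k j) x‖ₑ ^ 2 *
      (heatL e (9 * Real.exp t) V x ^ (-a))⁻¹) fun j _ => ?_).trans ?_
  · exact lintegral_lintegral_mul_sq_le_weighted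
      (f := fun t x => ‖derC (sdir e' j) (4 * Real.exp t)
        (sqB (sdir e' j) (Real.exp t) (sqB e (Real.exp t) w)) x‖ₑ)
      (w := fun t x => heatL e (9 * Real.exp t) V x ^ (-a))
      (m1 j).enorm (m2 j).enorm (m3.pow_const _)
      (fun t x => by simp [hw, hw', ha]) (fun t x => by simp [hw, hw', ha])
  · refine mul_le_mul' ?_ ?_
    · rw [← lintegral_finsetSum _ fun j _ => (m5 j).lintegral_prod_right', mul_assoc]
      have c1 := mul_le_mul_right (lintegral_sqB_le (e := e) ha ha1 hb hV) (secC a K * 2 ^ a)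
      rw [← negC, ← mul_assoc] at c1
      rw [← mul_assoc]
      refine le_trans ?_ c1
      have hc : secC a K * 2 ^ a ≠ ⊤ := ENNReal.mul_ne_top (secC_ne_top ha ha1 hK)
        (ENNReal.rpow_ne_top_of_nonneg ha.le (by norm_num))
      rw [← lintegral_const_mul' _ _ hc]
      refine lintegral_mono fun t => ?_
      have c2 := sum_derC_sqB_le (e := e') (V := heatL e (9 * Real.exp t) V)
        (F := sqB e (Real.exp t) w) ha ha1 (h'.heatL hVm) hV.heatL hb.sqB (Real.exp_pos t) s
      refine c2.trans ?_
      rw [mul_assoc]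
      gcongr
      rw [← lintegral_const_mul' _ _ (ENNReal.rpow_ne_top_of_nonneg ha.le (by norm_num))]
      refine lintegral_mono fun x => ?_
      have := Real.exp_pos t
      rw [mul_left_comm]
      gcongr
      exact heatL_rpow_neg_le_of_le hVm (by positivity) (by linarith) (by linarith) ha.le x
    · rw [Finset.mul_sum]
      refine Finset.sum_le_sum fun j _ => ?_
      refine le_trans (le_of_eq ?_) (lintegral_sqB_pos_le ha ha1 h hV hK (hk j))
      simp_rw [← ENNReal.rpow_neg, neg_neg]

end LacunaryHalfPlane

namespace LacunaryHalfPlane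

open ProbabilityTheory ENNReal

/-- The character `x ↦ e^{2πi x·ξ}`. -/
noncomputable def ch (x ξ : ℝ × ℝ) : ℂ :=
  Complex.exp (((2 * Real.pi * (x.1 * ξ.1 + x.2 * ξ.2) : ℝ) : ℂ) * Complex.I)

/-- The function with frequency density `g`. -/
noncomputable def syn (g : ℝ × ℝ → ℂ) (x : ℝ × ℝ) : ℂ := ∫ ξ, g ξ * ch x ξ

/-- The symbol of `heatC e v`. -/
noncomputable def hS (e : ℝ × ℝ) (v : ℝ) (ξ : ℝ × ℝ) : ℂ :=
  ((Real.exp (-(2 * Real.pi ^ 2 * v * (e.1 * ξ.1 + e.2 * ξ.2) ^ 2)) : ℝ) : ℂ)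

/-- The symbol of `derC e v`. -/
noncomputable def dS (e : ℝ × ℝ) (v : ℝ) (ξ : ℝ × ℝ) : ℂ :=
  ((2 * Real.pi * √v * (e.1 * ξ.1 + e.2 * ξ.2) : ℝ) : ℂ) * Complex.I * hS e v ξ

theorem norm_ch (x ξ : ℝ × ℝ) : ‖ch x ξ‖ = 1 := Complex.norm_exp_ofReal_mul_I _

theorem ch_add (x y ξ : ℝ × ℝ) : ch (x + y) ξ = ch x ξ * ch y ξ := by
  unfold ch
  rw [← Complex.exp_add, ← add_mul, ← Complex.ofReal_add]
  congr 3
  simp only [Prod.fst_add, Prod.snd_add]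
  ring

theorem ch_comm (x ξ : ℝ × ℝ) : ch x ξ = ch ξ x := by
  unfold ch
  simp only [mul_comm (x.1), mul_comm (x.2)]

theorem continuous_ch : Continuous fun q : (ℝ × ℝ) × (ℝ × ℝ) => ch q.1 q.2 := by
  unfold ch
  fun_prop

@[fun_prop]
theorem measurable_ch {α : Type*} [MeasurableSpace α] {x ξ : α → ℝ × ℝ} (hx : Measurable x)
    (hξ : Measurable ξ) : Measurable fun q => ch (x q) (ξ q) :=
  continuous_ch.measurable.comp (hx.prodMk hξ)

theorem measurable_hS_aux (e : ℝ × ℝ) : Measurable fun q : ℝ × (ℝ × ℝ) => hS e q.1 q.2 := by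
  unfold hS
  fun_prop

@[fun_prop]
theorem measurable_hS {α : Type*} [MeasurableSpace α] {e : ℝ × ℝ} {v : α → ℝ} {ξ : α → ℝ × ℝ}
    (hv : Measurable v) (hξ : Measurable ξ) : Measurable fun q => hS e (v q) (ξ q) :=
  (measurable_hS_aux e).comp (hv.prodMk hξ)

@[fun_prop]
theorem measurable_dS {α : Type*} [MeasurableSpace α] {e : ℝ × ℝ} {v : α → ℝ} {ξ : α → ℝ × ℝ}
    (hv : Measurable v) (hξ : Measurable ξ) : Measurable fun q => dS e (v q) (ξ q) := by
  unfold dS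
  fun_prop

variable {e e' : ℝ × ℝ} {u v : ℝ} {g h k : ℝ × ℝ → ℂ} {x ξ : ℝ × ℝ}

theorem integrable_mul_ch (hg : Integrable g) (x : ℝ × ℝ) :
    Integrable fun ξ => g ξ * ch x ξ :=
  hg.mul_bdd (c := 1) (Measurable.aestronglyMeasurable (by fun_prop))
    (ae_of_all _ fun _ => (norm_ch _ _).le)

theorem continuous_syn (hg : Integrable g) : Continuous (syn g) := by
  refine continuous_of_dominated (bound := fun ξ => ‖g ξ‖) (fun x => (integrable_mul_ch hg x).1)
    (fun x => ae_of_all _ fun ξ => by rw [norm_mul, norm_ch, mul_one]) hg.norm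
    (ae_of_all _ fun ξ => ?_)
  exact continuous_const.mul (continuous_ch.comp (by fun_prop : Continuous fun x => (x, ξ)))

theorem norm_syn_le (g : ℝ × ℝ → ℂ) (x : ℝ × ℝ) : ‖syn g x‖ ≤ ∫ ξ, ‖g ξ‖ := by
  refine (norm_integral_le_integral_norm _).trans (le_of_eq ?_)
  simp_rw [norm_mul, norm_ch, mul_one]

theorem BddM.syn (hg : Integrable g) : BddM (syn g) :=
  ⟨(continuous_syn hg).measurable, _, norm_syn_le g⟩

theorem BddM.ch (ξ : ℝ × ℝ) : BddM (fun x => ch x ξ) :=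
  ⟨by fun_prop, 1, fun x => (norm_ch x ξ).le⟩

theorem syn_add (hg : Integrable g) (hh : Integrable h) :
    syn (fun ξ => g ξ + h ξ) x = syn g x + syn h x := by
  unfold syn
  rw [← integral_add (integrable_mul_ch hg x) (integrable_mul_ch hh x)]
  simp_rw [add_mul]

theorem syn_sub (hg : Integrable g) (hh : Integrable h) :
    syn (fun ξ => g ξ - h ξ) x = syn g x - syn h x := by
  unfold syn
  rw [← integral_sub (integrable_mul_ch hg x) (integrable_mul_ch hh x)]
  simp_rw [sub_mul]

theorem syn_const_mul (c : ℂ) (g : ℝ × ℝ → ℂ) (x : ℝ × ℝ) :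
    syn (fun ξ => c * g ξ) x = c * syn g x := by
  unfold syn
  rw [← integral_const_mul]
  simp_rw [mul_assoc]

theorem norm_hS_le (hv : 0 ≤ v) : ‖hS e v ξ‖ ≤ 1 := by
  unfold hS
  rw [Complex.norm_real, Real.norm_eq_abs, Real.abs_exp, Real.exp_le_one_iff]
  have : 0 ≤ 2 * Real.pi ^ 2 * v * (e.1 * ξ.1 + e.2 * ξ.2) ^ 2 := by positivity
  linarith

theorem integral_exp_stdG (z : ℝ) :
    ∫ s, Complex.exp (((z * s : ℝ) : ℂ) * Complex.I) ∂stdG =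
      ((Real.exp (-(z ^ 2 / 2)) : ℝ) : ℂ) := by
  have h := complexMGF_id_gaussianReal (μ := 0) (v := 1) (z * Complex.I)
  unfold complexMGF at h
  simp only [id] at h
  convert h using 1
  · congr 1; ext s; congr 1; push_cast; ring
  · push_cast
    congr 1
    have := Complex.I_sq
    simp only [mul_zero, zero_add, mul_pow, this]
    simp
    ring

theorem integral_mul_exp_stdG (z : ℝ) :
    ∫ s, (s : ℂ) * Complex.exp (((z * s : ℝ) : ℂ) * Complex.I) ∂stdG =
      (z : ℂ) * Complex.I * ((Real.exp (-(z ^ 2 / 2)) : ℝ) : ℂ) := by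
  have h1 : HasDerivAt (complexMGF id stdG) (stdG[fun s : ℝ => (s : ℂ) * Complex.exp (z * Complex.I * s)])
      (z * Complex.I) := by
    refine hasDerivAt_complexMGF (X := id) (μ := stdG) ?_
    rw [integrableExpSet_id_gaussianReal]
    simp
  have h2 : complexMGF id stdG = fun z => Complex.exp (z ^ 2 / 2) := by
    ext z
    rw [complexMGF_id_gaussianReal]
    simp
  rw [h2] at h1
  have h3 : HasDerivAt (fun z : ℂ => Complex.exp (z ^ 2 / 2))
      (Complex.exp ((z * Complex.I) ^ 2 / 2) * ((2 : ℕ) * (z * Complex.I) ^ (2 - 1) * 1 / 2)) (z * Complex.I) :=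
    (((hasDerivAt_id (z * Complex.I)).pow 2).div_const 2).cexp
  have h4 := h1.unique h3
  convert h4 using 1
  · congr 1; ext s; congr 2; push_cast; ring
  · push_cast
    rw [mul_pow, Complex.I_sq]
    rw [show -((z : ℂ) ^ 2 / 2) = z ^ 2 * -1 / 2 by ring]
    ring

theorem sqrt_symbol (hv : 0 ≤ v) (t : ℝ) :
    (2 * Real.pi * √v * t) ^ 2 / 2 = 2 * Real.pi ^ 2 * v * t ^ 2 := by
  rw [mul_pow, mul_pow, mul_pow, Real.sq_sqrt hv]; ring

theorem ch_shift (x : ℝ × ℝ) (s : ℝ) : ch (x + (√v * s) • e) ξ = ch x ξ *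
    Complex.exp (((2 * Real.pi * √v * (e.1 * ξ.1 + e.2 * ξ.2) * s : ℝ) : ℂ) * Complex.I) := by
  rw [ch_add]
  congr 1
  unfold ch
  congr 3
  simp only [Prod.smul_fst, Prod.smul_snd, smul_eq_mul]
  ring

theorem heatC_ch (hv : 0 ≤ v) : heatC e v (fun x => ch x ξ) x = hS e v ξ * ch x ξ := by
  unfold heatC
  simp_rw [ch_shift]
  rw [integral_const_mul, integral_exp_stdG, sqrt_symbol hv, mul_comm]
  rfl

theorem derC_ch (hv : 0 ≤ v) : derC e v (fun x => ch x ξ) x = dS e v ξ * ch x ξ := by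
  unfold derC
  simp_rw [ch_shift, mul_left_comm _ (ch x ξ)]
  rw [integral_const_mul, integral_mul_exp_stdG, sqrt_symbol hv, mul_comm]
  rfl

theorem norm_dS_le (hv : 0 ≤ v) : ‖dS e v ξ‖ ≤ 1 := by
  unfold dS hS
  rw [norm_mul, norm_mul, Complex.norm_I, Complex.norm_real, Complex.norm_real, mul_one,
    Real.norm_eq_abs, Real.norm_eq_abs, Real.abs_exp, ← sqrt_symbol hv]
  set z := 2 * Real.pi * √v * (e.1 * ξ.1 + e.2 * ξ.2)
  rw [Real.exp_neg, ← div_eq_mul_inv, div_le_one (Real.exp_pos _)]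
  have := Real.add_one_le_exp (z ^ 2 / 2)
  nlinarith [sq_nonneg (|z| - 1), sq_abs z]

theorem heatC_syn (hv : 0 ≤ v) (hg : Integrable g) :
    heatC e v (syn g) x = syn (fun ξ => hS e v ξ * g ξ) x := by
  unfold heatC syn
  rw [integral_integral_swap]
  · congr 1; ext ξ
    beta_reduce
    rw [integral_const_mul, mul_comm (hS e v ξ), mul_assoc, ← heatC_ch hv]
    rfl
  · have : Integrable (fun q : ℝ × (ℝ × ℝ) => (1 : ℂ) * g q.2) (stdG.prod volume) :=
      (integrable_const (1 : ℂ)).mul_prod hg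
    simp only [one_mul] at this
    exact this.mul_bdd (c := 1) (Measurable.aestronglyMeasurable (by fun_prop))
      (ae_of_all _ fun _ => (norm_ch _ _).le)

theorem derC_syn (hv : 0 ≤ v) (hg : Integrable g) :
    derC e v (syn g) x = syn (fun ξ => dS e v ξ * g ξ) x := by
  unfold derC syn
  simp_rw [← integral_const_mul]
  rw [integral_integral_swap]
  · congr 1; ext ξ
    simp_rw [mul_left_comm _ (g ξ)]
    rw [integral_const_mul, mul_comm (dS e v ξ), mul_assoc, ← derC_ch hv]
    rfl
  · have : Integrable (fun q : ℝ × (ℝ × ℝ) => (q.1 : ℂ) * g q.2) (stdG.prod volume) :=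
      Integrable.mul_prod (f := fun s : ℝ => (s : ℂ)) integrable_id_stdG.ofReal hg
    simp only [← mul_assoc]
    exact this.mul_bdd (c := 1) (Measurable.aestronglyMeasurable (by fun_prop))
      (ae_of_all _ fun _ => (norm_ch _ _).le)

theorem integrable_hS_mul (hv : 0 ≤ v) (hg : Integrable g) : Integrable fun ξ => hS e v ξ * g ξ :=
  hg.bdd_mul (c := 1) (Measurable.aestronglyMeasurable (by fun_prop))
    (ae_of_all _ fun _ => norm_hS_le hv)

theorem integrable_dS_mul (hv : 0 ≤ v) (hg : Integrable g) : Integrable fun ξ => dS e v ξ * g ξ :=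
  hg.bdd_mul (c := 1) (Measurable.aestronglyMeasurable (by fun_prop))
    (ae_of_all _ fun _ => norm_dS_le hv)

theorem integral_syn_mul (hg : Integrable g) (hk : Integrable k) :
    ∫ x, syn g x * k x = ∫ ξ, g ξ * syn k ξ := by
  unfold syn
  simp_rw [← integral_const_mul, ← integral_mul_const]
  rw [integral_integral_swap]
  · congr 1; ext ξ; congr 1; ext x
    rw [ch_comm, mul_assoc, mul_comm (ch _ _)]
  · have : Integrable (fun q : (ℝ × ℝ) × (ℝ × ℝ) => k q.1 * g q.2) (volume.prod volume) :=
      hk.mul_prod hg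
    refine (this.mul_bdd (c := 1) (g := fun q => ch q.1 q.2)
      (Measurable.aestronglyMeasurable (by fun_prop))
      (ae_of_all _ fun _ => (norm_ch _ _).le)).congr (ae_of_all _ fun q => ?_)
    simp only [Function.uncurry]
    ring

theorem syn_integral {T : Type*} [MeasurableSpace T] {ν : Measure T} [SFinite ν]
    {m : T → ℝ × ℝ → ℂ} (hm : Measurable (Function.uncurry m)) {C : ℝ≥0∞} (hC : C ≠ ⊤)
    (hmC : ∀ ξ, ∫⁻ t, ‖m t ξ‖ₑ ∂ν ≤ C) (hg : Integrable g) (x : ℝ × ℝ) :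
    syn (fun ξ => (∫ t, m t ξ ∂ν) * g ξ) x = ∫ t, syn (fun ξ => m t ξ * g ξ) x ∂ν := by
  unfold syn
  simp_rw [← integral_mul_const]
  rw [integral_integral_swap]
  have hgm := hg.1
  have hmeas : AEStronglyMeasurable (fun q : (ℝ × ℝ) × T => m q.2 q.1 * g q.1 * ch x q.1)
      (volume.prod ν) := by
    refine ((Measurable.aestronglyMeasurable (hm.comp measurable_swap)).mul hgm.comp_fst).mul ?_
    exact Measurable.aestronglyMeasurable (by fun_prop)
  refine ⟨hmeas, ?_⟩
  have : ∫⁻ q : (ℝ × ℝ) × T, ‖m q.2 q.1 * g q.1 * ch x q.1‖ₑ ∂(volume.prod ν) ≤ C * ∫⁻ ξ, ‖g ξ‖ₑ := by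
    rw [lintegral_prod _ hmeas.enorm, ← lintegral_const_mul'' _ hgm.enorm]
    refine lintegral_mono fun ξ => ?_
    have hc : ‖ch x ξ‖ₑ = 1 := by rw [← ofReal_norm, norm_ch]; simp
    simp_rw [enorm_mul, hc, mul_one]
    have hmξ : Measurable fun t => m t ξ := hm.comp measurable_prodMk_right
    rw [lintegral_mul_const _ hmξ.enorm]
    exact mul_le_mul_left (hmC ξ) _
  exact this.trans_lt (ENNReal.mul_lt_top hC.lt_top hg.2)

theorem enorm_syn_integral_le {T : Type*} [MeasurableSpace T] {ν : Measure T} [SFinite ν]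
    {m : T → ℝ × ℝ → ℂ} (hm : Measurable (Function.uncurry m)) {C : ℝ≥0∞} (hC : C ≠ ⊤)
    (hmC : ∀ ξ, ∫⁻ t, ‖m t ξ‖ₑ ∂ν ≤ C) (hg : Integrable g) (x : ℝ × ℝ) :
    ‖syn (fun ξ => (∫ t, m t ξ ∂ν) * g ξ) x‖ₑ ≤ ∫⁻ t, ‖syn (fun ξ => m t ξ * g ξ) x‖ₑ ∂ν := by
  rw [syn_integral hm hC hmC hg]
  exact enorm_integral_le_lintegral_enorm _

theorem integrable_integral_mul {T : Type*} [MeasurableSpace T] {ν : Measure T} [SFinite ν]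
    {m : T → ℝ × ℝ → ℂ} (hm : Measurable (Function.uncurry m)) {C : ℝ≥0∞} (hC : C ≠ ⊤)
    (hmC : ∀ ξ, ∫⁻ t, ‖m t ξ‖ₑ ∂ν ≤ C) (hg : Integrable g) :
    Integrable fun ξ => (∫ t, m t ξ ∂ν) * g ξ := by
  have h1 : StronglyMeasurable fun ξ => ∫ t, m t ξ ∂ν :=
    StronglyMeasurable.integral_prod_right' (f := fun q : (ℝ × ℝ) × T => m q.2 q.1)
      (hm.comp measurable_swap).stronglyMeasurable
  refine hg.bdd_mul (c := C.toReal) h1.aestronglyMeasurable (ae_of_all _ fun ξ => ?_)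
  rw [← toReal_enorm]
  exact ENNReal.toReal_mono hC ((enorm_integral_le_lintegral_enorm _).trans (hmC ξ))

theorem enorm_pair_syn_le {T : Type*} [MeasurableSpace T] {ν : Measure T} [SFinite ν]
    {m : T → ℝ × ℝ → ℂ} (hm : Measurable (Function.uncurry m)) {C : ℝ≥0∞} (hC : C ≠ ⊤)
    (hmC : ∀ ξ, ∫⁻ t, ‖m t ξ‖ₑ ∂ν ≤ C) (hb : ∀ t, ∃ B, ∀ ξ, ‖m t ξ‖ ≤ B)
    (hg : Integrable g) (hk : Integrable k) :
    ‖∫ x, syn (fun ξ => (∫ t, m t ξ ∂ν) * g ξ) x * k x‖ₑ ≤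
      ∫⁻ t, ‖∫ x, syn (fun ξ => m t ξ * g ξ) x * k x‖ₑ ∂ν := by
  have hgk : Integrable fun ξ => g ξ * syn k ξ :=
    hg.mul_bdd (c := ∫ ξ, ‖k ξ‖) (continuous_syn hk).aestronglyMeasurable
      (ae_of_all _ fun _ => norm_syn_le _ _)
  have key := enorm_syn_integral_le hm hC hmC hgk 0
  have h0 : ∀ G : ℝ × ℝ → ℂ, syn G 0 = ∫ ξ, G ξ := by
    intro G; unfold syn ch; simp
  simp_rw [h0] at key
  rw [integral_syn_mul (integrable_integral_mul hm hC hmC hg) hk]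
  refine (le_of_eq ?_).trans (key.trans (le_of_eq ?_))
  · simp_rw [mul_assoc]
  · refine lintegral_congr fun t => ?_
    obtain ⟨B, hB⟩ := hb t
    rw [integral_syn_mul _ hk]
    · simp_rw [mul_assoc]
    · exact hg.bdd_mul (c := B) (hm.comp measurable_prodMk_left).aestronglyMeasurable
        (ae_of_all _ hB)

end LacunaryHalfPlane

namespace LacunaryHalfPlane

open ProbabilityTheory ENNReal

section Schwartz

open FourierTransform

variable (f : SchwartzMap (ℝ × ℝ) ℂ)

/-- A Schwartz function on the plane, with the plane given its Euclidean norm. -/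
noncomputable def toEuclid : SchwartzMap (WithLp 2 (ℝ × ℝ)) ℂ :=
  SchwartzMap.compCLMOfContinuousLinearEquiv ℂ (WithLp.prodContinuousLinearEquiv 2 ℝ ℝ ℝ) f

theorem fourier2_eq (w : WithLp 2 (ℝ × ℝ)) : fourier2 f w.ofLp = (𝓕 (toEuclid f)) w := by
  rw [SchwartzMap.fourier_coe, Real.fourier_eq']
  unfold fourier2
  rw [← (WithLp.volume_preserving_ofLp (U := ℝ) (V := ℝ)).integral_comp
    (WithLp.prodContinuousLinearEquiv 2 ℝ ℝ ℝ).toHomeomorph.measurableEmbedding]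
  congr 1; ext y
  rw [smul_eq_mul, mul_comm, WithLp.prod_inner_apply]
  congr 1
  congr 1
  simp only [RCLike.inner_apply, conj_trivial]
  push_cast
  ring

theorem integrable_fourier2 : Integrable (fourier2 f) := by
  rw [← (WithLp.volume_preserving_ofLp (U := ℝ) (V := ℝ)).integrable_comp_emb
    (WithLp.prodContinuousLinearEquiv 2 ℝ ℝ ℝ).toHomeomorph.measurableEmbedding]
  refine (𝓕 (toEuclid f)).integrable.congr (ae_of_all _ fun w => ?_)
  exact (fourier2_eq f w).symm

theorem syn_fourier2 (x : ℝ × ℝ) : syn (fourier2 f) x = f x := by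
  have h : (𝓕⁻ (𝓕 (toEuclid f))) (WithLp.toLp 2 x) = f x := by
    rw [fourierInv_fourier_eq]; rfl
  rw [← h, SchwartzMap.fourierInv_coe, Real.fourierInv_eq']
  unfold syn
  rw [← (WithLp.volume_preserving_ofLp (U := ℝ) (V := ℝ)).integral_comp
    (WithLp.prodContinuousLinearEquiv 2 ℝ ℝ ℝ).toHomeomorph.measurableEmbedding]
  congr 1; ext y
  rw [smul_eq_mul, mul_comm, WithLp.prod_inner_apply]
  congr 1
  exact fourier2_eq f y

end Schwartz

section Gamma

theorem integral_exp_gamma {a c : ℝ} (ha : 0 < a) (hc : 0 < c) :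
    Integrable (fun t : ℝ => Real.exp (a * t) * Real.exp (-(c * Real.exp t))) ∧
    ∫ t : ℝ, Real.exp (a * t) * Real.exp (-(c * Real.exp t)) = (1 / c) ^ a * Real.Gamma a := by
  have him : Real.exp '' Set.univ = Set.Ioi 0 := by rw [Set.image_univ, Real.range_exp]
  have hd : ∀ x ∈ Set.univ, HasDerivWithinAt Real.exp (Real.exp x) Set.univ x :=
    fun x _ => (Real.hasDerivAt_exp x).hasDerivWithinAt
  have hE : ∀ t : ℝ, |Real.exp t| • (Real.exp t ^ (a - 1) * Real.exp (-(c * Real.exp t))) =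
      Real.exp (a * t) * Real.exp (-(c * Real.exp t)) := by
    intro t
    rw [Real.abs_exp, smul_eq_mul, ← mul_assoc]
    congr 1
    rw [← Real.exp_mul, ← Real.exp_add]
    congr 1; ring
  constructor
  · have h1 : IntegrableOn (fun t : ℝ => t ^ (a - 1) * Real.exp (-(c * t))) (Set.Ioi 0) := by
      have := integrableOn_rpow_mul_exp_neg_mul_rpow (p := 1) (s := a - 1) (b := c) (by linarith)
        one_pos hc
      simpa [neg_mul] using this
    rw [← him, integrableOn_image_iff_integrableOn_abs_deriv_smul MeasurableSet.univ hd
      Real.exp_injective.injOn] at h1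
    simp_rw [hE] at h1
    exact integrableOn_univ.1 h1
  · rw [← Real.integral_rpow_mul_exp_neg_mul_Ioi ha hc, ← him,
      integral_image_eq_integral_abs_deriv_smul MeasurableSet.univ hd Real.exp_injective.injOn]
    simp_rw [hE]
    rw [setIntegral_univ]

end Gamma

section Pairing

variable {e e' : ℝ × ℝ} {u v : ℝ} {F K g k : ℝ × ℝ → ℂ} {x ξ : ℝ × ℝ}

theorem integrable_heatC (hF : BddM F) (hi : Integrable F) : Integrable (heatC e v F) := by
  have hF' : BddM (heatC e v F) := hF.heatC
  have hm := hF.meas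
  refine ⟨hF'.meas.aestronglyMeasurable, ?_⟩
  refine lt_of_le_of_lt (lintegral_mono fun x => enorm_heatC_le x) ?_
  rw [lintegral_heatL (by fun_prop)]
  exact hi.2

theorem integrable_derC (hv : 0 < v) (hF : BddM F) (hi : Integrable F) :
    Integrable (derC e v F) := by
  have hF' : BddM (derC e v F) := hF.derC
  have hm := hF.meas
  refine ⟨hF'.meas.aestronglyMeasurable, ?_⟩
  refine lt_of_le_of_lt (lintegral_mono fun x => enorm_derC_le hm hv x) ?_
  rw [lintegral_const_mul _ (by fun_prop), lintegral_heatL (by fun_prop)]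
  exact ENNReal.mul_lt_top (by simp) hi.2

theorem integrable_sqB (hv : 0 < v) (hF : BddM F) (hi : Integrable F) :
    Integrable (sqB e v F) :=
  integrable_derC (by linarith) hF.heatC (integrable_heatC hF hi)

theorem measurePreserving_neg_stdG : MeasurePreserving (fun s : ℝ => -s) stdG stdG := by
  refine ⟨measurable_neg, ?_⟩
  have h := gaussianReal_map_neg (μ := 0) (v := 1)
  rwa [neg_zero] at h

theorem integral_heatC_mul (hF : BddM F) (hK : BddM K) (hi : Integrable K) :
    ∫ x, heatC e v F x * K x = ∫ x, F x * heatC e v K x := by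
  obtain ⟨C, hC⟩ := hF.bdd
  have hFm := hF.meas
  have hKm := hK.meas
  unfold heatC
  simp_rw [← integral_const_mul, ← integral_mul_const]
  have hinner : ∀ c : ℝ, Integrable (Function.uncurry fun (x : ℝ × ℝ) (s : ℝ) =>
      F (x + (c * s) • e) * K x) (volume.prod stdG) := by
    intro c
    have : Integrable (fun q : (ℝ × ℝ) × ℝ => K q.1 * (1 : ℂ)) (volume.prod stdG) :=
      hi.mul_prod (integrable_const (1 : ℂ))
    simp only [mul_one] at this
    exact this.bdd_mul (c := C) (Measurable.aestronglyMeasurable (by fun_prop))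
      (ae_of_all _ fun _ => hC _)
  have hinner2 : Integrable (Function.uncurry fun (x : ℝ × ℝ) (s : ℝ) =>
      F x * K (x + (√v * s) • e)) (volume.prod stdG) := by
    have hb : ∫⁻ q : (ℝ × ℝ) × ℝ, ‖K (q.1 + (√v * q.2) • e)‖ₑ ∂(volume.prod stdG) < ⊤ := by
      rw [lintegral_prod _ (by fun_prop)]
      change ∫⁻ x, heatL e v (fun y => ‖K y‖ₑ) x < ⊤
      rw [lintegral_heatL (by fun_prop)]
      exact hi.2
    have : Integrable (fun q : (ℝ × ℝ) × ℝ => K (q.1 + (√v * q.2) • e)) (volume.prod stdG) :=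
      ⟨Measurable.aestronglyMeasurable (by fun_prop), hb⟩
    exact this.bdd_mul (c := C) (Measurable.aestronglyMeasurable (by fun_prop))
      (ae_of_all _ fun _ => hC _)
  rw [integral_integral_swap (hinner _), integral_integral_swap hinner2]
  rw [← (measurePreserving_neg_stdG).integral_comp (MeasurableEquiv.neg ℝ).measurableEmbedding]
  congr 1; ext s
  rw [← integral_add_right_eq_self _ ((√v * s) • e)]
  congr 1; ext x
  have : x + (√v * s) • e + (√v * -s) • e = x := by
    rw [add_assoc, ← add_smul]; simp
  rw [this]

theorem integral_pi_mul (hF : BddM F) (hK : BddM K) (hi : Integrable K) :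
    ∫ x, heatC e v (derC e (3 * v) (derC e v (sqB e v F))) x * K x =
      -∫ x, derC e v (sqB e v F) x * sqB e v K x := by
  rw [integral_heatC_mul hF.sqB.derC.derC hK hi,
    integral_derC_mul hF.sqB.derC hK.heatC (integrable_heatC hK hi)]
  rfl

theorem integral_pi_mul' (hv : 0 < v) (hF : BddM F) (hK : BddM K) (hi : Integrable K) :
    ∫ x, heatC e v (derC e (3 * v) (derC e v (sqB e v F))) x * K x =
      ∫ x, sqB e v F x * derC e v (sqB e v K) x := by
  rw [integral_pi_mul hF hK hi, integral_derC_mul hF.sqB hK.sqB (integrable_sqB hv hK hi),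
    neg_neg]

theorem integral_sector_mul (hF : BddM F) (hK : BddM K) (hi : Integrable K) :
    ∫ x, heatC e v (derC e (3 * v) F) x * K x = -∫ x, F x * sqB e v K x := by
  rw [integral_heatC_mul hF.derC hK hi,
    integral_derC_mul hF hK.heatC (integrable_heatC hK hi)]
  rfl

end Pairing

end LacunaryHalfPlane

namespace LacunaryHalfPlane

open ProbabilityTheory ENNReal

/-- The pairing of `ξ` with the direction `e`. -/
noncomputable def dotp (e ξ : ℝ × ℝ) : ℝ := e.1 * ξ.1 + e.2 * ξ.2

@[fun_prop]
theorem continuous_dotp (e : ℝ × ℝ) : Continuous (dotp e) := by unfold dotp; fun_prop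

variable {e e' : ℝ × ℝ} {g k : ℝ × ℝ → ℂ} {x ξ : ℝ × ℝ}

theorem hS_eq (v : ℝ) : hS e v ξ = ((Real.exp (-(2 * Real.pi ^ 2 * v * dotp e ξ ^ 2)) : ℝ) : ℂ) := rfl

theorem dS_eq (v : ℝ) : dS e v ξ = ((2 * Real.pi * √v * dotp e ξ *
    Real.exp (-(2 * Real.pi ^ 2 * v * dotp e ξ ^ 2)) : ℝ) : ℂ) * Complex.I := by
  rw [dS, hS_eq, dotp]
  push_cast
  ring

theorem heatC_syn_fun {v : ℝ} (hv : 0 ≤ v) (hg : Integrable g) :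
    heatC e v (syn g) = syn fun ξ => hS e v ξ * g ξ := funext fun _ => heatC_syn hv hg

theorem derC_syn_fun {v : ℝ} (hv : 0 ≤ v) (hg : Integrable g) :
    derC e v (syn g) = syn fun ξ => dS e v ξ * g ξ := funext fun _ => derC_syn hv hg

/-- The symbol at scale `exp t` in the resolution of the directional Hilbert transform. -/
noncomputable def piSym (e : ℝ × ℝ) (t : ℝ) (ξ : ℝ × ℝ) : ℂ :=
  hS e (Real.exp t) ξ * (dS e (3 * Real.exp t) ξ * (dS e (Real.exp t) ξ *
    (dS e (3 * Real.exp t) ξ * hS e (Real.exp t) ξ)))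

theorem sqrt_exp_mul_exp (t : ℝ) : √(Real.exp t) * Real.exp t = Real.exp (3 / 2 * t) := by
  rw [← Real.exp_half, ← Real.exp_add]; congr 1; ring

theorem piSym_eq (t : ℝ) : piSym e t ξ = ((24 * Real.pi ^ 3 * dotp e ξ ^ 3 *
    (Real.exp (3 / 2 * t) * Real.exp (-(18 * Real.pi ^ 2 * dotp e ξ ^ 2 * Real.exp t))) : ℝ) : ℂ) *
      -Complex.I := by
  rw [piSym, hS_eq, dS_eq, dS_eq]
  set θ := dotp e ξ
  set v := Real.exp t with hv
  have hvp : 0 < v := Real.exp_pos t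
  have h3 : √(3 * v) * √(3 * v) = 3 * v := Real.mul_self_sqrt (by positivity)
  have hI : Complex.I * Complex.I * Complex.I = -Complex.I := by rw [Complex.I_mul_I]; ring
  set E1 := Real.exp (-(2 * Real.pi ^ 2 * v * θ ^ 2))
  set E3 := Real.exp (-(2 * Real.pi ^ 2 * (3 * v) * θ ^ 2))
  have hE : E1 * E3 * E1 * E3 * E1 = Real.exp (-(18 * Real.pi ^ 2 * θ ^ 2 * v)) := by
    simp only [E1, E3, ← Real.exp_add]; congr 1; ring
  rw [← sqrt_exp_mul_exp, ← hE, ← hI]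
  have : (24 * Real.pi ^ 3 * θ ^ 3 * (√v * v * (E1 * E3 * E1 * E3 * E1)) : ℝ) =
      (2 * Real.pi) ^ 3 * θ ^ 3 * √v * (3 * v) * (E1 * E3 * E1 * E3 * E1) := by ring
  rw [this]
  generalize √(3 * v) = w at h3 ⊢
  rw [← h3]
  push_cast
  ring

theorem measurable_piSym (e : ℝ × ℝ) : Measurable (Function.uncurry (piSym e)) := by
  unfold piSym
  unfold Function.uncurry
  fun_prop

/-- The normalizing constant in the resolution of the directional Hilbert transform. -/
noncomputable def piC : ℝ :=
  24 * Real.pi ^ 3 * (1 / (18 * Real.pi ^ 2)) ^ (3 / 2 : ℝ) * Real.Gamma (3 / 2)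

theorem piC_pos : 0 < piC := by
  have := Real.Gamma_pos_of_pos (s := 3 / 2) (by norm_num)
  unfold piC
  positivity

theorem one_div_sq_rpow {θ : ℝ} (hθ : θ ≠ 0) : (1 / (18 * Real.pi ^ 2 * θ ^ 2)) ^ (3 / 2 : ℝ) =
    (1 / (18 * Real.pi ^ 2)) ^ (3 / 2 : ℝ) * (1 / |θ| ^ 3) := by
  have h : 0 < |θ| := abs_pos.2 hθ
  have : 1 / (18 * Real.pi ^ 2 * θ ^ 2) = (1 / (18 * Real.pi ^ 2)) * (1 / |θ|) ^ (2 : ℝ) := by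
    rw [Real.rpow_two, div_pow, sq_abs, one_pow, div_mul_div_comm, one_mul]
  rw [this, Real.mul_rpow (by positivity) (by positivity), ← Real.rpow_mul (by positivity)]
  congr 1
  rw [show (2 * (3 / 2) : ℝ) = (3 : ℕ) by norm_num, Real.rpow_natCast, div_pow, one_pow]

theorem integral_piSym (e ξ : ℝ × ℝ) :
    ∫ t, piSym e t ξ = ((SignType.sign (dotp e ξ) : ℝ) : ℂ) * (piC * -Complex.I) := by
  simp_rw [piSym_eq]
  rw [integral_mul_const, integral_complex_ofReal, integral_const_mul]
  rcases eq_or_ne (dotp e ξ) 0 with h | h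
  · rw [h]; simp
  · rw [(integral_exp_gamma (by norm_num) (by positivity)).2, one_div_sq_rpow h,
      ← mul_assoc ((SignType.sign (dotp e ξ) : ℝ) : ℂ), ← Complex.ofReal_mul]
    congr 2
    unfold piC
    have h1 : |dotp e ξ| ≠ 0 := abs_ne_zero.2 h
    rcases lt_or_gt_of_ne h with h2 | h2
    · rw [abs_of_neg h2, sign_neg h2, SignType.coe_neg, SignType.coe_one]
      field_simp
    · rw [abs_of_pos h2, sign_pos h2, SignType.coe_one]
      field_simp

theorem lintegral_piSym_le (e ξ : ℝ × ℝ) : ∫⁻ t, ‖piSym e t ξ‖ₑ ≤ ENNReal.ofReal piC := by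
  have h0 : ∀ t, ‖piSym e t ξ‖ₑ = ENNReal.ofReal (24 * Real.pi ^ 3 * |dotp e ξ| ^ 3 *
    (Real.exp (3 / 2 * t) * Real.exp (-(18 * Real.pi ^ 2 * dotp e ξ ^ 2 * Real.exp t)))) := by
    intro t
    rw [piSym_eq, ← ofReal_norm, norm_mul, norm_neg, Complex.norm_I, mul_one, Complex.norm_real,
      Real.norm_eq_abs, abs_mul, abs_mul, abs_pow, abs_of_pos (by positivity : 0 < 24 * Real.pi ^ 3)]
    congr 2
    exact abs_of_pos (by positivity)
  simp_rw [h0]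
  rcases eq_or_ne (dotp e ξ) 0 with h | h
  · rw [h]; simp
  · have hi := integral_exp_gamma (a := 3 / 2) (c := 18 * Real.pi ^ 2 * dotp e ξ ^ 2) (by norm_num)
      (by positivity)
    rw [← ofReal_integral_eq_lintegral_ofReal (hi.1.const_mul _)
      (ae_of_all _ fun t => by positivity), integral_const_mul, hi.2, one_div_sq_rpow h]
    apply ENNReal.ofReal_le_ofReal
    unfold piC
    have h1 : |dotp e ξ| ≠ 0 := abs_ne_zero.2 h
    apply le_of_eq
    field_simp

theorem syn_piSym (hg : Integrable g) (t : ℝ) (x : ℝ × ℝ) :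
    heatC e (Real.exp t) (derC e (3 * Real.exp t) (derC e (Real.exp t) (sqB e (Real.exp t) (syn g)))) x =
      syn (fun ξ => piSym e t ξ * g ξ) x := by
  have hv := (Real.exp_pos t).le
  have hv3 : 0 ≤ 3 * Real.exp t := by positivity
  have i1 := integrable_hS_mul (e := e) hv hg
  have i2 := integrable_dS_mul (e := e) hv3 i1
  have i3 := integrable_dS_mul (e := e) hv i2
  have i4 := integrable_dS_mul (e := e) hv3 i3
  unfold sqB
  rw [heatC_syn_fun hv hg, derC_syn_fun hv3 i1,
    derC_syn_fun hv i2, derC_syn_fun hv3 i3,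
    heatC_syn hv i4]
  unfold piSym
  simp_rw [mul_assoc]

theorem enorm_sign_pair_le (hg : Integrable g) (hk : Integrable k) :
    ‖∫ x, syn (fun ξ => ((SignType.sign (dotp e ξ) : ℝ) : ℂ) * g ξ) x * k x‖ₑ ≤
      ENNReal.ofReal (1 / piC) * ∫⁻ t, ‖∫ x, heatC e (Real.exp t) (derC e (3 * Real.exp t)
        (derC e (Real.exp t) (sqB e (Real.exp t) (syn g)))) x * k x‖ₑ := by
  have key := enorm_pair_syn_le (measurable_piSym e) ENNReal.ofReal_ne_top
    (lintegral_piSym_le e) (fun t => ⟨1, fun ξ => ?_⟩) hg hk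
  · have h1 : ∀ x, syn (fun ξ => (∫ t, piSym e t ξ) * g ξ) x =
        (piC * -Complex.I) * syn (fun ξ => ((SignType.sign (dotp e ξ) : ℝ) : ℂ) * g ξ) x := by
      intro x
      rw [← syn_const_mul]
      congr 1; ext ξ
      rw [integral_piSym]; ring
    simp_rw [h1, mul_assoc, integral_const_mul, enorm_mul, enorm_neg] at key
    have h2 : ‖(piC : ℂ)‖ₑ = ENNReal.ofReal piC := by
      rw [← ofReal_norm, Complex.norm_real, Real.norm_of_nonneg piC_pos.le]
    have h3 : ‖Complex.I‖ₑ = 1 := by rw [← ofReal_norm, Complex.norm_I]; simp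
    rw [h2, h3, one_mul] at key
    simp_rw [syn_piSym hg]
    refine le_trans (le_of_eq ?_) (mul_le_mul_right key (ENNReal.ofReal (1 / piC)))
    rw [← mul_assoc, ← ENNReal.ofReal_mul (by have := piC_pos; positivity),
      one_div_mul_cancel piC_pos.ne']
    simp
  · have hv := (Real.exp_pos t).le
    have hv3 : 0 ≤ 3 * Real.exp t := by positivity
    unfold piSym
    simp only [norm_mul]
    exact mul_le_one₀ (norm_hS_le hv) (by positivity) (mul_le_one₀ (norm_dS_le hv3) (by positivity)
      (mul_le_one₀ (norm_dS_le hv) (by positivity) (mul_le_one₀ (norm_dS_le hv3) (by positivity)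
        (norm_hS_le hv))))

/-- The symbol at scale `exp t` in the resolution of the sector multiplier. -/
noncomputable def sectSym (e e' : ℝ × ℝ) (t : ℝ) (ξ : ℝ × ℝ) : ℂ :=
  hS e (Real.exp t) ξ * (dS e (3 * Real.exp t) ξ * (dS e' (4 * Real.exp t) ξ *
    (dS e' (3 * Real.exp t) ξ * (hS e' (Real.exp t) ξ *
      (dS e (3 * Real.exp t) ξ * hS e (Real.exp t) ξ)))))

theorem sectSym_eq (t : ℝ) : sectSym e e' t ξ = ((96 * √3 * Real.pi ^ 4 *
    (dotp e ξ ^ 2 * dotp e' ξ ^ 2) * (Real.exp (2 * t) *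
      Real.exp (-(16 * Real.pi ^ 2 * (dotp e ξ ^ 2 + dotp e' ξ ^ 2) * Real.exp t))) : ℝ) : ℂ) := by
  rw [sectSym, hS_eq, hS_eq, dS_eq, dS_eq, dS_eq]
  set θ := dotp e ξ
  set η := dotp e' ξ
  have hv2 : Real.exp (2 * t) = Real.exp t ^ 2 := by rw [← Real.exp_nat_mul]; norm_num
  rw [hv2]
  set v := Real.exp t with hv
  have hvp : 0 < v := Real.exp_pos t
  have h3 : √(3 * v) * √(3 * v) = 3 * v := Real.mul_self_sqrt (by positivity)
  have h4 : √(4 * v) * √(3 * v) = 2 * √3 * v := by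
    rw [← Real.sqrt_mul (by positivity), show 4 * v * (3 * v) = 3 * (2 * v) ^ 2 by ring,
      Real.sqrt_mul (by norm_num), Real.sqrt_sq (by positivity)]
    ring
  have hI : Complex.I * Complex.I * (Complex.I * Complex.I) = 1 := by rw [Complex.I_mul_I]; ring
  set E1 := Real.exp (-(2 * Real.pi ^ 2 * v * θ ^ 2))
  set E3 := Real.exp (-(2 * Real.pi ^ 2 * (3 * v) * θ ^ 2))
  set D1 := Real.exp (-(2 * Real.pi ^ 2 * v * η ^ 2))
  set D3 := Real.exp (-(2 * Real.pi ^ 2 * (3 * v) * η ^ 2))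
  set D4 := Real.exp (-(2 * Real.pi ^ 2 * (4 * v) * η ^ 2))
  have hE : E1 * E3 * D4 * D3 * D1 * E3 * E1 =
      Real.exp (-(16 * Real.pi ^ 2 * (θ ^ 2 + η ^ 2) * v)) := by
    simp only [E1, E3, D1, D3, D4, ← Real.exp_add]; congr 1; ring
  rw [← hE]
  have : (96 * √3 * Real.pi ^ 4 * (θ ^ 2 * η ^ 2) * (v ^ 2 * (E1 * E3 * D4 * D3 * D1 * E3 * E1)) : ℝ) =
      (2 * Real.pi) ^ 4 * (θ ^ 2 * η ^ 2) * (3 * v) * (2 * √3 * v) *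
        (E1 * E3 * D4 * D3 * D1 * E3 * E1) := by ring
  rw [this]
  generalize √(3 * v) = w at h3 h4 ⊢
  rw [← h3, ← h4]
  conv_rhs => rw [← mul_one ((_ : ℝ) : ℂ), ← hI]
  push_cast
  ring

theorem measurable_sectSym (e e' : ℝ × ℝ) : Measurable (Function.uncurry (sectSym e e')) := by
  unfold sectSym
  unfold Function.uncurry
  fun_prop

/-- The symbol of the sector multiplier. -/
noncomputable def sectS (e e' ξ : ℝ × ℝ) : ℝ :=
  4 * (dotp e ξ ^ 2 * dotp e' ξ ^ 2) / (dotp e ξ ^ 2 + dotp e' ξ ^ 2) ^ 2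

theorem integral_sectSym_real (e e' ξ : ℝ × ℝ) :
    Integrable (fun t : ℝ => 96 * √3 * Real.pi ^ 4 *
    (dotp e ξ ^ 2 * dotp e' ξ ^ 2) * (Real.exp (2 * t) *
      Real.exp (-(16 * Real.pi ^ 2 * (dotp e ξ ^ 2 + dotp e' ξ ^ 2) * Real.exp t)))) ∧
    ∫ t, 96 * √3 * Real.pi ^ 4 *
    (dotp e ξ ^ 2 * dotp e' ξ ^ 2) * (Real.exp (2 * t) *
      Real.exp (-(16 * Real.pi ^ 2 * (dotp e ξ ^ 2 + dotp e' ξ ^ 2) * Real.exp t))) =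
    (3 * √3 / 32) * sectS e e' ξ := by
  rw [integral_const_mul]
  unfold sectS
  set θ := dotp e ξ
  set η := dotp e' ξ
  rcases eq_or_ne (θ ^ 2 + η ^ 2) 0 with h | h
  · have h1 : θ ^ 2 = 0 := by nlinarith [sq_nonneg θ, sq_nonneg η]
    rw [h1]; simp
  · have hp : 0 < θ ^ 2 + η ^ 2 := lt_of_le_of_ne (by positivity) (Ne.symm h)
    have hi := integral_exp_gamma (a := 2) (c := 16 * Real.pi ^ 2 * (θ ^ 2 + η ^ 2)) (by norm_num)
      (by positivity)
    refine ⟨hi.1.const_mul _, ?_⟩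
    rw [hi.2, Real.Gamma_two, Real.rpow_two]
    field_simp
    ring

theorem integral_sectSym (e e' ξ : ℝ × ℝ) :
    ∫ t, sectSym e e' t ξ = ((3 * √3 / 32 : ℝ) : ℂ) * (sectS e e' ξ : ℂ) := by
  simp_rw [sectSym_eq]
  rw [integral_complex_ofReal, (integral_sectSym_real e e' ξ).2, Complex.ofReal_mul]

theorem sectS_nonneg (e e' ξ : ℝ × ℝ) : 0 ≤ sectS e e' ξ := by unfold sectS; positivity

theorem sectS_le_one (e e' ξ : ℝ × ℝ) : sectS e e' ξ ≤ 1 := by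
  unfold sectS
  apply div_le_one_of_le₀ _ (by positivity)
  nlinarith [sq_nonneg (dotp e ξ ^ 2 - dotp e' ξ ^ 2)]

theorem lintegral_sectSym_le (e e' ξ : ℝ × ℝ) :
    ∫⁻ t, ‖sectSym e e' t ξ‖ₑ ≤ ENNReal.ofReal (3 * √3 / 32) := by
  simp_rw [sectSym_eq]
  have h0 : ∀ r : ℝ, 0 ≤ r → ‖(r : ℂ)‖ₑ = ENNReal.ofReal r := fun r hr => by
    rw [← ofReal_norm, Complex.norm_real, Real.norm_of_nonneg hr]
  have h1 : ∀ t : ℝ, 0 ≤ 96 * √3 * Real.pi ^ 4 *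
    (dotp e ξ ^ 2 * dotp e' ξ ^ 2) * (Real.exp (2 * t) *
      Real.exp (-(16 * Real.pi ^ 2 * (dotp e ξ ^ 2 + dotp e' ξ ^ 2) * Real.exp t))) :=
    fun t => by positivity
  simp_rw [h0 _ (h1 _)]
  rw [← ofReal_integral_eq_lintegral_ofReal (integral_sectSym_real e e' ξ).1 (ae_of_all _ h1),
    (integral_sectSym_real e e' ξ).2]
  apply ENNReal.ofReal_le_ofReal
  exact mul_le_of_le_one_right (by positivity) (sectS_le_one e e' ξ)

theorem syn_sectSym (hg : Integrable g) (t : ℝ) (x : ℝ × ℝ) :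
    heatC e (Real.exp t) (derC e (3 * Real.exp t) (derC e' (4 * Real.exp t)
      (sqB e' (Real.exp t) (sqB e (Real.exp t) (syn g))))) x =
      syn (fun ξ => sectSym e e' t ξ * g ξ) x := by
  have hv := (Real.exp_pos t).le
  have hv3 : 0 ≤ 3 * Real.exp t := by positivity
  have hv4 : 0 ≤ 4 * Real.exp t := by positivity
  have i1 := integrable_hS_mul (e := e) hv hg
  have i2 := integrable_dS_mul (e := e) hv3 i1
  have i3 := integrable_hS_mul (e := e') hv i2
  have i4 := integrable_dS_mul (e := e') hv3 i3
  have i5 := integrable_dS_mul (e := e') hv4 i4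
  have i6 := integrable_dS_mul (e := e) hv3 i5
  unfold sqB
  rw [heatC_syn_fun hv hg, derC_syn_fun hv3 i1,
    heatC_syn_fun hv i2, derC_syn_fun hv3 i3,
    derC_syn_fun hv4 i4, derC_syn_fun hv3 i5,
    heatC_syn hv i6]
  unfold sectSym
  simp_rw [mul_assoc]

/-- The sector multiplier applied to the function with frequency density `g`. -/
noncomputable def sectOp (e e' : ℝ × ℝ) (g : ℝ × ℝ → ℂ) (x : ℝ × ℝ) : ℂ :=
  syn (fun ξ => (sectS e e' ξ : ℂ) * g ξ) x

theorem integrable_sectS_mul (hg : Integrable g) :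
    Integrable fun ξ => (sectS e e' ξ : ℂ) * g ξ := by
  refine hg.bdd_mul (c := 1) (Measurable.aestronglyMeasurable ?_) (ae_of_all _ fun ξ => ?_)
  · unfold sectS; fun_prop
  · rw [Complex.norm_real, Real.norm_of_nonneg (sectS_nonneg _ _ _)]
    exact sectS_le_one _ _ _

theorem BddM.sectOp (hg : Integrable g) : BddM (sectOp e e' g) :=
  BddM.syn (integrable_sectS_mul hg)

theorem enorm_sectOp_pair_le (hg : Integrable g) (hk : BddM k) (hi : Integrable k) :
    ‖∫ x, sectOp e e' g x * k x‖ₑ ≤ ENNReal.ofReal (32 / (3 * √3)) *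
      ∫⁻ t : ℝ, ∫⁻ x, ‖derC e' (4 * Real.exp t) (sqB e' (Real.exp t) (sqB e (Real.exp t) (syn g))) x‖ₑ *
        ‖sqB e (Real.exp t) k x‖ₑ := by
  have key := enorm_pair_syn_le (measurable_sectSym e e') ENNReal.ofReal_ne_top
    (lintegral_sectSym_le e e') (fun t => ⟨1, fun ξ => ?_⟩) hg hi
  · have h1 : ∀ x, syn (fun ξ => (∫ t, sectSym e e' t ξ) * g ξ) x =
        ((3 * √3 / 32 : ℝ) : ℂ) * sectOp e e' g x := by
      intro x
      rw [sectOp, ← syn_const_mul]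
      congr 1; ext ξ
      rw [integral_sectSym]; ring
    simp_rw [h1, mul_assoc, integral_const_mul, enorm_mul] at key
    have h2 : ‖((3 * √3 / 32 : ℝ) : ℂ)‖ₑ = ENNReal.ofReal (3 * √3 / 32) := by
      rw [← ofReal_norm, Complex.norm_real, Real.norm_of_nonneg (by positivity)]
    rw [h2] at key
    refine le_trans (le_of_eq ?_) ((mul_le_mul_right key (ENNReal.ofReal (32 / (3 * √3)))).trans
      (mul_le_mul_right (lintegral_mono fun t => ?_) _))
    · rw [← mul_assoc, ← ENNReal.ofReal_mul (by positivity),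
        show 32 / (3 * √3) * (3 * √3 / 32) = 1 by field_simp]
      simp
    · simp_rw [← syn_sectSym hg]
      rw [integral_sector_mul (BddM.syn hg).sqB.sqB.derC hk hi, enorm_neg]
      refine (enorm_integral_le_lintegral_enorm _).trans (le_of_eq ?_)
      simp_rw [enorm_mul]
  · have hv := (Real.exp_pos t).le
    have hv3 : 0 ≤ 3 * Real.exp t := by positivity
    have hv4 : 0 ≤ 4 * Real.exp t := by positivity
    unfold sectSym
    simp only [norm_mul]
    exact mul_le_one₀ (norm_hS_le hv) (by positivity) (mul_le_one₀ (norm_dS_le hv3) (by positivity)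
      (mul_le_one₀ (norm_dS_le hv4) (by positivity) (mul_le_one₀ (norm_dS_le hv3) (by positivity)
      (mul_le_one₀ (norm_hS_le hv) (by positivity) (mul_le_one₀ (norm_dS_le hv3) (by positivity)
        (norm_hS_le hv))))))

end LacunaryHalfPlane

namespace LacunaryHalfPlane

open ProbabilityTheory ENNReal

variable {e e' : ℝ × ℝ} {g k : ℝ × ℝ → ℂ} {x ξ : ℝ × ℝ}

theorem lintegral_stdG_rotate {φ : ℝ × ℝ → ℝ≥0∞} (hφ : Measurable φ) :
    ∫⁻ s, ∫⁻ r, φ ((s - r) / √2, (s + r) / √2) ∂stdG ∂stdG = ∫⁻ s, ∫⁻ r, φ (s, r) ∂stdG ∂stdG := by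
  have h0 : ∫ s, id s ∂stdG = 0 := by simp
  have h := IsGaussian.map_rotation_eq_self h0 (-(Real.pi / 4))
  have h1 : Measurable fun q : ℝ × ℝ => φ ((q.1 - q.2) / √2, (q.1 + q.2) / √2) := by fun_prop
  rw [← lintegral_prod _ hφ.aemeasurable, ← lintegral_prod _ h1.aemeasurable]
  conv_rhs => rw [← h]
  rw [lintegral_map hφ (ContinuousLinearMap.rotation _).continuous.measurable]
  congr 1; ext q
  rw [ContinuousLinearMap.rotation_apply]
  simp only [Real.cos_neg, Real.sin_neg, Real.cos_pi_div_four, Real.sin_pi_div_four, smul_eq_mul]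
  have h2 : √2 ^ 2 = (2 : ℝ) := Real.sq_sqrt (by norm_num)
  congr 2
  · field_simp
    linear_combination (-(q.1 - q.2)) * h2
  · field_simp
    linear_combination (-(q.1 + q.2)) * h2

theorem heatL_diag {v : ℝ} {F : ℝ × ℝ → ℝ≥0∞} (hF : Measurable F) (x : ℝ × ℝ) :
    heatL (e + e') v (heatL (e - e') v F) x = heatL e (2 * v) (heatL e' (2 * v) F) x := by
  rw [heatL_comm hF (e := e)]
  unfold heatL
  rw [← lintegral_stdG_rotate (φ := fun q => F (x + (√(2 * v) * q.1) • e' + (√(2 * v) * q.2) • e))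
    (by fun_prop)]
  rw [lintegral_lintegral_swap (by fun_prop)]
  rw [lintegral_lintegral_swap (by fun_prop)]
  congr! 5 with s r
  rw [Real.sqrt_mul (by norm_num)]
  have h2 : √2 ≠ 0 := by positivity
  ext
  · simp
    field_simp
    ring
  · simp
    field_simp
    ring

theorem enorm_derC_derC_le {F : ℝ × ℝ → ℂ} (hF : BddM F) {v : ℝ} (hv : 0 < v) (x : ℝ × ℝ) :
    ‖derC e v (derC e v F) x‖ₑ ≤ 9 * heatL e (4 * v) (fun y => ‖F y‖ₑ) x := by
  have hm : Measurable fun y => ‖F y‖ₑ := hF.meas.enorm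
  refine (enorm_derC_le hF.derC.meas hv x).trans ?_
  refine (mul_le_mul_right (heatL_mono (fun y => enorm_derC_le hF.meas hv y) x) _).trans ?_
  rw [heatL_const_mul _ (by fun_prop), heatL_heatL (by positivity) (by positivity) hm, ← mul_assoc]
  refine le_of_eq ?_
  congr 1
  · norm_num
  · congr 1; ring

theorem enorm_derC_six_le {a b : ℝ × ℝ} {F : ℝ × ℝ → ℂ} (hF : BddM F) {v w : ℝ} (hv : 0 < v) (hw : 0 < w)
    (x : ℝ × ℝ) :
    ‖derC a v (derC a v (derC b w (derC b w (derC b w (derC b w F))))) x‖ₑ ≤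
      729 * heatL a (4 * v) (heatL b (8 * w) fun y => ‖F y‖ₑ) x := by
  have hm : Measurable fun y => ‖F y‖ₑ := hF.meas.enorm
  refine (enorm_derC_derC_le hF.derC.derC.derC.derC hv x).trans ?_
  refine (mul_le_mul_right (heatL_mono (fun y => (enorm_derC_derC_le hF.derC.derC hw y).trans
    (mul_le_mul_right (heatL_mono (fun z => enorm_derC_derC_le hF hw z) y) _)) x) _).trans ?_
  have h1 : ∀ y, 9 * heatL b (4 * w) (fun z => 9 * heatL b (4 * w) (fun y => ‖F y‖ₑ) z) y =
      81 * heatL b (8 * w) (fun y => ‖F y‖ₑ) y := by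
    intro y
    rw [heatL_const_mul _ (by fun_prop), heatL_heatL (by positivity) (by positivity) hm, ← mul_assoc]
    congr 1
    · norm_num
    · congr 1; ring
  simp_rw [h1]
  rw [heatL_const_mul _ (by fun_prop), ← mul_assoc]
  refine le_of_eq ?_
  congr 1
  norm_num

/-- The density in the integral representation of the error symbol. -/
noncomputable def errSym (a b : ℝ × ℝ) (t : ℝ) (p : ℝ × ℝ) (ξ : ℝ × ℝ) : ℝ :=
  32 * Real.pi ^ 6 * dotp a ξ ^ 2 * dotp b ξ ^ 4 * Real.exp (-(2 * Real.pi ^ 2 * t * dotp a ξ ^ 2)) *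
    (Real.exp (-(2 * Real.pi ^ 2 * dotp b ξ ^ 2 * p.1)) *
      (p.2 * Real.exp (-(2 * Real.pi ^ 2 * (dotp a ξ ^ 2 + dotp b ξ ^ 2) * p.2))))

theorem measurable_errSym (a b : ℝ × ℝ) (t : ℝ) :
    Measurable (Function.uncurry fun p ξ => (errSym a b t p ξ : ℂ)) := by
  unfold errSym Function.uncurry
  fun_prop

/-- The parameter measure in the integral representation of the error symbol. -/
noncomputable abbrev errM (t : ℝ) : Measure (ℝ × ℝ) :=
  (volume.restrict (Set.Ioc 0 t)).prod (volume.restrict (Set.Ioi 0))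

theorem integral_mul_exp_Ioi {c : ℝ} (hc : 0 < c) :
    IntegrableOn (fun l : ℝ => l * Real.exp (-(c * l))) (Set.Ioi 0) ∧
      ∫ l in Set.Ioi (0 : ℝ), l * Real.exp (-(c * l)) = 1 / c ^ 2 := by
  have h := Real.integral_rpow_mul_exp_neg_mul_Ioi (a := 2) (r := c) (by norm_num) hc
  have h1 : ∀ l : ℝ, l ^ ((2 : ℝ) - 1) * Real.exp (-(c * l)) = l * Real.exp (-(c * l)) := by
    intro l; norm_num
  simp_rw [h1, Real.Gamma_two, mul_one, Real.rpow_two, div_pow, one_pow] at h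
  refine ⟨?_, h⟩
  by_contra hn
  rw [integral_undef hn] at h
  have : 0 < 1 / c ^ 2 := by positivity
  exact this.ne h

theorem integral_exp_Ioc {c t : ℝ} (hc : c ≠ 0) (ht : 0 ≤ t) :
    ∫ r in Set.Ioc 0 t, Real.exp (-(c * r)) = (1 - Real.exp (-(c * t))) / c := by
  rw [← intervalIntegral.integral_of_le ht]
  have : ∀ r, Real.exp (-(c * r)) = Real.exp ((-c) * r) := fun r => by ring_nf
  simp_rw [this]
  rw [intervalIntegral.integral_comp_mul_left (fun r => Real.exp r) (neg_ne_zero.2 hc), integral_exp]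
  simp
  field_simp
  ring

theorem integral_errSym {a b : ℝ × ℝ} {t : ℝ} (ht : 0 ≤ t) :
    Integrable (fun p => errSym a b t p ξ) (errM t) ∧ ∫ p, errSym a b t p ξ ∂(errM t) =
      Real.exp (-(2 * Real.pi ^ 2 * t * dotp a ξ ^ 2)) *
        (1 - Real.exp (-(2 * Real.pi ^ 2 * t * dotp b ξ ^ 2))) *
        (4 * (dotp a ξ ^ 2 * dotp b ξ ^ 2) / (dotp a ξ ^ 2 + dotp b ξ ^ 2) ^ 2) := by
  unfold errSym
  rcases eq_or_ne (dotp b ξ) 0 with hb | hb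
  · simp [hb]
  have h2 : 0 < 2 * Real.pi ^ 2 * (dotp a ξ ^ 2 + dotp b ξ ^ 2) := by positivity
  have h3 := integral_mul_exp_Ioi h2
  constructor
  · refine Integrable.const_mul ?_ _
    refine Integrable.mul_prod (f := fun r : ℝ => Real.exp (-(2 * Real.pi ^ 2 * dotp b ξ ^ 2 * r)))
      (g := fun l : ℝ => l * Real.exp (-(2 * Real.pi ^ 2 * (dotp a ξ ^ 2 + dotp b ξ ^ 2) * l))) ?_ h3.1
    exact (Continuous.integrableOn_Icc (by fun_prop)).mono_set Set.Ioc_subset_Icc_self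
  · rw [integral_const_mul, integral_prod_mul
      (f := fun r : ℝ => Real.exp (-(2 * Real.pi ^ 2 * dotp b ξ ^ 2 * r)))
      (g := fun l : ℝ => l * Real.exp (-(2 * Real.pi ^ 2 * (dotp a ξ ^ 2 + dotp b ξ ^ 2) * l))),
      integral_exp_Ioc (by positivity) ht, h3.2]
    rw [show 2 * Real.pi ^ 2 * dotp b ξ ^ 2 * t = 2 * Real.pi ^ 2 * t * dotp b ξ ^ 2 by ring]
    generalize 1 - Real.exp (-(2 * Real.pi ^ 2 * t * dotp b ξ ^ 2)) = E
    have h4 : dotp a ξ ^ 2 + dotp b ξ ^ 2 ≠ 0 := by positivity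
    field_simp
    ring

theorem lintegral_errSym_le {a b : ℝ × ℝ} {t : ℝ} (ht : 0 ≤ t) :
    ∫⁻ p, ‖(errSym a b t p ξ : ℂ)‖ₑ ∂(errM t) ≤ 1 := by
  have h0 : ∀ᵐ p ∂(errM t), 0 ≤ errSym a b t p ξ := by
    rw [errM, Measure.prod_restrict]
    filter_upwards [ae_restrict_mem (measurableSet_Ioc.prod measurableSet_Ioi)] with p hp
    have : 0 < p.2 := hp.2
    unfold errSym
    positivity
  have h1 : ∫⁻ p, ‖(errSym a b t p ξ : ℂ)‖ₑ ∂(errM t) =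
      ∫⁻ p, ENNReal.ofReal (errSym a b t p ξ) ∂(errM t) := by
    refine lintegral_congr_ae ?_
    filter_upwards [h0] with p hp
    rw [← ofReal_norm, Complex.norm_real, Real.norm_of_nonneg hp]
  rw [h1, ← ofReal_integral_eq_lintegral_ofReal (integral_errSym ht).1 h0, (integral_errSym ht).2]
  rw [← ENNReal.ofReal_one]
  apply ENNReal.ofReal_le_ofReal
  have h2 : Real.exp (-(2 * Real.pi ^ 2 * t * dotp a ξ ^ 2)) ≤ 1 := by
    rw [Real.exp_le_one_iff, Left.neg_nonpos_iff]; positivity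
  have h3 : 0 ≤ 1 - Real.exp (-(2 * Real.pi ^ 2 * t * dotp b ξ ^ 2)) := by
    rw [sub_nonneg, Real.exp_le_one_iff, Left.neg_nonpos_iff]; positivity
  have h3' : 1 - Real.exp (-(2 * Real.pi ^ 2 * t * dotp b ξ ^ 2)) ≤ 1 := by
    linarith [Real.exp_pos (-(2 * Real.pi ^ 2 * t * dotp b ξ ^ 2))]
  have h4 : 4 * (dotp a ξ ^ 2 * dotp b ξ ^ 2) / (dotp a ξ ^ 2 + dotp b ξ ^ 2) ^ 2 ≤ 1 := by
    apply div_le_one_of_le₀ _ (by positivity)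
    nlinarith [sq_nonneg (dotp a ξ ^ 2 - dotp b ξ ^ 2)]
  exact mul_le_one₀ (mul_le_one₀ h2 h3 h3') (by positivity) h4

theorem errSym_eq_dS {a b : ℝ × ℝ} {t r l : ℝ} (hr : 0 < r) (hrt : r ≤ t) (hl : 0 < l) :
    (errSym a b t (r, l) ξ : ℂ) = ((-(16 * l / ((t + l) * (l + r) ^ 2)) : ℝ) : ℂ) *
      (dS a ((t + l) / 2) ξ * (dS a ((t + l) / 2) ξ * (dS b ((l + r) / 4) ξ * (dS b ((l + r) / 4) ξ *
        (dS b ((l + r) / 4) ξ * dS b ((l + r) / 4) ξ))))) := by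
  have ht : 0 < t := hr.trans_le hrt
  have h1 : ∀ (c : ℝ × ℝ) (v : ℝ), 0 ≤ v → dS c v ξ * dS c v ξ =
      ((-(4 * Real.pi ^ 2 * v * dotp c ξ ^ 2 * Real.exp (-(4 * Real.pi ^ 2 * v * dotp c ξ ^ 2))) : ℝ) : ℂ) := by
    intro c v hv
    rw [dS_eq, mul_mul_mul_comm, Complex.I_mul_I, ← Complex.ofReal_mul, mul_neg_one,
      ← Complex.ofReal_neg]
    congr 2
    rw [show -(4 * Real.pi ^ 2 * v * dotp c ξ ^ 2) = -(2 * Real.pi ^ 2 * v * dotp c ξ ^ 2) +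
      -(2 * Real.pi ^ 2 * v * dotp c ξ ^ 2) by ring, Real.exp_add]
    have := Real.mul_self_sqrt hv
    generalize √v = w at this ⊢
    rw [← this]; ring
  have h2 : dS a ((t + l) / 2) ξ * (dS a ((t + l) / 2) ξ * (dS b ((l + r) / 4) ξ * (dS b ((l + r) / 4) ξ *
        (dS b ((l + r) / 4) ξ * dS b ((l + r) / 4) ξ)))) =
      (dS a ((t + l) / 2) ξ * dS a ((t + l) / 2) ξ) * ((dS b ((l + r) / 4) ξ * dS b ((l + r) / 4) ξ) *
        (dS b ((l + r) / 4) ξ * dS b ((l + r) / 4) ξ)) := by ring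
  rw [h2, h1 a _ (by positivity), h1 b _ (by positivity), ← Complex.ofReal_mul, ← Complex.ofReal_mul,
    ← Complex.ofReal_mul, errSym]
  congr 1
  simp only
  set α := dotp a ξ
  set β := dotp b ξ
  have e1 : Real.exp (-(2 * Real.pi ^ 2 * t * α ^ 2)) * (Real.exp (-(2 * Real.pi ^ 2 * β ^ 2 * r)) *
      Real.exp (-(2 * Real.pi ^ 2 * (α ^ 2 + β ^ 2) * l))) =
      Real.exp (-(4 * Real.pi ^ 2 * ((t + l) / 2) * α ^ 2)) *
      (Real.exp (-(4 * Real.pi ^ 2 * ((l + r) / 4) * β ^ 2)) *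
       Real.exp (-(4 * Real.pi ^ 2 * ((l + r) / 4) * β ^ 2))) := by
    simp only [← Real.exp_add]; congr 1; ring
  have hA : 32 * Real.pi ^ 6 * α ^ 2 * β ^ 4 * Real.exp (-(2 * Real.pi ^ 2 * t * α ^ 2)) *
    (Real.exp (-(2 * Real.pi ^ 2 * β ^ 2 * r)) * (l * Real.exp (-(2 * Real.pi ^ 2 * (α ^ 2 + β ^ 2) * l)))) =
    32 * Real.pi ^ 6 * α ^ 2 * β ^ 4 * l * (Real.exp (-(2 * Real.pi ^ 2 * t * α ^ 2)) *
    (Real.exp (-(2 * Real.pi ^ 2 * β ^ 2 * r)) * Real.exp (-(2 * Real.pi ^ 2 * (α ^ 2 + β ^ 2) * l)))) := by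
    ring
  rw [hA, e1]
  generalize Real.exp (-(4 * Real.pi ^ 2 * ((t + l) / 2) * α ^ 2)) = E1
  generalize Real.exp (-(4 * Real.pi ^ 2 * ((l + r) / 4) * β ^ 2)) = E2
  field_simp
  ring

end LacunaryHalfPlane

namespace LacunaryHalfPlane

open ProbabilityTheory ENNReal

variable {e e' : ℝ × ℝ} {g k : ℝ × ℝ → ℂ} {x ξ : ℝ × ℝ}

theorem lintegral_Ioi_kernel {r : ℝ} (hr : 0 < r) :
    ∫⁻ l in Set.Ioi (0 : ℝ), ENNReal.ofReal ((l + r) ^ (-3 / 2 : ℝ)) =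
      ENNReal.ofReal (2 * r ^ (-1 / 2 : ℝ)) := by
  have h1 : ∫⁻ l in Set.Ioi (0 : ℝ), ENNReal.ofReal ((l + r) ^ (-3 / 2 : ℝ)) =
      ∫⁻ l in Set.Ioi r, ENNReal.ofReal (l ^ (-3 / 2 : ℝ)) := by
    rw [← lintegral_indicator measurableSet_Ioi, ← lintegral_indicator measurableSet_Ioi,
      ← lintegral_add_right_eq_self
        ((Set.Ioi r).indicator fun l => ENNReal.ofReal (l ^ (-3 / 2 : ℝ))) r]
    congr 1; ext l
    simp [Set.indicator]
  have h2 := integrableOn_Ioi_rpow_of_lt (a := -3 / 2) (by norm_num) hr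
  rw [h1, ← ofReal_integral_eq_lintegral_ofReal h2, integral_Ioi_rpow_of_lt (by norm_num) hr]
  · congr 1
    norm_num
    ring
  · filter_upwards [ae_restrict_mem measurableSet_Ioi] with l hl
    have : 0 < l := hr.trans hl
    positivity

theorem lintegral_Ioc_kernel {t : ℝ} (ht : 0 < t) :
    ∫⁻ r in Set.Ioc (0 : ℝ) t, ENNReal.ofReal (2 * r ^ (-1 / 2 : ℝ)) = ENNReal.ofReal (4 * √t) := by
  have h2 : IntegrableOn (fun r : ℝ => 2 * r ^ (-1 / 2 : ℝ)) (Set.Ioc 0 t) := by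
    rw [← intervalIntegrable_iff_integrableOn_Ioc_of_le ht.le]
    exact (intervalIntegral.intervalIntegrable_rpow' (by norm_num)).const_mul _
  rw [← ofReal_integral_eq_lintegral_ofReal h2, ← intervalIntegral.integral_of_le ht.le,
    intervalIntegral.integral_const_mul, integral_rpow (Or.inl (by norm_num))]
  · congr 1
    rw [Real.sqrt_eq_rpow, Real.zero_rpow (by norm_num)]
    norm_num
    ring
  · filter_upwards [ae_restrict_mem measurableSet_Ioc] with l hl
    have : 0 < l := hl.1
    positivity

theorem lintegral_errM_kernel {t : ℝ} (ht : 0 < t) :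
    ∫⁻ p, ENNReal.ofReal ((√t)⁻¹ * (p.2 + p.1) ^ (-3 / 2 : ℝ)) ∂(errM t) = 4 := by
  have hm : Measurable fun p : ℝ × ℝ => ENNReal.ofReal ((√t)⁻¹ * (p.2 + p.1) ^ (-3 / 2 : ℝ)) := by
    fun_prop
  have hc : 0 ≤ (√t)⁻¹ := by positivity
  rw [errM, lintegral_prod _ hm.aemeasurable]
  simp_rw [ENNReal.ofReal_mul hc]
  have h1 : ∀ r ∈ Set.Ioc 0 t, ∫⁻ l in Set.Ioi (0 : ℝ), ENNReal.ofReal (√t)⁻¹ *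
      ENNReal.ofReal ((l + r) ^ (-3 / 2 : ℝ)) =
        ENNReal.ofReal (√t)⁻¹ * ENNReal.ofReal (2 * r ^ (-1 / 2 : ℝ)) := by
    intro r hr
    rw [lintegral_const_mul _ (by fun_prop), lintegral_Ioi_kernel hr.1]
  rw [setLIntegral_congr_fun measurableSet_Ioc h1, lintegral_const_mul _ (by fun_prop),
    lintegral_Ioc_kernel ht, ← ENNReal.ofReal_mul hc]
  have : √t ≠ 0 := by positivity
  rw [show (√t)⁻¹ * (4 * √t) = 4 by field_simp]
  norm_num

theorem err_weight_le {t r l : ℝ} (hr : 0 < r) (hrt : r ≤ t) (hl : 0 < l) :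
    16 * l / ((t + l) * (l + r) ^ 2) * √((2 * (t + l)) / (2 * (l + r))) ≤
      16 * ((√t)⁻¹ * (l + r) ^ (-3 / 2 : ℝ)) := by
  have ht : 0 < t := hr.trans_le hrt
  have hlr : 0 < l + r := by positivity
  have h1 : (l + r) ^ (-3 / 2 : ℝ) = ((l + r) * √(l + r))⁻¹ := by
    rw [show (-3 / 2 : ℝ) = -(1 + 1 / 2) by norm_num, Real.rpow_neg hlr.le, Real.rpow_add hlr,
      Real.rpow_one, Real.sqrt_eq_rpow]
  rw [h1, mul_div_mul_left _ _ (by norm_num), Real.sqrt_div (by positivity)]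
  have h2 : √t ≤ √(t + l) := Real.sqrt_le_sqrt (by linarith)
  have h3 : √(t + l) * √(t + l) = t + l := Real.mul_self_sqrt (by positivity)
  have h5 : 0 < √t := by positivity
  have h6 : 0 < √(l + r) := by positivity
  generalize √(t + l) = A at *
  generalize √(l + r) = B at *
  generalize √t = T at *
  have hA : 0 < A := h5.trans_le h2
  rw [← h3]
  have : 16 * l / (A * A * (l + r) ^ 2) * (A / B) = 16 * (A⁻¹ * ((l / (l + r)) * ((l + r) * B)⁻¹)) := by
    field_simp
  rw [this]
  have h7 : l / (l + r) ≤ 1 := by rw [div_le_one hlr]; linarith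
  have h8 : A⁻¹ ≤ T⁻¹ := by gcongr
  have h9 : 0 < ((l + r) * B)⁻¹ := by positivity
  have h10 : (l / (l + r)) * ((l + r) * B)⁻¹ ≤ ((l + r) * B)⁻¹ := mul_le_of_le_one_left h9.le h7
  gcongr

theorem enorm_syn_errSym_le (hg : Integrable g) {t r l : ℝ} (hr : 0 < r) (hrt : r ≤ t) (hl : 0 < l)
    {B : ℝ≥0∞} (hB : ∀ σ, 0 < σ → heatL e σ (heatL e' σ fun y => ‖syn g y‖ₑ) x ≤ B) :
    ‖syn (fun ξ => (errSym (e + e') (e - e') t (r, l) ξ : ℂ) * g ξ) x‖ₑ ≤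
      ENNReal.ofReal ((√t)⁻¹ * (l + r) ^ (-3 / 2 : ℝ)) * (11664 * B) := by
  have ht : 0 < t := hr.trans_le hrt
  set a := e + e' with ha
  set b := e - e' with hb
  set v := (t + l) / 2 with hv
  set w := (l + r) / 4 with hw
  have hvp : 0 < v := by positivity
  have hwp : 0 < w := by positivity
  have hF : BddM (syn g) := BddM.syn hg
  have hm : Measurable fun y => ‖syn g y‖ₑ := hF.meas.enorm
  have i1 := integrable_dS_mul (e := b) hwp.le hg
  have i2 := integrable_dS_mul (e := b) hwp.le i1
  have i3 := integrable_dS_mul (e := b) hwp.le i2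
  have i4 := integrable_dS_mul (e := b) hwp.le i3
  have i5 := integrable_dS_mul (e := a) hvp.le i4
  have h1 : syn (fun ξ => (errSym a b t (r, l) ξ : ℂ) * g ξ) x =
      ((-(16 * l / ((t + l) * (l + r) ^ 2)) : ℝ) : ℂ) *
        derC a v (derC a v (derC b w (derC b w (derC b w (derC b w (syn g)))))) x := by
    rw [derC_syn_fun hwp.le hg, derC_syn_fun hwp.le i1, derC_syn_fun hwp.le i2,
      derC_syn_fun hwp.le i3, derC_syn_fun hvp.le i4, derC_syn hvp.le i5, ← syn_const_mul]
    congr 1; ext ξ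
    rw [errSym_eq_dS hr hrt hl]
    ring
  have hW : 0 ≤ 16 * l / ((t + l) * (l + r) ^ 2) := by positivity
  rw [h1, enorm_mul, ← ofReal_norm, Complex.norm_real, norm_neg, Real.norm_of_nonneg hW]
  have h2 : heatL a (4 * v) (heatL b (8 * w) fun y => ‖syn g y‖ₑ) x ≤
      ENNReal.ofReal √((2 * (t + l)) / (2 * (l + r))) * B := by
    have h3 : 4 * v = 2 * (t + l) := by rw [hv]; ring
    have h4 : 8 * w = 2 * (l + r) := by rw [hw]; ring
    rw [h3, h4]
    refine (heatL_mono (fun y => heatL_le (e := b) (by positivity)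
      (by linarith : 2 * (l + r) ≤ 2 * (t + l)) hm y) x).trans ?_
    rw [heatL_const_mul _ (by fun_prop)]
    refine mul_le_mul_right ?_ _
    rw [ha, hb, heatL_diag hm]
    exact hB _ (by positivity)
  refine (mul_le_mul_right ((enorm_derC_six_le hF hvp hwp x).trans (mul_le_mul_right h2 _)) _).trans ?_
  calc _ = ENNReal.ofReal (16 * l / ((t + l) * (l + r) ^ 2) * √((2 * (t + l)) / (2 * (l + r)))) *
        (729 * B) := by rw [ENNReal.ofReal_mul hW]; ring
    _ ≤ ENNReal.ofReal (16 * ((√t)⁻¹ * (l + r) ^ (-3 / 2 : ℝ))) * (729 * B) :=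
        mul_le_mul_left (ENNReal.ofReal_le_ofReal (err_weight_le hr hrt hl)) _
    _ = _ := by
        rw [ENNReal.ofReal_mul (by norm_num)]
        norm_num
        ring

theorem enorm_syn_err_le (hg : Integrable g) {t : ℝ} (ht : 0 < t)
    {B : ℝ≥0∞} (hB : ∀ σ, 0 < σ → heatL e σ (heatL e' σ fun y => ‖syn g y‖ₑ) x ≤ B) :
    ‖syn (fun ξ => (∫ p, (errSym (e + e') (e - e') t p ξ : ℂ) ∂(errM t)) * g ξ) x‖ₑ ≤ 46656 * B := by
  refine (enorm_syn_integral_le (measurable_errSym _ _ t) ENNReal.one_ne_top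
    (fun ξ => lintegral_errSym_le ht.le) hg x).trans ?_
  have h : ∀ᵐ p ∂(errM t), ‖syn (fun ξ => (errSym (e + e') (e - e') t p ξ : ℂ) * g ξ) x‖ₑ ≤
      ENNReal.ofReal ((√t)⁻¹ * (p.2 + p.1) ^ (-3 / 2 : ℝ)) * (11664 * B) := by
    rw [errM, Measure.prod_restrict]
    filter_upwards [ae_restrict_mem (measurableSet_Ioc.prod measurableSet_Ioi)] with p hp
    exact enorm_syn_errSym_le hg hp.1.1 hp.1.2 hp.2 hB
  refine (lintegral_mono_ae h).trans ?_
  rw [lintegral_mul_const _ (by fun_prop), lintegral_errM_kernel ht, ← mul_assoc]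
  refine le_of_eq ?_
  congr 1
  norm_num

theorem dotp_add (e e' ξ : ℝ × ℝ) : dotp (e + e') ξ = dotp e ξ + dotp e' ξ := by
  simp only [dotp, Prod.fst_add, Prod.snd_add]; ring

theorem dotp_sub (e e' ξ : ℝ × ℝ) : dotp (e - e') ξ = dotp e ξ - dotp e' ξ := by
  simp only [dotp, Prod.fst_sub, Prod.snd_sub]; ring

theorem hS_decomp (e e' ξ : ℝ × ℝ) {t : ℝ} (ht : 0 ≤ t) :
    hS (e + e') t ξ = hS (e + e') t ξ * hS (e - e') t ξ + hS (e + e') t ξ * sectS e e' ξ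
      - hS (e + e') t ξ * (hS (e - e') t ξ * sectS e e' ξ) +
      ∫ p, (errSym (e + e') (e - e') t p ξ : ℂ) ∂(errM t) := by
  rw [integral_complex_ofReal, (integral_errSym ht).2, hS_eq, hS_eq]
  simp only [← Complex.ofReal_mul, ← Complex.ofReal_add, ← Complex.ofReal_sub]
  congr 1
  have h1 : (1 - Real.exp (-(2 * Real.pi ^ 2 * t * dotp (e - e') ξ ^ 2))) *
      (4 * (dotp (e + e') ξ ^ 2 * dotp (e - e') ξ ^ 2) / (dotp (e + e') ξ ^ 2 + dotp (e - e') ξ ^ 2) ^ 2) =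
      (1 - Real.exp (-(2 * Real.pi ^ 2 * t * dotp (e - e') ξ ^ 2))) * (1 - sectS e e' ξ) := by
    rw [dotp_add, dotp_sub, sectS]
    by_cases h : dotp e ξ ^ 2 + dotp e' ξ ^ 2 = 0
    · have h1 : dotp e ξ = 0 := by nlinarith [sq_nonneg (dotp e ξ), sq_nonneg (dotp e' ξ)]
      have h2 : dotp e' ξ = 0 := by nlinarith [sq_nonneg (dotp e ξ), sq_nonneg (dotp e' ξ)]
      simp [h1, h2]
    · congr 1
      rw [show (dotp e ξ + dotp e' ξ) ^ 2 + (dotp e ξ - dotp e' ξ) ^ 2 =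
        2 * (dotp e ξ ^ 2 + dotp e' ξ ^ 2) by ring]
      field_simp
      ring
  linear_combination (-Real.exp (-(2 * Real.pi ^ 2 * t * dotp (e + e') ξ ^ 2))) * h1

theorem enorm_heatC_le_sect (hg : Integrable g) {t : ℝ} (ht : 0 < t)
    {B : ℝ≥0∞} (hB : ∀ σ, 0 < σ → heatL e σ (heatL e' σ fun y => ‖syn g y‖ₑ) x ≤ B) :
    ‖heatC (e + e') t (syn g) x‖ₑ ≤ 46657 * B +
      heatL (e + e') t (fun y => ‖sectOp e e' g y‖ₑ) x +
      heatL e (2 * t) (heatL e' (2 * t) fun y => ‖sectOp e e' g y‖ₑ) x := by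
  have i0 := integrable_sectS_mul (e := e) (e' := e') hg
  have i1 := integrable_hS_mul (e := e - e') ht.le hg
  have i2 := integrable_hS_mul (e := e + e') ht.le i1
  have i3 := integrable_hS_mul (e := e + e') ht.le i0
  have i4 := integrable_hS_mul (e := e - e') ht.le i0
  have i5 := integrable_hS_mul (e := e + e') ht.le i4
  have i23 : Integrable fun ξ => hS (e + e') t ξ *
      (hS (e - e') t ξ * g ξ) + hS (e + e') t ξ *
        ((sectS e e' ξ : ℂ) * g ξ) := i2.add i3
  have i235 : Integrable fun ξ => hS (e + e') t ξ *
      (hS (e - e') t ξ * g ξ) + hS (e + e') t ξ *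
        ((sectS e e' ξ : ℂ) * g ξ) - hS (e + e') t ξ *
          (hS (e - e') t ξ * ((sectS e e' ξ : ℂ) * g ξ)) := i23.sub i5
  have i6 := integrable_integral_mul (measurable_errSym (e + e') (e - e') t) ENNReal.one_ne_top
    (fun ξ => lintegral_errSym_le ht.le) hg
  have hF : BddM (syn g) := BddM.syn hg
  have hT : BddM (sectOp e e' g) := BddM.sectOp hg
  have key : heatC (e + e') t (syn g) x = heatC (e + e') t (heatC (e - e') t (syn g)) x +
      heatC (e + e') t (sectOp e e' g) x - heatC (e + e') t (heatC (e - e') t (sectOp e e' g)) x +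
      syn (fun ξ => (∫ p, (errSym (e + e') (e - e') t p ξ : ℂ) ∂(errM t)) * g ξ) x := by
    have hs : sectOp e e' g = syn fun ξ => (sectS e e' ξ : ℂ) * g ξ := rfl
    rw [hs, heatC_syn ht.le hg, heatC_syn_fun ht.le hg, heatC_syn_fun ht.le i0, heatC_syn ht.le i1,
      heatC_syn_fun ht.le i0, heatC_syn ht.le i4, ← syn_add i2 i3, ← syn_sub i23 i5,
      ← syn_add i235 i6]
    congr 1; ext ξ
    conv_lhs => rw [hS_decomp e e' ξ ht.le]
    ring
  have h1 : ‖heatC (e + e') t (heatC (e - e') t (syn g)) x‖ₑ ≤ B := by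
    refine (enorm_heatC_le x).trans ((heatL_mono (fun y => enorm_heatC_le y) x).trans ?_)
    rw [heatL_diag hF.meas.enorm]
    exact hB _ (by positivity)
  have h2 : ‖heatC (e + e') t (heatC (e - e') t (sectOp e e' g)) x‖ₑ ≤
      heatL e (2 * t) (heatL e' (2 * t) fun y => ‖sectOp e e' g y‖ₑ) x := by
    refine (enorm_heatC_le x).trans ((heatL_mono (fun y => enorm_heatC_le y) x).trans ?_)
    rw [heatL_diag hT.meas.enorm]
  have h3 : ‖heatC (e + e') t (sectOp e e' g) x‖ₑ ≤ _ := enorm_heatC_le x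
  have h4 := enorm_syn_err_le hg ht hB
  rw [key]
  refine (enorm_add_le _ _).trans ((add_le_add ((enorm_sub_le).trans
    (add_le_add (enorm_add_le _ _) le_rfl)) le_rfl).trans ?_)
  refine (add_le_add (add_le_add (add_le_add h1 h3) h2) h4).trans (le_of_eq ?_)
  rw [show (46657 : ℝ≥0∞) = 1 + 46656 by norm_num]
  ring

end LacunaryHalfPlane

namespace LacunaryHalfPlane

open ProbabilityTheory ENNReal

/-- Positive sublinear operators satisfying Hölder's inequality pointwise. -/
structure PosOp (T : (ℝ × ℝ → ℝ≥0∞) → ℝ × ℝ → ℝ≥0∞) : Prop where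
  meas : ∀ {F}, Measurable F → Measurable (T F)
  mono : ∀ {F K}, (∀ x, F x ≤ K x) → ∀ x, T F x ≤ T K x
  const : ∀ c x, T (fun _ => c) x ≤ c
  const_mul : ∀ c {F}, Measurable F → ∀ x, T (fun y => c * F y) x ≤ c * T F x
  add : ∀ {F K}, Measurable F → Measurable K → ∀ x, T (fun y => F y + K y) x ≤ T F x + T K x
  tsum : ∀ {F : ℕ → ℝ × ℝ → ℝ≥0∞}, (∀ n, Measurable (F n)) → ∀ x,
    T (fun y => ∑' n, F n y) x ≤ ∑' n, T (F n) x
  holder : ∀ {F K}, Measurable F → Measurable K → ∀ {a b : ℝ}, 0 ≤ a → 0 ≤ b → a + b = 1 → ∀ x,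
    T (fun y => F y ^ a * K y ^ b) x ≤ T F x ^ a * T K x ^ b

theorem PosOp.heatL (e : ℝ × ℝ) (v : ℝ) : PosOp (heatL e v) where
  meas hF := measurable_heatL hF
  mono h := heatL_mono h
  const c x := (heatL_const e v c x).le
  const_mul c _ hF x := (heatL_const_mul c hF x).le
  add hF _ x := (heatL_add hF x).le
  tsum hF x := (heatL_tsum hF x).le
  holder hF hK _ _ ha hb hab x := heatL_holder hF hK ha hb hab x

theorem PosOp.iSup {ι : Type*} [Countable ι] {T : ι → (ℝ × ℝ → ℝ≥0∞) → ℝ × ℝ → ℝ≥0∞}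
    (h : ∀ i, PosOp (T i)) : PosOp fun F x => ⨆ i, T i F x where
  meas hF := .iSup fun i => (h i).meas hF
  mono hFK x := iSup_mono fun i => (h i).mono hFK x
  const c x := iSup_le fun i => (h i).const c x
  const_mul c _ hF x := iSup_le fun i => ((h i).const_mul c hF x).trans
    (mul_le_mul_right (le_iSup (fun i => T i _ x) i) _)
  add hF hK x := iSup_le fun i => ((h i).add hF hK x).trans
    (add_le_add (le_iSup (fun i => T i _ x) i) (le_iSup (fun i => T i _ x) i))
  tsum hF x := iSup_le fun i => ((h i).tsum hF x).trans
    (ENNReal.tsum_le_tsum fun _ => le_iSup (fun i => T i _ x) i)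
  holder hF hK _ _ ha hb hab x := iSup_le fun i => ((h i).holder hF hK ha hb hab x).trans
    (mul_le_mul' (ENNReal.rpow_le_rpow (le_iSup (fun i => T i _ x) i) ha)
      (ENNReal.rpow_le_rpow (le_iSup (fun i => T i _ x) i) hb))

theorem PosOp.comp {T U : (ℝ × ℝ → ℝ≥0∞) → ℝ × ℝ → ℝ≥0∞} (hT : PosOp T) (hU : PosOp U) :
    PosOp fun F => T (U F) where
  meas hF := hT.meas (hU.meas hF)
  mono h x := hT.mono (fun y => hU.mono h y) x
  const c x := (hT.mono (fun y => hU.const c y) x).trans (hT.const c x)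
  const_mul c _ hF x := (hT.mono (fun y => hU.const_mul c hF y) x).trans (hT.const_mul c (hU.meas hF) x)
  add hF hK x := (hT.mono (fun y => hU.add hF hK y) x).trans (hT.add (hU.meas hF) (hU.meas hK) x)
  tsum hF x := (hT.mono (fun y => hU.tsum hF y) x).trans (hT.tsum (fun n => hU.meas (hF n)) x)
  holder hF hK _ _ ha hb hab x := (hT.mono (fun y => hU.holder hF hK ha hb hab y) x).trans
    (hT.holder (hU.meas hF) (hU.meas hK) ha hb hab x)

/-- `T` is bounded on `L^q` with constant `C` (for the `q`-th powers of norms). -/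
def LqBdd (T : (ℝ × ℝ → ℝ≥0∞) → ℝ × ℝ → ℝ≥0∞) (q : ℝ) (C : ℝ≥0∞) : Prop :=
  ∀ ⦃F⦄, Measurable F → ∫⁻ x, T F x ^ q ≤ C * ∫⁻ x, F x ^ q

theorem LqBdd.comp {T U : (ℝ × ℝ → ℝ≥0∞) → ℝ × ℝ → ℝ≥0∞} {q : ℝ} {C D : ℝ≥0∞} (hT : LqBdd T q C)
    (hU : LqBdd U q D) (hU' : PosOp U) : LqBdd (fun F => T (U F)) q (C * D) := fun F hF =>
  (hT (hU'.meas hF)).trans (by rw [mul_assoc]; exact mul_le_mul_right (hU hF) C)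

theorem LqBdd.mono {T : (ℝ × ℝ → ℝ≥0∞) → ℝ × ℝ → ℝ≥0∞} {q : ℝ} {C D : ℝ≥0∞} (hT : LqBdd T q C)
    (h : C ≤ D) : LqBdd T q D := fun _ hF => (hT hF).trans (mul_le_mul_left h _)

theorem LqBdd.iSup_finset {ι : Type*} {T : ι → (ℝ × ℝ → ℝ≥0∞) → ℝ × ℝ → ℝ≥0∞} {q : ℝ} (hq : 0 < q)
    (s : Finset ι) {C : ℝ≥0∞} (h : ∀ i, PosOp (T i)) (hT : ∀ i, LqBdd (T i) q C) :
    LqBdd (fun F x => ⨆ i : s, T i F x) q (s.card * C) := by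
  intro F hF
  calc ∫⁻ x, (⨆ i : s, T i F x) ^ q ≤ ∫⁻ x, ∑ i ∈ s, T i F x ^ q := by
        refine lintegral_mono fun x => ?_
        rw [← ENNReal.le_rpow_inv_iff hq]
        refine iSup_le fun i => ?_
        rw [ENNReal.le_rpow_inv_iff hq]
        exact Finset.single_le_sum (f := fun i => T i F x ^ q) (fun _ _ => zero_le) i.2
    _ = ∑ i ∈ s, ∫⁻ x, T i F x ^ q :=
        lintegral_finsetSum _ fun i _ => ((h i).meas hF).pow_const q
    _ ≤ ∑ i ∈ s, C * ∫⁻ x, F x ^ q := Finset.sum_le_sum fun i _ => hT i hF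
    _ = _ := by rw [Finset.sum_const, nsmul_eq_mul, mul_assoc]

/-- Positive operators controlled by one maximal operator extend to `ℓ²`-valued functions. -/
theorem vector_valued {ι : Type*} (s : Finset ι) {T : ι → (ℝ × ℝ → ℝ≥0∞) → ℝ × ℝ → ℝ≥0∞}
    {M : (ℝ × ℝ → ℝ≥0∞) → ℝ × ℝ → ℝ≥0∞} (hT : ∀ j ∈ s, PosOp (T j)) (hM : PosOp M)
    (hTM : ∀ j ∈ s, ∀ F x, T j F x ≤ M F x) {θ q p : ℝ} {A B : ℝ≥0∞} (hθ : 0 < θ) (hθ1 : θ < 1)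
    (hq : 0 < q) (hp : 0 < p) (hpq : 1 / p = 1 / 2 + θ / q) (hA : LqBdd M q A)
    (hB : ∀ j ∈ s, LqBdd (T j) (2 * (1 - θ)) B) {f : ι → ℝ × ℝ → ℝ≥0∞} (hf : ∀ j, Measurable (f j))
    (hf' : ∀ j x, f j x ≠ ⊤) :
    ∫⁻ x, (∑ j ∈ s, T j (f j) x ^ 2) ^ (p / 2) ≤
      A ^ (θ * p / q) * B ^ (p / 2) * ∫⁻ x, (∑ j ∈ s, f j x ^ 2) ^ (p / 2) := by
  have h1θ : 0 < 1 - θ := by linarith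
  have hsum : θ * p / q + p / 2 = 1 := by field_simp at hpq ⊢; linarith
  set F : ℝ × ℝ → ℝ≥0∞ := fun x => ∑ j ∈ s, f j x ^ 2 with hFdef
  have hF : Measurable F := by fun_prop
  have hFt : ∀ x, F x ≠ ⊤ := fun x => ENNReal.sum_ne_top.2 fun j _ => ENNReal.pow_ne_top (hf' j x)
  set g : ℝ × ℝ → ℝ≥0∞ := fun x => F x ^ (p / (2 * q)) with hg
  set k : ι → ℝ × ℝ → ℝ≥0∞ := fun j x => (f j x * F x ^ (-(p * θ / (2 * q)))) ^ (1 / (1 - θ)) with hk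
  have hgm : Measurable g := by fun_prop
  have hkm : ∀ j, Measurable (k j) := by intro j; fun_prop
  have hfac : ∀ j ∈ s, ∀ x, f j x = g x ^ θ * k j x ^ (1 - θ) := by
    intro j hj x
    simp only [hg, hk]
    rw [← ENNReal.rpow_mul, ← ENNReal.rpow_mul, one_div_mul_cancel h1θ.ne', ENNReal.rpow_one]
    rw [show p / (2 * q) * θ = p * θ / (2 * q) by ring]
    rcases eq_or_ne (F x) 0 with h0 | h0
    · have : f j x = 0 := by
        have := (Finset.sum_eq_zero_iff.1 h0) j hj
        simpa using this
      simp [this]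
    · rw [mul_left_comm, ← ENNReal.rpow_add _ _ h0 (hFt x), add_neg_cancel, ENNReal.rpow_zero, mul_one]
  have hkr : ∀ x, ∑ j ∈ s, k j x ^ (2 * (1 - θ)) ≤ F x ^ (p / 2) := by
    intro x
    have h1 : ∀ j, k j x ^ (2 * (1 - θ)) = f j x ^ 2 * F x ^ (-(p * θ / q)) := by
      intro j
      simp only [hk]
      rw [← ENNReal.rpow_mul, show 1 / (1 - θ) * (2 * (1 - θ)) = 2 by field_simp,
        ENNReal.mul_rpow_of_nonneg _ _ (by norm_num), ← ENNReal.rpow_mul, ENNReal.rpow_two]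
      congr 2
      ring
    simp_rw [h1, ← Finset.sum_mul]
    rcases eq_or_ne (F x) 0 with h0 | h0
    · change F x * _ ≤ _
      rw [h0]; simp
    · change F x * F x ^ (-(p * θ / q)) ≤ _
      nth_rw 1 [← ENNReal.rpow_one (F x)]
      rw [← ENNReal.rpow_add _ _ h0 (hFt x)]
      refine le_of_eq ?_
      congr 1
      rw [mul_comm p θ]
      linarith
  have hpt : ∀ x, (∑ j ∈ s, T j (f j) x ^ 2) ^ (p / 2) ≤
      (M g x ^ q) ^ (θ * p / q) * (∑ j ∈ s, T j (k j) x ^ (2 * (1 - θ))) ^ (p / 2) := by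
    intro x
    have h1 : ∑ j ∈ s, T j (f j) x ^ 2 ≤ M g x ^ (2 * θ) * ∑ j ∈ s, T j (k j) x ^ (2 * (1 - θ)) := by
      rw [Finset.mul_sum]
      refine Finset.sum_le_sum fun j hj => ?_
      have h2 : T j (f j) x ≤ M g x ^ θ * T j (k j) x ^ (1 - θ) := by
        rw [funext (hfac j hj)]
        refine ((hT j hj).holder hgm (hkm j) hθ.le h1θ.le (by ring) x).trans ?_
        exact mul_le_mul_left (ENNReal.rpow_le_rpow (hTM j hj g x) hθ.le) _
      refine (pow_le_pow_left' h2 2).trans (le_of_eq ?_)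
      rw [mul_pow, ← ENNReal.rpow_two, ← ENNReal.rpow_two, ← ENNReal.rpow_mul, ← ENNReal.rpow_mul,
        mul_comm θ, mul_comm (1 - θ)]
    refine (ENNReal.rpow_le_rpow h1 (by positivity)).trans (le_of_eq ?_)
    rw [ENNReal.mul_rpow_of_nonneg _ _ (by positivity), ← ENNReal.rpow_mul, ← ENNReal.rpow_mul]
    congr 2
    field_simp
  have m1 : Measurable fun x => M g x ^ q := (hM.meas hgm).pow_const _
  have m2 : Measurable fun x => ∑ j ∈ s, T j (k j) x ^ (2 * (1 - θ)) :=
    Finset.measurable_sum _ fun j hj => ((hT j hj).meas (hkm j)).pow_const _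
  refine (lintegral_mono hpt).trans ((ENNReal.lintegral_mul_norm_pow_le m1.aemeasurable
    m2.aemeasurable (by positivity) (by positivity) hsum).trans ?_)
  have hi1 : ∫⁻ x, M g x ^ q ≤ A * ∫⁻ x, F x ^ (p / 2) := by
    refine (hA hgm).trans (le_of_eq ?_)
    congr 2; ext x
    simp only [hg]
    rw [← ENNReal.rpow_mul]
    congr 1; field_simp
  have hi2 : ∫⁻ x, ∑ j ∈ s, T j (k j) x ^ (2 * (1 - θ)) ≤ B * ∫⁻ x, F x ^ (p / 2) := by
    rw [lintegral_finsetSum' _ fun j hj => (((hT j hj).meas (hkm j)).pow_const _).aemeasurable]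
    refine (Finset.sum_le_sum fun j hj => hB j hj (hkm j)).trans ?_
    rw [← Finset.mul_sum, ← lintegral_finsetSum _ fun j _ => (hkm j).pow_const _]
    exact mul_le_mul_right (lintegral_mono hkr) _
  refine (mul_le_mul' (ENNReal.rpow_le_rpow hi1 (by positivity))
    (ENNReal.rpow_le_rpow hi2 (by positivity))).trans (le_of_eq ?_)
  rw [ENNReal.mul_rpow_of_nonneg _ _ (by positivity), ENNReal.mul_rpow_of_nonneg _ _ (by positivity),
    mul_mul_mul_comm, ← ENNReal.rpow_add_of_nonneg _ _ (by positivity) (by positivity), hsum,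
    ENNReal.rpow_one]

end LacunaryHalfPlane

namespace LacunaryHalfPlane

open ProbabilityTheory ENNReal

theorem add_rpow_le_tangent {p : ℝ} (hp : 1 ≤ p) (a b : ℝ≥0∞) :
    (a + b) ^ p ≤ b ^ p + ENNReal.ofReal p * (a * (a + b) ^ (p - 1)) := by
  have hp0 : 0 < p := by linarith
  rcases eq_or_ne a ⊤ with rfl | ha
  · rcases hp.eq_or_lt with rfl | h1
    · simp
    · simp [hp0, sub_pos.2 h1, ENNReal.mul_top]
  rcases eq_or_ne b ⊤ with rfl | hb
  · simp [hp0]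
  lift a to NNReal using ha
  lift b to NNReal using hb
  rcases eq_or_ne (a + b) 0 with h0 | h0
  · rw [← ENNReal.coe_add, h0]; simp [hp0]
  have hpos : (0 : ℝ) < a + b := by exact_mod_cast pos_iff_ne_zero.2 h0
  have key : ((a : ℝ) + b) ^ p ≤ (b : ℝ) ^ p + p * (a * ((a : ℝ) + b) ^ (p - 1)) := by
    have hB := one_add_mul_self_le_rpow_one_add (s := -(a / (a + b) : ℝ)) (by
      rw [neg_le_neg_iff, div_le_one hpos]; linarith [b.2]) hp
    have e1 : (1 + -(a / (a + b) : ℝ)) = b / (a + b) := by field_simp; ring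
    rw [e1, Real.div_rpow (NNReal.coe_nonneg b) hpos.le, le_div_iff₀ (by positivity)] at hB
    have e2 : ((a : ℝ) + b) ^ (p - 1) * (a + b) = (a + b) ^ p := by
      rw [← Real.rpow_add_one hpos.ne']; ring_nf
    have e3 : (1 + p * -(a / (a + b) : ℝ)) * (a + b) ^ p =
        (a + b) ^ p - p * (a * ((a : ℝ) + b) ^ (p - 1)) := by
      rw [← e2]; field_simp; ring
    linarith
  have h1 : 0 ≤ p - 1 := by linarith
  rw [← ENNReal.coe_add, ← ENNReal.coe_rpow_of_nonneg _ hp0.le, ← ENNReal.coe_rpow_of_nonneg _ hp0.le,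
    ← ENNReal.coe_rpow_of_nonneg _ h1, ENNReal.ofReal, ← ENNReal.coe_mul, ← ENNReal.coe_mul,
    ← ENNReal.coe_add, ENNReal.coe_le_coe, ← NNReal.coe_le_coe]
  push_cast
  rwa [Real.coe_toNNReal _ hp0.le]

theorem sum_rpow_le_sum_mul {p : ℝ} (hp : 1 ≤ p) (a : ℕ → ℝ≥0∞) (N : ℕ) :
    (∑ l ∈ Finset.range N, a l) ^ p ≤ ENNReal.ofReal p *
      ∑ k ∈ Finset.range N, a k * (∑ l ∈ Finset.range (k + 1), a l) ^ (p - 1) := by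
  induction N with
  | zero => simp [show 0 < p by linarith]
  | succ N ih =>
    rw [Finset.sum_range_succ (fun k => a k * _), mul_add, Finset.sum_range_succ, add_comm _ (a N)]
    exact (add_rpow_le_tangent hp _ _).trans (add_le_add_left ih _)

theorem le_rpow_mul_of_le_mul {p : ℝ} (hp : 0 < p) {c X Y : ℝ≥0∞} (hX : X ≠ ⊤)
    (h : X ≤ c * Y ^ (1 / p) * X ^ ((p - 1) / p)) : X ≤ c ^ p * Y := by
  rcases eq_or_ne X 0 with rfl | h0
  · exact zero_le
  have e1 : X = X ^ (1 / p) * X ^ ((p - 1) / p) := by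
    rw [← ENNReal.rpow_add _ _ h0 hX, ← add_div, add_sub_cancel, div_self hp.ne', ENNReal.rpow_one]
  have h2 : X ^ (1 / p) ≤ c * Y ^ (1 / p) := by
    have h3 : X ^ (1 / p) * X ^ ((p - 1) / p) ≤ c * Y ^ (1 / p) * X ^ ((p - 1) / p) := e1 ▸ h
    refine (ENNReal.mul_le_mul_iff_left ?_ ?_).1 h3
    · simp [ENNReal.rpow_eq_zero_iff, h0, hX]
    · simp [ENNReal.rpow_eq_top_iff, h0, hX]
  have h3 := ENNReal.rpow_le_rpow h2 hp.le
  rwa [ENNReal.mul_rpow_of_nonneg _ _ hp.le, ← ENNReal.rpow_mul, ← ENNReal.rpow_mul,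
    one_div_mul_cancel hp.ne', ENNReal.rpow_one, ENNReal.rpow_one] at h3

/-- The constant in the comparison of heat averages at nested scales. -/
noncomputable def nestC (p : ℝ) : ℝ≥0∞ :=
  ∫⁻ s, ENNReal.ofReal (√(2 * p) * Real.exp (s ^ 2 / (2 * (2 * p - 1)))) ^ (p - 1) ∂stdG

theorem nestC_ne_top {p : ℝ} (hp : 1 < p) : nestC p ≠ ⊤ := by
  have h := lintegral_stdG_le_of_density (u := 1) (v := 2) (C := √2 * √(2 * p) ^ (p - 1))
    (a := fun s => (√(2 * p) * Real.exp (s ^ 2 / (2 * (2 * p - 1)))) ^ (p - 1)) one_pos two_pos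
    (by fun_prop) (by positivity) (fun s => ?_) (φ := fun _ => 1) measurable_const
  · refine ne_top_of_le_ne_top (b := ENNReal.ofReal (√2 * √(2 * p) ^ (p - 1))) ofReal_ne_top ?_
    simp only [mul_one, Real.sqrt_one, one_mul, lintegral_const, measure_univ] at h
    refine le_trans (le_of_eq (lintegral_congr fun s => ?_)) h
    rw [ENNReal.ofReal_rpow_of_pos (by positivity)]
  · rw [Real.mul_rpow (by positivity) (by positivity), ← Real.exp_mul]
    have e1 : √2 * (√(2 * Real.pi * 2))⁻¹ = (√(2 * Real.pi * 1))⁻¹ := by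
      rw [← Real.sqrt_inv, ← Real.sqrt_mul (by positivity), ← Real.sqrt_inv]
      congr 1; field_simp
    have e2 : s ^ 2 / (2 * (2 * p - 1)) * (p - 1) ≤ s ^ 2 / 4 := by
      rw [div_mul_eq_mul_div, div_le_div_iff₀ (by linarith) (by norm_num)]
      nlinarith [sq_nonneg s]
    have e3 : Real.exp (s ^ 2 / (2 * (2 * p - 1)) * (p - 1)) * Real.exp (-s ^ 2 / (2 * 1)) ≤
        Real.exp (-s ^ 2 / (2 * 2)) := by
      rw [← Real.exp_add]
      refine Real.exp_le_exp.2 ?_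
      linarith
    calc _ = √(2 * p) ^ (p - 1) * (√(2 * Real.pi * 1))⁻¹ *
          (Real.exp (s ^ 2 / (2 * (2 * p - 1)) * (p - 1)) * Real.exp (-s ^ 2 / (2 * 1))) := by ring
      _ ≤ √(2 * p) ^ (p - 1) * (√(2 * Real.pi * 1))⁻¹ * Real.exp (-s ^ 2 / (2 * 2)) := by gcongr
      _ = _ := by rw [← e1]; ring

theorem heatL_translate_nested {e : ℝ × ℝ} {p u v : ℝ} (hp : 1 < p) (hu : 0 < u) (huv : u ≤ v)
    {F : ℝ × ℝ → ℝ≥0∞} (hF : Measurable F) (s : ℝ) (x : ℝ × ℝ) :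
    heatL e v F (x + (√u * s) • e) ≤
      ENNReal.ofReal (√(2 * p) * Real.exp (s ^ 2 / (2 * (2 * p - 1)))) * heatL e (2 * p * v) F x := by
  have hv : 0 < v := hu.trans_le huv
  have h := heatL_translate_le (e := e) (v := v) (w := 2 * p * v) (y := √u * s) hv (by positivity)
    (C := √(2 * p * v / v) * Real.exp (s ^ 2 / (2 * (2 * p - 1)))) (by positivity)
    (gauss_translate_le_aux hv (by positivity) fun z => ?_) hF x
  · rwa [mul_div_cancel_right₀ _ hv.ne'] at h
  · set y := √u * s
    have hy : y ^ 2 ≤ v * s ^ 2 := by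
      rw [mul_pow, Real.sq_sqrt hu.le]; gcongr
    have h2 : 0 < 2 * p - 1 := by linarith
    have h3 : y ^ 2 / (2 * v * (2 * p - 1)) ≤ s ^ 2 / (2 * (2 * p - 1)) := by
      rw [div_le_div_iff₀ (by positivity) (by positivity)]
      nlinarith
    have h4 : z ^ 2 / (2 * (2 * p * v)) ≤ (z - y) ^ 2 / (2 * v) + y ^ 2 / (2 * v * (2 * p - 1)) := by
      have : (z - y) ^ 2 / (2 * v) + y ^ 2 / (2 * v * (2 * p - 1)) - z ^ 2 / (2 * (2 * p * v)) =
          ((2 * p - 1) * z - 2 * p * y) ^ 2 / (4 * p * v * (2 * p - 1)) := by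
        field_simp; ring
      have h5 : 0 ≤ ((2 * p - 1) * z - 2 * p * y) ^ 2 / (4 * p * v * (2 * p - 1)) := by positivity
      linarith
    linarith

theorem heatL_rpow_nested {e : ℝ × ℝ} {p : ℝ} (hp : 1 < p) {v : ℕ → ℝ} (hv : ∀ l, 0 < v l)
    (hanti : Antitone v) {g : ℕ → ℝ × ℝ → ℝ≥0∞} (hg : ∀ l, Measurable (g l)) {k N : ℕ} (hk : k < N)
    (x : ℝ × ℝ) :
    heatL e (v k) (fun y => (∑ l ∈ Finset.range (k + 1), heatL e (v l) (g l) y) ^ (p - 1)) x ≤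
      nestC p * (∑ l ∈ Finset.range N, heatL e (2 * p * v l) (g l) x) ^ (p - 1) := by
  have h1 : 0 ≤ p - 1 := by linarith
  rw [heatL, nestC, ← lintegral_mul_const _ (by fun_prop)]
  refine lintegral_mono fun s => ?_
  rw [← ENNReal.mul_rpow_of_nonneg _ _ h1, Finset.mul_sum]
  refine ENNReal.rpow_le_rpow ?_ h1
  calc _ ≤ ∑ l ∈ Finset.range (k + 1), ENNReal.ofReal (√(2 * p) *
        Real.exp (s ^ 2 / (2 * (2 * p - 1)))) * heatL e (2 * p * v l) (g l) x :=
      Finset.sum_le_sum fun l hl => heatL_translate_nested hp (hv k)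
        (hanti (Nat.lt_succ_iff.1 (Finset.mem_range.1 hl))) (hg l) s x
    _ ≤ _ := Finset.sum_le_sum_of_subset (Finset.range_mono hk)

theorem lintegral_finsetSum_mul {ι : Type*} (s : Finset ι) {f g : ι → ℝ × ℝ → ℝ≥0∞}
    (hf : ∀ i, Measurable (f i)) (hg : ∀ i, Measurable (g i)) :
    ∫⁻ x, ∑ i ∈ s, f i x * g i x = ∑ i ∈ s, ∫⁻ x, f i x * g i x :=
  lintegral_finsetSum _ fun i _ => (hf i).mul (hg i)

theorem lintegral_sum_heatL_rpow_le_aux {e : ℝ × ℝ} {p : ℝ} (hp : 1 < p) {v : ℕ → ℝ}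
    (hv : ∀ l, 0 < v l) (hanti : Antitone v) {g : ℕ → ℝ × ℝ → ℝ≥0∞} (hg : ∀ l, Measurable (g l))
    (N : ℕ) :
    ∫⁻ x, (∑ l ∈ Finset.range N, heatL e (v l) (g l) x) ^ p ≤ ENNReal.ofReal p * nestC p *
      (∫⁻ x, (∑ l ∈ Finset.range N, g l x) ^ p) ^ (1 / p) *
      (∫⁻ x, (∑ l ∈ Finset.range N, heatL e (2 * p * v l) (g l) x) ^ p) ^ ((p - 1) / p) := by
  have hp0 : 0 < p := by linarith
  have mh : ∀ l w, Measurable (heatL e w (g l)) := fun l w => measurable_heatL (hg l)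
  have mS : ∀ k, Measurable fun y => (∑ l ∈ Finset.range k, heatL e (v l) (g l) y) ^ (p - 1) :=
    fun k => (Finset.measurable_sum _ fun l _ => mh l _).pow_const _
  have mR : Measurable fun y => ∑ l ∈ Finset.range N, heatL e (2 * p * v l) (g l) y :=
    Finset.measurable_sum _ fun l _ => mh l _
  have mg : Measurable fun y => ∑ l ∈ Finset.range N, g l y := Finset.measurable_sum _ fun l _ => hg l
  calc _ ≤ ∫⁻ x, ENNReal.ofReal p * ∑ k ∈ Finset.range N, heatL e (v k) (g k) x *
        (∑ l ∈ Finset.range (k + 1), heatL e (v l) (g l) x) ^ (p - 1) :=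
        lintegral_mono fun x => sum_rpow_le_sum_mul hp.le _ N
    _ = ENNReal.ofReal p * ∑ k ∈ Finset.range N, ∫⁻ x, heatL e (v k) (g k) x *
        (∑ l ∈ Finset.range (k + 1), heatL e (v l) (g l) x) ^ (p - 1) := by
        rw [lintegral_const_mul' _ _ ofReal_ne_top,
          lintegral_finsetSum_mul _ (fun k => mh k (v k)) fun k => mS (k + 1)]
    _ ≤ ENNReal.ofReal p * ∑ k ∈ Finset.range N, ∫⁻ x, g k x * (nestC p *
        (∑ l ∈ Finset.range N, heatL e (2 * p * v l) (g l) x) ^ (p - 1)) := by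
        refine mul_le_mul_right (Finset.sum_le_sum fun k hk => ?_) _
        rw [lintegral_heatL_mul (hg k) (mS (k + 1))]
        exact lintegral_mono fun x => mul_le_mul_right
          (heatL_rpow_nested hp hv hanti hg (Finset.mem_range.1 hk) x) _
    _ = ENNReal.ofReal p * nestC p * ∫⁻ x, ((∑ l ∈ Finset.range N, g l x) ^ p) ^ (1 / p) *
        ((∑ l ∈ Finset.range N, heatL e (2 * p * v l) (g l) x) ^ p) ^ ((p - 1) / p) := by
        rw [← lintegral_finsetSum_mul _ hg fun _ => (mR.pow_const (p - 1)).const_mul (nestC p), mul_assoc,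
          ← lintegral_const_mul' _ _ (nestC_ne_top hp)]
        congr 2
        ext x
        rw [← Finset.sum_mul, ← ENNReal.rpow_mul, ← ENNReal.rpow_mul, mul_one_div_cancel hp0.ne',
          ENNReal.rpow_one, mul_div_cancel₀ _ hp0.ne']
        ring
    _ ≤ _ := by
        rw [mul_assoc (ENNReal.ofReal p * nestC p)]
        refine mul_le_mul_right ?_ _
        refine ENNReal.lintegral_mul_norm_pow_le (mg.pow_const _).aemeasurable
          (mR.pow_const _).aemeasurable (by positivity) (div_nonneg (by linarith) hp0.le) ?_
        field_simp; ring

theorem lintegral_sum_heatL_rpow_le {e : ℝ × ℝ} {p : ℝ} (hp : 1 < p) {v : ℕ → ℝ}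
    (hv : ∀ l, 0 < v l) (hanti : Antitone v) {g : ℕ → ℝ × ℝ → ℝ≥0∞} (hg : ∀ l, Measurable (g l))
    (N : ℕ) :
    ∫⁻ x, (∑ l ∈ Finset.range N, heatL e (v l) (g l) x) ^ p ≤
      (ENNReal.ofReal p * nestC p) ^ p * ∫⁻ x, (∑ l ∈ Finset.range N, g l x) ^ p := by
  have hp0 : 0 < p := by linarith
  set I := ∫⁻ x, (∑ l ∈ Finset.range N, g l x) ^ p with hI
  rcases eq_or_ne I ⊤ with hIt | hIt
  · rcases Nat.eq_zero_or_pos N with rfl | hN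
    · simp [hp0]
    have hc : (ENNReal.ofReal p * nestC p) ^ p ≠ 0 := by
      have h0 : nestC p ≠ 0 := by
        rw [nestC, Ne, lintegral_eq_zero_iff (by fun_prop)]
        intro h
        have h2 : ∀ᵐ s ∂stdG, False := h.mono fun s hs => by
          have hpos : 0 < √(2 * p) * Real.exp (s ^ 2 / (2 * (2 * p - 1))) := by positivity
          simp only [Pi.zero_apply, ENNReal.rpow_eq_zero_iff, ofReal_eq_zero, ofReal_ne_top, false_and,
            or_false] at hs
          linarith [hs.1]
        simp [IsProbabilityMeasure.ne_zero] at h2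
      simp [ENNReal.rpow_eq_zero_iff, h0, hp0, hp0.le]
    rw [hIt, ENNReal.mul_top hc]; exact le_top
  set Q : ℝ≥0∞ := ⨆ n : ℕ, ∫⁻ x, (∑ l ∈ Finset.range N, heatL e ((2 * p) ^ n * v l) (g l) x) ^ p with hQ
  have hQt : Q ≠ ⊤ := by
    refine ne_top_of_le_ne_top (b := (N : ℝ≥0∞) ^ (p - 1) * ∑ l ∈ Finset.range N, I)
      (ENNReal.mul_ne_top (by simp [ENNReal.rpow_eq_top_iff, hp.not_gt])
        (ENNReal.sum_ne_top.2 fun _ _ => hIt)) ?_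
    refine iSup_le fun n => ?_
    calc _ ≤ ∫⁻ x, (N : ℝ≥0∞) ^ (p - 1) * ∑ l ∈ Finset.range N, heatL e ((2 * p) ^ n * v l) (fun y => g l y ^ p) x := by
          refine lintegral_mono fun x => ?_
          have := ENNReal.rpow_sum_le_const_mul_sum_rpow (Finset.range N)
            (fun l => heatL e ((2 * p) ^ n * v l) (g l) x) hp.le
          rw [Finset.card_range] at this
          refine this.trans (mul_le_mul_right (Finset.sum_le_sum fun l _ => ?_) _)
          exact rpow_heatL_le (hg l) hp.le x
      _ = (N : ℝ≥0∞) ^ (p - 1) * ∑ l ∈ Finset.range N, ∫⁻ x, g l x ^ p := by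
          rw [lintegral_const_mul _ (Finset.measurable_sum _ fun l _ => measurable_heatL ((hg l).pow_const _)),
            lintegral_finsetSum _ fun l _ => measurable_heatL ((hg l).pow_const _)]
          congr 1
          exact Finset.sum_congr rfl fun l _ => lintegral_heatL ((hg l).pow_const _)
      _ ≤ _ := by
          refine mul_le_mul_right (Finset.sum_le_sum fun l hl => lintegral_mono fun x => ?_) _
          exact ENNReal.rpow_le_rpow
            (Finset.single_le_sum (f := fun l => g l x) (fun _ _ => zero_le) hl) hp0.le
  have hQ2 : Q ≤ ENNReal.ofReal p * nestC p * I ^ (1 / p) * Q ^ ((p - 1) / p) := by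
    refine iSup_le fun n => ?_
    refine (lintegral_sum_heatL_rpow_le_aux hp (v := fun l => (2 * p) ^ n * v l)
      (fun l => mul_pos (by positivity) (hv l)) (fun i j hij => mul_le_mul_of_nonneg_left (hanti hij)
        (by positivity)) hg N).trans ?_
    refine mul_le_mul_right (ENNReal.rpow_le_rpow ?_ (div_nonneg (by linarith) hp0.le)) _
    refine le_trans (le_of_eq ?_) (le_iSup _ (n + 1))
    simp_rw [pow_succ', mul_assoc]
  refine le_trans ?_ (le_rpow_mul_of_le_mul hp0 hQt hQ2)
  refine le_trans (le_of_eq ?_) (le_iSup _ 0)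
  simp

theorem exists_partition_sup {α : Type*} [MeasurableSpace α] {a : ℕ → α → ℝ≥0∞}
    (ha : ∀ k, Measurable (a k)) (n : ℕ) :
    ∃ φ : ℕ → α → ℝ≥0∞, (∀ k, Measurable (φ k)) ∧
      (∀ x, ∑ k ∈ Finset.range (n + 1), φ k x = 1) ∧
      ∀ x, (Finset.range (n + 1)).sup (fun k => a k x) = ∑ k ∈ Finset.range (n + 1), φ k x * a k x := by
  induction n with
  | zero => exact ⟨fun _ _ => 1, fun _ => measurable_const, by simp, by simp⟩
  | succ n ih =>
    obtain ⟨φ, hm, h1, h2⟩ := ih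
    set m : α → ℝ≥0∞ := fun x => (Finset.range (n + 1)).sup (fun k => a k x) with hmdef
    have mm : Measurable m := by
      have : m = fun x => ∑ k ∈ Finset.range (n + 1), φ k x * a k x := funext h2
      rw [this]; exact Finset.measurable_sum _ fun k _ => (hm k).mul (ha k)
    have hS : MeasurableSet {x | m x < a (n + 1) x} := measurableSet_lt mm (ha _)
    classical
    refine ⟨fun k x => if k = n + 1 then (if m x < a (n + 1) x then 1 else 0)
      else (if m x < a (n + 1) x then 0 else φ k x), fun k => ?_, fun x => ?_, fun x => ?_⟩
    · by_cases hk : k = n + 1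
      · simp only [hk, if_true]; exact Measurable.ite hS measurable_const measurable_const
      · simp only [hk, if_false]; exact Measurable.ite hS measurable_const (hm k)
    · rw [Finset.sum_range_succ]
      beta_reduce
      rw [if_pos rfl]
      have : ∀ k ∈ Finset.range (n + 1), (if k = n + 1 then (if m x < a (n + 1) x then (1 : ℝ≥0∞) else 0)
          else (if m x < a (n + 1) x then 0 else φ k x)) = if m x < a (n + 1) x then 0 else φ k x :=
        fun k hk => if_neg (Finset.mem_range.1 hk).ne
      rw [Finset.sum_congr rfl this]
      by_cases h : m x < a (n + 1) x <;> simp [h, h1]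
    · rw [Finset.sum_range_succ]
      beta_reduce
      rw [if_pos rfl]
      have : ∀ k ∈ Finset.range (n + 1), (if k = n + 1 then (if m x < a (n + 1) x then (1 : ℝ≥0∞) else 0)
          else (if m x < a (n + 1) x then 0 else φ k x)) * a k x =
          (if m x < a (n + 1) x then 0 else φ k x) * a k x :=
        fun k hk => by rw [if_neg (Finset.mem_range.1 hk).ne]
      rw [Finset.sum_congr rfl this, Finset.range_add_one (n := n + 1), Finset.sup_insert]
      change a (n + 1) x ⊔ m x = _
      by_cases h : m x < a (n + 1) x
      · simp [h, h.le]
      · simp only [h, if_false, zero_mul, add_zero]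
        rw [← h2 x, sup_eq_right.2 (not_lt.1 h)]

theorem measurable_range_sup {α : Type*} [MeasurableSpace α] {a : ℕ → α → ℝ≥0∞}
    (ha : ∀ k, Measurable (a k)) (n : ℕ) :
    Measurable fun x => (Finset.range (n + 1)).sup fun k => a k x := by
  obtain ⟨φ, hφ, -, h⟩ := exists_partition_sup ha n
  rw [funext h]
  exact Finset.measurable_sum _ fun k _ => (hφ k).mul (ha k)

/-- The constant in the `L^q` bound for the heat maximal function. -/
noncomputable def maxC (q : ℝ) : ℝ≥0∞ :=
  (((ENNReal.ofReal (q / (q - 1)) * nestC (q / (q - 1))) ^ (q / (q - 1))) ^ ((q - 1) / q)) ^ q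

theorem maxC_ne_top {q : ℝ} (hq : 1 < q) : maxC q ≠ ⊤ := by
  have h1 : 0 < q - 1 := by linarith
  have hp : 1 < q / (q - 1) := by rw [lt_div_iff₀ h1]; linarith
  refine ENNReal.rpow_ne_top_of_nonneg (by linarith) (ENNReal.rpow_ne_top_of_nonneg (by positivity)
    (ENNReal.rpow_ne_top_of_nonneg (by positivity) (ENNReal.mul_ne_top ofReal_ne_top (nestC_ne_top hp))))

theorem lintegral_sup_heatL_rpow_le {e : ℝ × ℝ} {q : ℝ} (hq : 1 < q) {v : ℕ → ℝ}
    (hv : ∀ l, 0 < v l) (hanti : Antitone v) {F : ℝ × ℝ → ℝ≥0∞} (hF : Measurable F) (n : ℕ) :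
    ∫⁻ x, ((Finset.range (n + 1)).sup fun k => heatL e (v k) F x) ^ q ≤ maxC q * ∫⁻ x, F x ^ q := by
  have h1 : 0 < q - 1 := by linarith
  have hq0 : 0 < q := by linarith
  have hp : 1 < q / (q - 1) := by rw [lt_div_iff₀ h1]; linarith
  have mh : ∀ k, Measurable (heatL e (v k) F) := fun k => measurable_heatL hF
  obtain ⟨φ, hφ, hφ1, hφ2⟩ := exists_partition_sup mh n
  set m : ℝ × ℝ → ℝ≥0∞ := fun x => (Finset.range (n + 1)).sup fun k => heatL e (v k) F x with hm
  have mm : Measurable m := measurable_range_sup mh n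
  change ∫⁻ x, m x ^ q ≤ _
  by_cases hI : ∫⁻ x, F x ^ q = ⊤
  · have hc : maxC q ≠ 0 := by
      intro h0
      have h := fun N => lintegral_sum_heatL_rpow_le (e := e) hp hv hanti (g := fun _ _ => 1)
        (fun _ => measurable_const) N
      have h2 := h 1
      simp only [Finset.range_one, Finset.sum_singleton, heatL_const, one_rpow] at h2
      rw [maxC, ENNReal.rpow_eq_zero_iff_of_pos hq0, ENNReal.rpow_eq_zero_iff_of_pos (by positivity)] at h0
      rw [h0] at h2
      simp at h2
    rw [hI, ENNReal.mul_top hc]; exact le_top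
  have hX : ∫⁻ x, m x ^ q ≠ ⊤ := by
    refine ne_top_of_le_ne_top (b := ∑ k ∈ Finset.range (n + 1), ∫⁻ x, F x ^ q)
      (ENNReal.sum_ne_top.2 fun _ _ => hI) ?_
    calc _ ≤ ∫⁻ x, ∑ k ∈ Finset.range (n + 1), heatL e (v k) (fun y => F y ^ q) x := by
          refine lintegral_mono fun x => ?_
          rw [← ENNReal.le_rpow_inv_iff hq0]
          refine Finset.sup_le fun k hk => ?_
          rw [ENNReal.le_rpow_inv_iff hq0]
          refine (rpow_heatL_le hF hq.le x).trans ?_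
          exact Finset.single_le_sum (f := fun k => heatL e (v k) (fun y => F y ^ q) x)
            (fun _ _ => zero_le) hk
      _ = _ := by
          rw [lintegral_finsetSum _ fun k _ => measurable_heatL (hF.pow_const _)]
          exact Finset.sum_congr rfl fun k _ => lintegral_heatL (hF.pow_const _)
  refine le_rpow_mul_of_le_mul hq0 hX ?_
  have mg : ∀ k, Measurable fun x => φ k x * m x ^ (q - 1) := fun k => (hφ k).mul (mm.pow_const _)
  have hfac : ∀ x, m x ^ q = ∑ k ∈ Finset.range (n + 1), heatL e (v k) F x * (φ k x * m x ^ (q - 1)) := by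
    intro x
    have e1 : m x ^ q = m x * m x ^ (q - 1) := by
      conv_rhs => rw [← ENNReal.rpow_one (m x), ← ENNReal.rpow_mul, one_mul]
      rw [← ENNReal.rpow_add_of_nonneg _ _ zero_le_one h1.le, add_sub_cancel]
    rw [e1]
    conv_lhs => rw [show m x = _ from hφ2 x, Finset.sum_mul]
    refine Finset.sum_congr rfl fun k _ => ?_
    rw [← hφ2 x]
    change φ k x * heatL e (v k) F x * m x ^ (q - 1) = _
    ring
  calc ∫⁻ x, m x ^ q = ∑ k ∈ Finset.range (n + 1),
        ∫⁻ x, heatL e (v k) F x * (φ k x * m x ^ (q - 1)) := by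
        rw [← lintegral_finsetSum_mul _ mh mg]
        exact lintegral_congr hfac
    _ = ∫⁻ x, (F x ^ q) ^ (1 / q) * ((∑ k ∈ Finset.range (n + 1),
        heatL e (v k) (fun y => φ k y * m y ^ (q - 1)) x) ^ (q / (q - 1))) ^ ((q - 1) / q) := by
        rw [Finset.sum_congr rfl fun k _ => lintegral_heatL_mul hF (mg k),
          ← lintegral_finsetSum_mul _ (fun _ => hF) fun k => measurable_heatL (mg k)]
        refine lintegral_congr fun x => ?_
        rw [← Finset.mul_sum, ← ENNReal.rpow_mul, ← ENNReal.rpow_mul, mul_one_div_cancel hq0.ne',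
          ENNReal.rpow_one, show q / (q - 1) * ((q - 1) / q) = 1 by field_simp, ENNReal.rpow_one]
    _ ≤ (∫⁻ x, F x ^ q) ^ (1 / q) * (∫⁻ x, (∑ k ∈ Finset.range (n + 1),
        heatL e (v k) (fun y => φ k y * m y ^ (q - 1)) x) ^ (q / (q - 1))) ^ ((q - 1) / q) := by
        refine ENNReal.lintegral_mul_norm_pow_le (hF.pow_const _).aemeasurable
          ((Finset.measurable_sum _ fun k _ => measurable_heatL (mg k)).pow_const _).aemeasurable
          (by positivity) (by positivity) ?_
        field_simp; ring
    _ ≤ (∫⁻ x, F x ^ q) ^ (1 / q) * ((ENNReal.ofReal (q / (q - 1)) * nestC (q / (q - 1))) ^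
        (q / (q - 1)) * ∫⁻ x, m x ^ q) ^ ((q - 1) / q) := by
        refine mul_le_mul_right (ENNReal.rpow_le_rpow ?_ (by positivity)) _
        refine (lintegral_sum_heatL_rpow_le hp hv hanti mg (n + 1)).trans (le_of_eq ?_)
        congr 1
        refine lintegral_congr fun x => ?_
        rw [← Finset.sum_mul, hφ1, one_mul, ← ENNReal.rpow_mul]
        congr 1; field_simp
    _ = _ := by
        rw [ENNReal.mul_rpow_of_nonneg _ _ (by positivity)]
        ring

/-- The heat maximal operator in the direction `e`, over the scales `4 ^ k`. -/
noncomputable def hM (e : ℝ × ℝ) (F : ℝ × ℝ → ℝ≥0∞) (x : ℝ × ℝ) : ℝ≥0∞ :=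
  ⨆ k : ℤ, heatL e ((4 : ℝ) ^ k) F x

theorem posOp_hM (e : ℝ × ℝ) : PosOp (hM e) := PosOp.iSup fun _ => PosOp.heatL _ _

theorem iSup_rpow {ι : Type*} [Nonempty ι] (f : ι → ℝ≥0∞) {q : ℝ} (hq : 0 < q) :
    (⨆ i, f i) ^ q = ⨆ i, f i ^ q :=
  (ENNReal.orderIsoRpow q hq).map_iSup f

theorem lqBdd_hM {q : ℝ} (hq : 1 < q) (e : ℝ × ℝ) : LqBdd (hM e) q (maxC q) := by
  intro F hF
  have hq0 : 0 < q := by linarith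
  set m : ℕ → ℝ × ℝ → ℝ≥0∞ := fun n x =>
    (Finset.range (2 * n + 1)).sup fun l => heatL e ((4 : ℝ) ^ ((n : ℤ) - l)) F x with hm
  have mm : ∀ n, Measurable (m n) := fun n => measurable_range_sup (fun _ => measurable_heatL hF) _
  have hsup : ∀ x, hM e F x = ⨆ n, m n x := by
    intro x
    refine le_antisymm (iSup_le fun k => ?_) (iSup_le fun n => Finset.sup_le fun l _ =>
      le_iSup (fun k : ℤ => heatL e ((4 : ℝ) ^ k) F x) _)
    refine le_trans ?_ (le_iSup _ k.natAbs)
    have hk : (k.natAbs - k).toNat ∈ Finset.range (2 * k.natAbs + 1) := by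
      rw [Finset.mem_range]; omega
    refine le_trans (le_of_eq ?_)
      (Finset.le_sup (f := fun l : ℕ => heatL e ((4 : ℝ) ^ ((k.natAbs : ℤ) - l)) F x) hk)
    congr 2
    omega
  have hmono : Monotone m := by
    refine monotone_nat_of_le_succ fun n x => Finset.sup_le fun l hl => ?_
    have hl' : l + 1 ∈ Finset.range (2 * (n + 1) + 1) := by
      rw [Finset.mem_range] at hl ⊢; omega
    refine le_trans (le_of_eq ?_)
      (Finset.le_sup (f := fun l : ℕ => heatL e ((4 : ℝ) ^ (((n + 1 : ℕ) : ℤ) - l)) F x) hl')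
    beta_reduce
    congr 2
    push_cast
    ring
  simp_rw [hsup, iSup_rpow _ hq0]
  rw [lintegral_iSup (fun n => (mm n).pow_const _)
    fun i j hij x => ENNReal.rpow_le_rpow (hmono hij x) hq0.le]
  refine iSup_le fun n => ?_
  refine lintegral_sup_heatL_rpow_le hq (v := fun l : ℕ => (4 : ℝ) ^ ((n : ℤ) - l))
    (fun l => by positivity) (fun i j hij => ?_) hF (2 * n)
  refine zpow_le_zpow_right₀ (by norm_num) ?_
  omega

theorem heatL_le_hM {σ : ℝ} (hσ : 0 < σ) (e : ℝ × ℝ) {F : ℝ × ℝ → ℝ≥0∞} (hF : Measurable F)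
    (x : ℝ × ℝ) : heatL e σ F x ≤ 2 * hM e F x := by
  obtain ⟨k, hk1, hk2⟩ := exists_mem_Ioc_zpow hσ (by norm_num : (1 : ℝ) < 4)
  have h4 : (4 : ℝ) ^ (k + 1) / σ ≤ 2 ^ 2 := by
    rw [div_le_iff₀ hσ, zpow_add_one₀ (by norm_num)]; linarith
  refine (heatL_le hσ hk2 hF x).trans (mul_le_mul' ?_ (le_iSup (fun k : ℤ => heatL e ((4 : ℝ) ^ k) F x) _))
  rw [← ENNReal.ofReal_ofNat 2]
  exact ENNReal.ofReal_le_ofReal ((Real.sqrt_le_left (by norm_num)).2 h4)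

end LacunaryHalfPlane

namespace LacunaryHalfPlane

open ProbabilityTheory ENNReal

theorem tsum_geometric_mul_rpow_le {r : ℝ} (hr : 1 ≤ r) (w : ℕ → ℝ≥0∞) :
    (∑' n, 2⁻¹ ^ n * w n) ^ r ≤ 2 ^ (r - 1) * ∑' n, 2⁻¹ ^ n * w n ^ r := by
  have hr0 : 0 < r := by linarith
  have h := ENNReal.lintegral_mul_norm_pow_le (μ := Measure.count)
    (f := fun n : ℕ => (2⁻¹ : ℝ≥0∞) ^ n * w n ^ r) (g := fun n => (2⁻¹ : ℝ≥0∞) ^ n)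
    (measurable_of_countable _).aemeasurable (measurable_of_countable _).aemeasurable
    (p := 1 / r) (q := (r - 1) / r) (by positivity) (div_nonneg (by linarith) hr0.le)
    (by field_simp; ring)
  simp only [lintegral_count] at h
  have h2 : ∀ n, ((2⁻¹ : ℝ≥0∞) ^ n * w n ^ r) ^ (1 / r) * ((2⁻¹ : ℝ≥0∞) ^ n) ^ ((r - 1) / r) =
      2⁻¹ ^ n * w n := by
    intro n
    rw [ENNReal.mul_rpow_of_nonneg _ _ (by positivity), ← ENNReal.rpow_mul, mul_one_div_cancel hr0.ne',
      ENNReal.rpow_one, mul_right_comm, ← ENNReal.rpow_add_of_nonneg _ _ (by positivity)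
        (div_nonneg (by linarith) hr0.le), ← add_div, add_sub_cancel, div_self hr0.ne', ENNReal.rpow_one]
  simp_rw [h2] at h
  rw [ENNReal.tsum_geometric, ENNReal.one_sub_inv_two, inv_inv] at h
  refine (ENNReal.rpow_le_rpow h hr0.le).trans (le_of_eq ?_)
  rw [ENNReal.mul_rpow_of_nonneg _ _ hr0.le, ← ENNReal.rpow_mul, ← ENNReal.rpow_mul,
    one_div_mul_cancel hr0.ne', ENNReal.rpow_one, div_mul_cancel₀ _ hr0.ne', mul_comm]

/-- The constant in the Rubio de Francia algorithm. -/
noncomputable def rdfC (r : ℝ) (D : ℝ≥0∞) : ℝ≥0∞ := 2 * (D ^ (1 / r) + 1)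

theorem one_le_rdfC (r : ℝ) (D : ℝ≥0∞) : 1 ≤ rdfC r D := by
  rw [rdfC]
  calc (1 : ℝ≥0∞) ≤ 2 * 1 := by norm_num
    _ ≤ _ := mul_le_mul_right le_add_self _

theorem rdfC_ne_top {r : ℝ} {D : ℝ≥0∞} (hr : 0 < r) (hD : D ≠ ⊤) : rdfC r D ≠ ⊤ :=
  ENNReal.mul_ne_top (by norm_num)
    (ENNReal.add_ne_top.2 ⟨ENNReal.rpow_ne_top_of_nonneg (by positivity) hD, one_ne_top⟩)

theorem exists_rdf {T : (ℝ × ℝ → ℝ≥0∞) → ℝ × ℝ → ℝ≥0∞} (hT : PosOp T) {r : ℝ} (hr : 1 ≤ r)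
    {D : ℝ≥0∞} (hTD : LqBdd T r D) (hD : D ≠ ⊤) {h : ℝ × ℝ → ℝ≥0∞} (hh : Measurable h) :
    ∃ V : ℝ × ℝ → ℝ≥0∞, Measurable V ∧ (∀ x, h x ≤ V x) ∧ (∀ x, T V x ≤ rdfC r D * V x) ∧
      ∫⁻ x, V x ^ r ≤ 2 ^ r * ∫⁻ x, h x ^ r := by
  have hr0 : 0 < r := by linarith
  set A := D ^ (1 / r) + 1 with hA
  have hA0 : A ≠ 0 := by simp [hA]
  have hAt : A ≠ ⊤ := ENNReal.add_ne_top.2 ⟨ENNReal.rpow_ne_top_of_nonneg (by positivity) hD, one_ne_top⟩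
  have hDA : D ≤ A ^ r := by
    calc D = (D ^ (1 / r)) ^ r := by rw [← ENNReal.rpow_mul, one_div_mul_cancel hr0.ne', ENNReal.rpow_one]
      _ ≤ _ := ENNReal.rpow_le_rpow le_self_add hr0.le
  set w : ℕ → ℝ × ℝ → ℝ≥0∞ := fun n x => A⁻¹ ^ n * T^[n] h x with hw
  have mT : ∀ n, Measurable (T^[n] h) := by
    intro n
    induction n with
    | zero => simpa
    | succ n ih => rw [Function.iterate_succ_apply']; exact hT.meas ih
  have mw : ∀ n, Measurable (w n) := fun n => (mT n).const_mul _
  have mt : ∀ n, Measurable fun x => (2⁻¹ : ℝ≥0∞) ^ n * w n x := fun n => (mw n).const_mul _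
  have hwi : ∀ n, ∫⁻ x, w n x ^ r ≤ ∫⁻ x, h x ^ r := by
    intro n
    induction n with
    | zero => simp [hw]
    | succ n ih =>
      refine le_trans ?_ ih
      have e1 : ∀ x, w (n + 1) x ^ r = (A⁻¹ ^ (n + 1)) ^ r * T (T^[n] h) x ^ r := fun x => by
        simp only [hw]
        rw [Function.iterate_succ_apply', ENNReal.mul_rpow_of_nonneg _ _ hr0.le]
      have e2 : ∀ x, w n x ^ r = (A⁻¹ ^ n) ^ r * T^[n] h x ^ r := fun x => by
        simp only [hw]
        rw [ENNReal.mul_rpow_of_nonneg _ _ hr0.le]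
      simp_rw [e1, e2]
      rw [lintegral_const_mul _ ((hT.meas (mT n)).pow_const _), lintegral_const_mul _ ((mT n).pow_const _)]
      calc _ ≤ (A⁻¹ ^ (n + 1)) ^ r * (A ^ r * ∫⁻ x, T^[n] h x ^ r) :=
            mul_le_mul_right ((hTD.mono hDA) (mT n)) _
        _ = _ := by
          rw [← mul_assoc, ← ENNReal.mul_rpow_of_nonneg _ _ hr0.le, pow_succ, mul_assoc,
            ENNReal.inv_mul_cancel hA0 hAt, mul_one]
  refine ⟨fun x => ∑' n, 2⁻¹ ^ n * w n x, Measurable.tsum mt, fun x => ?_, fun x => ?_, ?_⟩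
  · refine le_trans (le_of_eq ?_) (ENNReal.le_tsum 0)
    simp [hw]
  · refine (hT.tsum mt x).trans ?_
    rw [← ENNReal.tsum_mul_left]
    calc ∑' n, T (fun y => 2⁻¹ ^ n * w n y) x ≤ ∑' n, rdfC r D * (2⁻¹ ^ (n + 1) * w (n + 1) x) := by
          refine ENNReal.tsum_le_tsum fun n => ?_
          refine (hT.const_mul _ (mw n) x).trans ?_
          refine (mul_le_mul_right (hT.const_mul _ (mT n) x) _).trans (le_of_eq ?_)
          simp only [hw, rdfC, Function.iterate_succ_apply', pow_succ]
          rw [← hA]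
          calc _ = (2 * 2⁻¹) * (A⁻¹ * A) * (2⁻¹ ^ n * (A⁻¹ ^ n * T (T^[n] h) x)) := by
                rw [ENNReal.inv_mul_cancel hA0 hAt, ENNReal.mul_inv_cancel (by norm_num) (by norm_num)]
                ring
            _ = _ := by ring
      _ ≤ _ := ENNReal.tsum_comp_le_tsum_of_injective (add_left_injective 1) _
  · calc _ ≤ ∫⁻ x, 2 ^ (r - 1) * ∑' n, 2⁻¹ ^ n * w n x ^ r :=
          lintegral_mono fun x => tsum_geometric_mul_rpow_le hr _
      _ = 2 ^ (r - 1) * ∑' n : ℕ, 2⁻¹ ^ n * ∫⁻ x, w n x ^ r := by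
          rw [lintegral_const_mul _ (Measurable.tsum fun n => ((mw n).pow_const _).const_mul _),
            lintegral_tsum fun n => (((mw n).pow_const _).const_mul _).aemeasurable]
          congr 2; ext n
          rw [lintegral_const_mul _ ((mw n).pow_const _)]
      _ ≤ 2 ^ (r - 1) * ∑' n : ℕ, 2⁻¹ ^ n * ∫⁻ x, h x ^ r :=
          mul_le_mul_right (ENNReal.tsum_le_tsum fun n => mul_le_mul_right (hwi n) _) _
      _ = _ := by
          rw [ENNReal.tsum_mul_right, ENNReal.tsum_geometric, ENNReal.one_sub_inv_two, inv_inv,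
            ← mul_assoc]
          congr 1
          conv_lhs => rw [← ENNReal.rpow_one 2, ← ENNReal.rpow_mul, one_mul]
          rw [← ENNReal.rpow_add _ _ (by norm_num) (by norm_num), sub_add_cancel]

theorem wt_truncation {V : ℝ × ℝ → ℝ≥0∞} (hV : Measurable V) (N : NNReal) {ε : NNReal} (hε : 0 < ε) :
    Wt fun x => min (V x) N + ε :=
  ⟨(hV.min measurable_const).add_const _, ε, N + ε, hε, fun _ => le_add_self, fun x => by
    push_cast; exact add_le_add_left (min_le_right _ _) _⟩

theorem truncation_le {T : (ℝ × ℝ → ℝ≥0∞) → ℝ × ℝ → ℝ≥0∞} (hT : PosOp T) {A : ℝ≥0∞} (hA : 1 ≤ A)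
    {V : ℝ × ℝ → ℝ≥0∞} (hV : Measurable V) (h : ∀ x, T V x ≤ A * V x) (N ε : NNReal) (x : ℝ × ℝ) :
    T (fun x => min (V x) N + ε) x ≤ A * (min (V x) N + ε) := by
  refine (hT.add (hV.min measurable_const) measurable_const x).trans ?_
  rw [mul_add]
  refine add_le_add ?_ ((hT.const _ x).trans (le_mul_of_one_le_left zero_le hA))
  rw [mul_min]
  exact le_min ((hT.mono (fun y => min_le_left _ _) x).trans (h x))
    ((hT.mono (fun y => min_le_right _ _) x).trans
      ((hT.const _ x).trans (le_mul_of_one_le_left zero_le hA)))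

theorem extrapolation_low {T : (ℝ × ℝ → ℝ≥0∞) → ℝ × ℝ → ℝ≥0∞} (hT : PosOp T) {s a : ℝ}
    (hs : 0 < s) (hs2 : s < 2) (ha : 0 < a) (hr : 1 ≤ a * s / (2 - s)) {D : ℝ≥0∞}
    (hTD : LqBdd T (a * s / (2 - s)) D) (hD : D ≠ ⊤) {C : ℝ≥0∞} (hC : C ≠ 0) (hCt : C ≠ ⊤)
    {Φ Ψ : ℝ × ℝ → ℝ≥0∞} (hΦ : Measurable Φ) (hΨ : Measurable Ψ) {N : NNReal} (hN : ∀ x, Ψ x ≤ N)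
    (H : ∀ V, Wt V → (∀ x, T V x ≤ rdfC (a * s / (2 - s)) D * V x) →
      ∫⁻ x, Φ x * V x ^ (-a) ≤ C * ∫⁻ x, Ψ x * V x ^ (-a)) :
    ∫⁻ x, Φ x ^ (s / 2) ≤
      C ^ (s / 2) * (2 ^ (a * s / (2 - s))) ^ (1 - s / 2) * ∫⁻ x, Ψ x ^ (s / 2) := by
  have h2s : 0 < 2 - s := by linarith
  have hs2' : 0 < 1 - s / 2 := by linarith
  set r := a * s / (2 - s) with hrdef
  set I := ∫⁻ x, Ψ x ^ (s / 2) with hI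
  rcases eq_or_ne I ⊤ with hIt | hIt
  · rw [hIt, ENNReal.mul_top]
    · exact le_top
    · refine mul_ne_zero ?_ ?_
      · simp [ENNReal.rpow_eq_zero_iff, hC, hCt]
      · simp [ENNReal.rpow_eq_zero_iff, ENNReal.rpow_eq_top_iff]
  set h : ℝ × ℝ → ℝ≥0∞ := fun x => Ψ x ^ ((2 - s) / (2 * a)) with hh
  have mh : Measurable h := hΨ.pow_const _
  have hhr : ∀ x, h x ^ r = Ψ x ^ (s / 2) := fun x => by
    simp only [hh]
    rw [← ENNReal.rpow_mul]; congr 1; rw [hrdef]; field_simp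
  set N' : NNReal := N ^ ((2 - s) / (2 * a)) with hN'
  have hhN : ∀ x, h x ≤ N' := fun x => by
    rw [hN', ENNReal.coe_rpow_of_nonneg _ (by positivity)]
    exact ENNReal.rpow_le_rpow (hN x) (by positivity)
  obtain ⟨V, mV, hV1, hV2, hV3⟩ := exists_rdf hT hr hTD hD mh
  simp_rw [hhr] at hV3
  set W : ℝ × ℝ → ℝ≥0∞ := fun x => min (V x) N' with hW
  have mW : Measurable W := mV.min measurable_const
  have hWt : ∀ x, W x ≠ ⊤ := fun x => ne_top_of_le_ne_top coe_ne_top (min_le_right _ _)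
  have hε : ∀ n : ℕ, ∫⁻ x, Φ x * (W x + ((n + 1 : NNReal)⁻¹ : NNReal)) ^ (-a) ≤ C * I := by
    intro n
    refine (H _ (wt_truncation mV N' (by positivity))
      (truncation_le hT (one_le_rdfC _ _) mV hV2 _ _)).trans ?_
    refine mul_le_mul_right (lintegral_mono fun x => ?_) _
    rcases eq_or_ne (Ψ x) 0 with h0 | h0
    · simp [h0]
    have hΨt : Ψ x ≠ ⊤ := ne_top_of_le_ne_top coe_ne_top (hN x)
    calc Ψ x * (min (V x) N' + ((n + 1 : NNReal)⁻¹ : NNReal)) ^ (-a) ≤ Ψ x * h x ^ (-a) := by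
          refine mul_le_mul_right ?_ _
          rw [ENNReal.rpow_neg, ENNReal.rpow_neg, ENNReal.inv_le_inv]
          exact ENNReal.rpow_le_rpow ((le_min (hV1 x) (hhN x)).trans le_self_add) ha.le
      _ = Ψ x ^ (s / 2) := by
          simp only [hh]
          nth_rw 1 [← ENNReal.rpow_one (Ψ x)]
          rw [← ENNReal.rpow_mul, ← ENNReal.rpow_add _ _ h0 hΨt]
          congr 1; field_simp; ring
  have hmain : ∫⁻ x, Φ x * W x ^ (-a) ≤ C * I := by
    refine le_of_tendsto' (lintegral_tendsto_of_tendsto_of_monotone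
      (f := fun (n : ℕ) x => Φ x * (W x + ((n + 1 : NNReal)⁻¹ : NNReal)) ^ (-a))
      (fun n => (hΦ.mul ((mW.add_const _).pow_const _)).aemeasurable)
      (Filter.Eventually.of_forall fun x i j hij => ?_)
      (Filter.Eventually.of_forall fun x => ?_)) hε
    · refine mul_le_mul_right ?_ _
      rw [ENNReal.rpow_neg, ENNReal.rpow_neg, ENNReal.inv_le_inv]
      refine ENNReal.rpow_le_rpow (add_le_add_right ?_ _) ha.le
      rw [ENNReal.coe_le_coe]
      gcongr
    · refine ENNReal.Tendsto.const_mul ?_ (Or.inl ?_)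
      · refine (ENNReal.continuous_rpow_const (y := -a)).tendsto _ |>.comp ?_
        have h0 : Filter.Tendsto (fun n : ℕ => ((n + 1 : NNReal)⁻¹ : NNReal)) Filter.atTop (nhds 0) := by
          have := tendsto_one_div_add_atTop_nhds_zero_nat (𝕜 := NNReal)
          simpa using this
        have h1 := (tendsto_const_nhds (x := W x)).add (ENNReal.tendsto_coe.2 h0)
        simpa using h1
      · simp [ENNReal.rpow_eq_zero_iff, hWt, ha.not_gt, ha]
  have hfin : ∀ᵐ x, Φ x * W x ^ (-a) < ⊤ :=
    ae_lt_top (hΦ.mul (mW.pow_const _)) (ne_top_of_le_ne_top (ENNReal.mul_ne_top hCt hIt) hmain)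
  calc ∫⁻ x, Φ x ^ (s / 2) ≤ ∫⁻ x, (Φ x * W x ^ (-a)) ^ (s / 2) * (V x ^ r) ^ (1 - s / 2) := by
        refine lintegral_mono_ae (hfin.mono fun x hx => ?_)
        have e1 : r * (1 - s / 2) = a * (s / 2) := by rw [hrdef]; field_simp
        rw [← ENNReal.rpow_mul, e1]
        rcases eq_or_ne (W x) 0 with h0 | h0
        · have : Φ x = 0 := by
            by_contra h1
            rw [h0, ENNReal.zero_rpow_of_neg (by linarith), ENNReal.mul_top h1] at hx
            exact lt_irrefl _ hx
          rw [this, ENNReal.zero_rpow_of_pos (by linarith)]; exact zero_le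
        · calc Φ x ^ (s / 2) = (Φ x * W x ^ (-a)) ^ (s / 2) * W x ^ (a * (s / 2)) := by
                rw [ENNReal.mul_rpow_of_nonneg _ _ (by linarith), ← ENNReal.rpow_mul, mul_assoc,
                  ← ENNReal.rpow_add _ _ h0 (hWt x), neg_mul, neg_add_cancel, ENNReal.rpow_zero, mul_one]
            _ ≤ _ := mul_le_mul_right (ENNReal.rpow_le_rpow (min_le_left _ _) (by positivity)) _
    _ ≤ (∫⁻ x, Φ x * W x ^ (-a)) ^ (s / 2) * (∫⁻ x, V x ^ r) ^ (1 - s / 2) :=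
        ENNReal.lintegral_mul_norm_pow_le (hΦ.mul (mW.pow_const _)).aemeasurable
          (mV.pow_const _).aemeasurable (by linarith) hs2'.le (by ring)
    _ ≤ (C * I) ^ (s / 2) * (2 ^ r * I) ^ (1 - s / 2) :=
        mul_le_mul' (ENNReal.rpow_le_rpow hmain (by linarith)) (ENNReal.rpow_le_rpow hV3 hs2'.le)
    _ = _ := by
        rw [ENNReal.mul_rpow_of_nonneg _ _ (by linarith), ENNReal.mul_rpow_of_nonneg _ _ hs2'.le,
          mul_mul_mul_comm, ← ENNReal.rpow_add_of_nonneg _ _ (by linarith) hs2'.le,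
          add_sub_cancel, ENNReal.rpow_one]

end LacunaryHalfPlane

namespace LacunaryHalfPlane

open ProbabilityTheory ENNReal

theorem lintegral_le_of_forall_ball {Φ : ℝ × ℝ → ℝ≥0∞} (hΦ : Measurable Φ) {B : ℝ≥0∞}
    (h : ∀ n : ℕ, ∫⁻ x, (Metric.closedBall (0 : ℝ × ℝ) n).indicator Φ x ≤ B) : ∫⁻ x, Φ x ≤ B := by
  refine le_of_tendsto' (lintegral_tendsto_of_tendsto_of_monotone
    (f := fun (n : ℕ) => (Metric.closedBall (0 : ℝ × ℝ) n).indicator Φ)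
    (fun n => (hΦ.indicator Metric.isClosed_closedBall.measurableSet).aemeasurable)
    (Filter.Eventually.of_forall fun x i j hij => ?_)
    (Filter.Eventually.of_forall fun x => ?_)) h
  · exact Set.indicator_le_indicator_of_subset
      (Metric.closedBall_subset_closedBall (by exact_mod_cast hij)) (fun _ => zero_le) x
  · obtain ⟨n, hn⟩ := exists_nat_ge (dist x 0)
    refine tendsto_const_nhds.congr' ?_
    filter_upwards [Filter.eventually_ge_atTop n] with m hm
    rw [Set.indicator_of_mem]
    rw [Metric.mem_closedBall]
    exact hn.trans (by exact_mod_cast hm)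

theorem lintegral_indicator_ball_ne_top {Φ : ℝ × ℝ → ℝ≥0∞} {B : ℝ≥0∞} (hB : B ≠ ⊤)
    (h : ∀ x, Φ x ≤ B) (n : ℕ) : ∫⁻ x, (Metric.closedBall (0 : ℝ × ℝ) n).indicator Φ x ≠ ⊤ := by
  rw [lintegral_indicator Metric.isClosed_closedBall.measurableSet]
  refine ne_top_of_le_ne_top ?_ (lintegral_mono fun x => h x)
  rw [lintegral_const, Measure.restrict_apply_univ]
  exact ENNReal.mul_ne_top hB (measure_closedBall_lt_top).ne

theorem extrapolation_high {T : (ℝ × ℝ → ℝ≥0∞) → ℝ × ℝ → ℝ≥0∞} (hT : PosOp T) {p a : ℝ}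
    (hp : 2 < p) (ha : 0 < a) (ha1 : a ≤ 1) (hr : 1 ≤ a * p / (p - 2)) {D : ℝ≥0∞}
    (hTD : LqBdd T (a * p / (p - 2)) D) (hD : D ≠ ⊤) {C : ℝ≥0∞} (hCt : C ≠ ⊤)
    {Φ Ψ : ℝ × ℝ → ℝ≥0∞} (hΦ : Measurable Φ) (hΨ : Measurable Ψ) {N : NNReal} (hN : ∀ x, Φ x ≤ N)
    (hΨi : ∫⁻ x, Ψ x ≠ ⊤)
    (H : ∀ V, Wt V → (∀ x, T V x ≤ rdfC (a * p / (p - 2)) D * V x) →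
      ∫⁻ x, Φ x * V x ^ a ≤ C * ∫⁻ x, Ψ x * V x ^ a) :
    ∫⁻ x, Φ x ^ (p / 2) ≤ (C * (2 ^ (a * p / (p - 2))) ^ ((p / 2 - 1) / (p / 2))) ^ (p / 2) *
      ∫⁻ x, Ψ x ^ (p / 2) := by
  have hp2 : 0 < p - 2 := by linarith
  have hp1 : 0 < p / 2 - 1 := by linarith
  have hp0 : 0 < p / 2 := by linarith
  set r := a * p / (p - 2) with hrdef
  refine lintegral_le_of_forall_ball (hΦ.pow_const _) fun n => ?_
  set Φn : ℝ × ℝ → ℝ≥0∞ := (Metric.closedBall (0 : ℝ × ℝ) n).indicator Φ with hΦn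
  have mΦn : Measurable Φn := hΦ.indicator Metric.isClosed_closedBall.measurableSet
  have hle : ∀ x, Φn x ≤ Φ x := fun x => Set.indicator_le_self _ _ x
  have hpow : (Metric.closedBall (0 : ℝ × ℝ) n).indicator (fun x => Φ x ^ (p / 2)) =
      fun x => Φn x ^ (p / 2) := by
    ext x
    by_cases hx : x ∈ Metric.closedBall (0 : ℝ × ℝ) n
    · simp only [hΦn, Set.indicator_of_mem hx]
    · simp only [hΦn, Set.indicator_of_notMem hx, ENNReal.zero_rpow_of_pos hp0]
  have hX : ∫⁻ x, Φn x ^ (p / 2) ≠ ⊤ := by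
    have := lintegral_indicator_ball_ne_top (Φ := fun x => Φ x ^ (p / 2)) (B := (N : ℝ≥0∞) ^ (p / 2))
      (ENNReal.rpow_ne_top_of_nonneg hp0.le coe_ne_top) (fun x => ENNReal.rpow_le_rpow (hN x) hp0.le) n
    rwa [hpow] at this
  rw [hpow]
  refine le_rpow_mul_of_le_mul hp0 hX ?_
  set h : ℝ × ℝ → ℝ≥0∞ := fun x => Φn x ^ ((p / 2 - 1) / a) with hh
  have mh : Measurable h := mΦn.pow_const _
  have hhr : ∀ x, h x ^ r = Φn x ^ (p / 2) := fun x => by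
    simp only [hh]
    rw [← ENNReal.rpow_mul]; congr 1; rw [hrdef]; field_simp
  set N' : NNReal := N ^ ((p / 2 - 1) / a) with hN'
  have hhN : ∀ x, h x ≤ N' := fun x => by
    rw [hN', ENNReal.coe_rpow_of_nonneg _ (by positivity)]
    exact ENNReal.rpow_le_rpow ((hle x).trans (hN x)) (by positivity)
  obtain ⟨V, mV, hV1, hV2, hV3⟩ := exists_rdf hT hr hTD hD mh
  simp_rw [hhr] at hV3
  set W : ℝ × ℝ → ℝ≥0∞ := fun x => min (V x) N' with hW
  have mW : Measurable W := mV.min measurable_const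
  have hε : ∀ k : ℕ, ∫⁻ x, Φ x * W x ^ a ≤
      C * ((∫⁻ x, Ψ x * W x ^ a) + (((k + 1 : NNReal)⁻¹ : NNReal) : ℝ≥0∞) ^ a * ∫⁻ x, Ψ x) := by
    intro k
    calc ∫⁻ x, Φ x * W x ^ a ≤ ∫⁻ x, Φ x * (W x + ((k + 1 : NNReal)⁻¹ : NNReal)) ^ a :=
          lintegral_mono fun x => mul_le_mul_right (ENNReal.rpow_le_rpow le_self_add ha.le) _
      _ ≤ C * ∫⁻ x, Ψ x * (W x + ((k + 1 : NNReal)⁻¹ : NNReal)) ^ a :=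
          H _ (wt_truncation mV N' (by positivity))
            (truncation_le hT (one_le_rdfC _ _) mV hV2 _ _)
      _ ≤ C * ∫⁻ x, (Ψ x * W x ^ a + (((k + 1 : NNReal)⁻¹ : NNReal) : ℝ≥0∞) ^ a * Ψ x) := by
          refine mul_le_mul_right (lintegral_mono fun x => ?_) _
          refine (mul_le_mul_right (ENNReal.rpow_add_le_add_rpow _ _ ha.le ha1) _).trans (le_of_eq ?_)
          ring
      _ = _ := by
          rw [lintegral_add_left (f := fun x => Ψ x * W x ^ a) (hΨ.mul (mW.pow_const _)), lintegral_const_mul _ hΨ]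
  have hlim : ∫⁻ x, Φ x * W x ^ a ≤ C * ∫⁻ x, Ψ x * W x ^ a := by
    refine ge_of_tendsto' (x := Filter.atTop) ?_ hε
    refine ENNReal.Tendsto.const_mul ?_ (Or.inr hCt)
    have h0 : Filter.Tendsto (fun n : ℕ => ((n + 1 : NNReal)⁻¹ : NNReal)) Filter.atTop (nhds 0) := by
      have := tendsto_one_div_add_atTop_nhds_zero_nat (𝕜 := NNReal)
      simpa using this
    have h1 := ((ENNReal.continuous_rpow_const (y := a)).tendsto _).comp (ENNReal.tendsto_coe.2 h0)
    rw [ENNReal.coe_zero, ENNReal.zero_rpow_of_pos ha] at h1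
    have h2 := ENNReal.Tendsto.mul_const (b := ∫⁻ x, Ψ x) h1 (Or.inr hΨi)
    rw [zero_mul] at h2
    simpa using (tendsto_const_nhds (x := ∫⁻ x, Ψ x * W x ^ a)).add h2
  calc ∫⁻ x, Φn x ^ (p / 2) ≤ ∫⁻ x, Φ x * W x ^ a := by
        refine lintegral_mono fun x => ?_
        calc Φn x ^ (p / 2) = Φn x * h x ^ a := by
              simp only [hh]
              rw [← ENNReal.rpow_mul, div_mul_cancel₀ _ ha.ne']
              conv_rhs => rw [← ENNReal.rpow_one (Φn x), ← ENNReal.rpow_mul, one_mul]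
              rw [← ENNReal.rpow_add_of_nonneg _ _ zero_le_one hp1.le, add_sub_cancel]
          _ ≤ _ := mul_le_mul' (hle x) (ENNReal.rpow_le_rpow (le_min (hV1 x) (hhN x)) ha.le)
    _ ≤ C * ∫⁻ x, Ψ x * W x ^ a := hlim
    _ ≤ C * ∫⁻ x, (Ψ x ^ (p / 2)) ^ (1 / (p / 2)) * (V x ^ r) ^ ((p / 2 - 1) / (p / 2)) := by
        refine mul_le_mul_right (lintegral_mono fun x => ?_) _
        rw [← ENNReal.rpow_mul, ← ENNReal.rpow_mul, mul_one_div_cancel hp0.ne', ENNReal.rpow_one,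
          show r * ((p / 2 - 1) / (p / 2)) = a by rw [hrdef]; field_simp]
        exact mul_le_mul_right (ENNReal.rpow_le_rpow (min_le_left _ _) ha.le) _
    _ ≤ C * ((∫⁻ x, Ψ x ^ (p / 2)) ^ (1 / (p / 2)) * (∫⁻ x, V x ^ r) ^ ((p / 2 - 1) / (p / 2))) := by
        refine mul_le_mul_right (ENNReal.lintegral_mul_norm_pow_le (hΨ.pow_const _).aemeasurable
          (mV.pow_const _).aemeasurable (by positivity) (by positivity) ?_) _
        field_simp; ring
    _ ≤ C * ((∫⁻ x, Ψ x ^ (p / 2)) ^ (1 / (p / 2)) *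
          (2 ^ r * ∫⁻ x, Φn x ^ (p / 2)) ^ ((p / 2 - 1) / (p / 2))) :=
        mul_le_mul_right (mul_le_mul_right (ENNReal.rpow_le_rpow hV3 (by positivity)) _) _
    _ = _ := by
        rw [ENNReal.mul_rpow_of_nonneg _ _ (by positivity)]
        ring

/-- Weighted `L²` bounds by duality. -/
theorem lintegral_sq_le_of_pairing {ι : Type*} (s : Finset ι) {u : ι → ℝ × ℝ → ℂ}
    (hu : ∀ j, BddM (u j)) {W : ℝ × ℝ → ℝ≥0∞} (hW : Wt W) {B : ℝ≥0∞}
    (H : ∀ k : ι → ℝ × ℝ → ℂ, (∀ j, BddM (k j)) → (∀ j, Integrable (k j)) →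
      (∑ j ∈ s, ‖∫ x, u j x * k j x‖ₑ) ^ 2 ≤ B * ∑ j ∈ s, ∫⁻ x, ‖k j x‖ₑ ^ 2 * (W x)⁻¹) :
    ∫⁻ x, (∑ j ∈ s, ‖u j x‖ₑ ^ 2) * W x ≤ B := by
  have mu : ∀ j, Measurable (u j) := fun j => (hu j).meas
  have mW := hW.meas
  refine lintegral_le_of_forall_ball (by fun_prop) fun n => ?_
  set b := Metric.closedBall (0 : ℝ × ℝ) n with hb
  have mb : MeasurableSet b := Metric.isClosed_closedBall.measurableSet
  obtain ⟨ε, N, hε, h1, h2⟩ := hW.bds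
  have hWr : ∀ x, ENNReal.ofReal (W x).toReal = W x := fun x => ENNReal.ofReal_toReal (hW.ne_top x)
  choose C hC using fun j => (hu j).bdd
  have hWN : ∀ x, (W x).toReal ≤ N := fun x => by
    have := ENNReal.toReal_mono coe_ne_top (h2 x); simpa using this
  set k : ι → ℝ × ℝ → ℂ := fun j => b.indicator fun x =>
    (starRingEnd ℂ) (u j x) * ((W x).toReal : ℂ) with hk
  have mk : ∀ j, Measurable (k j) := fun j => by
    refine Measurable.indicator (Measurable.mul ?_ (by fun_prop)) mb
    exact Complex.continuous_conj.measurable.comp (mu j)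
  have bk : ∀ j x, ‖k j x‖ ≤ C j * N := fun j x => by
    have h0 : 0 ≤ C j := (norm_nonneg _).trans (hC j 0)
    by_cases hx : x ∈ b
    · simp only [hk, Set.indicator_of_mem hx, norm_mul, RCLike.norm_conj, Complex.norm_real,
        Real.norm_eq_abs, abs_of_nonneg ENNReal.toReal_nonneg]
      exact mul_le_mul (hC j x) (hWN x) ENNReal.toReal_nonneg h0
    · simp only [hk, Set.indicator_of_notMem hx, norm_zero]; positivity
  have ik : ∀ j, Integrable (k j) := fun j => by
    have : Integrable (b.indicator fun x => (starRingEnd ℂ) (u j x) * ((W x).toReal : ℂ)) := by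
      rw [integrable_indicator_iff mb]
      refine Measure.integrableOn_of_bounded (M := C j * N) measure_closedBall_lt_top.ne
        ((Complex.continuous_conj.measurable.comp (mu j)).mul (by fun_prop)).aestronglyMeasurable ?_
      filter_upwards [ae_restrict_mem mb] with x hx
      have := bk j x
      simp only [hk, Set.indicator_of_mem hx] at this
      exact this
    exact this
  set Z : ι → ℝ≥0∞ := fun j => ∫⁻ x, b.indicator (fun x => ‖u j x‖ₑ ^ 2 * W x) x with hZ
  have hprod : ∀ j x, u j x * k j x = ((b.indicator (fun x => ‖u j x‖ ^ 2 * (W x).toReal) x : ℝ) : ℂ) := by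
    intro j x
    by_cases hx : x ∈ b
    · simp only [hk, Set.indicator_of_mem hx]
      rw [← mul_assoc, Complex.mul_conj, Complex.normSq_eq_norm_sq]
      push_cast; rfl
    · simp only [hk, Set.indicator_of_notMem hx]; simp
  have hsq : ∀ j x, ENNReal.ofReal (‖u j x‖ ^ 2 * (W x).toReal) = ‖u j x‖ₑ ^ 2 * W x := fun j x => by
    rw [ENNReal.ofReal_mul (by positivity), hWr, ENNReal.ofReal_pow (norm_nonneg _), ofReal_norm]
  have hpair : ∀ j, ‖∫ x, u j x * k j x‖ₑ = Z j := by
    intro j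
    simp_rw [hprod]
    rw [integral_complex_ofReal, ← ofReal_norm, Complex.norm_real, Real.norm_eq_abs,
      abs_of_nonneg (integral_nonneg fun x => Set.indicator_nonneg (fun y _ => by positivity) x),
      ofReal_integral_eq_lintegral_ofReal]
    · refine lintegral_congr fun x => ?_
      by_cases hx : x ∈ b
      · simp only [Set.indicator_of_mem hx, hsq]
      · simp only [Set.indicator_of_notMem hx, ENNReal.ofReal_zero]
    · have : Integrable fun x => u j x * k j x :=
        (ik j).bdd_mul (mu j).aestronglyMeasurable (Filter.Eventually.of_forall (hC j))
      simp_rw [hprod] at this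
      exact this.re.congr (Filter.Eventually.of_forall fun x => by simp)
    · exact Filter.Eventually.of_forall fun x => Set.indicator_nonneg (fun y _ => by positivity) x
  have hk2 : ∀ j, ∫⁻ x, ‖k j x‖ₑ ^ 2 * (W x)⁻¹ = Z j := by
    intro j
    refine lintegral_congr fun x => ?_
    by_cases hx : x ∈ b
    · simp only [hk, Set.indicator_of_mem hx, enorm_mul]
      have e1 : ‖((W x).toReal : ℂ)‖ₑ = W x := by
        rw [← ofReal_norm, Complex.norm_real, Real.norm_eq_abs,
          abs_of_nonneg ENNReal.toReal_nonneg, hWr]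
      have e2 : ‖(starRingEnd ℂ) (u j x)‖ₑ = ‖u j x‖ₑ := by
        rw [← ofReal_norm, RCLike.norm_conj, ofReal_norm]
      rw [e1, e2, mul_pow, sq (W x), mul_assoc, mul_assoc,
        ENNReal.mul_inv_cancel (hW.ne_zero x) (hW.ne_top x), mul_one]
    · simp only [hk, Set.indicator_of_notMem hx]; simp
  have hZt : ∑ j ∈ s, Z j ≠ ⊤ := by
    refine ENNReal.sum_ne_top.2 fun j _ => ?_
    refine lintegral_indicator_ball_ne_top (B := ENNReal.ofReal (C j) ^ 2 * N)
      (ENNReal.mul_ne_top (ENNReal.pow_ne_top ofReal_ne_top) coe_ne_top) (fun x => ?_) n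
    refine mul_le_mul' (pow_le_pow_left' ?_ 2) (h2 x)
    rw [← ofReal_norm]
    exact ENNReal.ofReal_le_ofReal (hC j x)
  have hsum : ∫⁻ x, b.indicator (fun x => (∑ j ∈ s, ‖u j x‖ₑ ^ 2) * W x) x = ∑ j ∈ s, Z j := by
    rw [← lintegral_finsetSum _ fun j _ => Measurable.indicator (by fun_prop) mb]
    refine lintegral_congr fun x => ?_
    by_cases hx : x ∈ b
    · simp only [Set.indicator_of_mem hx, Finset.sum_mul]
    · simp only [Set.indicator_of_notMem hx, Finset.sum_const_zero]
  have hH := H k (fun j => ⟨mk j, _, bk j⟩) ik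
  simp_rw [hpair, hk2] at hH
  rw [hsum]
  rcases eq_or_ne (∑ j ∈ s, Z j) 0 with h0 | h0
  · rw [h0]; exact zero_le
  · rw [sq] at hH
    exact (ENNReal.mul_le_mul_iff_left h0 hZt).1 hH

end LacunaryHalfPlane

namespace LacunaryHalfPlane

open ProbabilityTheory ENNReal

theorem Wt.rpow {H : ℝ × ℝ → ℝ≥0∞} (hH : Wt H) (a : ℝ) : Wt fun x => H x ^ a := by
  have key : ∀ {K : ℝ × ℝ → ℝ≥0∞}, Wt K → ∀ {b : ℝ}, 0 ≤ b → Wt fun x => K x ^ b := by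
    intro K hK b hb
    obtain ⟨ε, N, hε, h1, h2⟩ := hK.bds
    refine ⟨hK.meas.pow_const b, ε ^ b, N ^ b, NNReal.rpow_pos hε, fun x => ?_, fun x => ?_⟩
    · rw [ENNReal.coe_rpow_of_nonneg _ hb]
      exact ENNReal.rpow_le_rpow (h1 x) hb
    · rw [ENNReal.coe_rpow_of_nonneg _ hb]
      exact ENNReal.rpow_le_rpow (h2 x) hb
  rcases le_total 0 a with ha | ha
  · exact key hH ha
  · have := (key hH (neg_nonneg.2 ha)).inv
    simp_rw [← ENNReal.rpow_neg, neg_neg] at this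
    exact this

/-- The supremum of the maximal operators `hM (d i)` over `i ∈ s`. -/
noncomputable def hMs {ι : Type*} (d : ι → ℝ × ℝ) (s : Finset ι) (F : ℝ × ℝ → ℝ≥0∞) (x : ℝ × ℝ) :
    ℝ≥0∞ := ⨆ i : s, hM (d i) F x

variable {ι : Type*} {d : ι → ℝ × ℝ} {s : Finset ι}

theorem posOp_hMs (d : ι → ℝ × ℝ) (s : Finset ι) : PosOp (hMs d s) :=
  PosOp.iSup (T := fun (i : s) F x => hM (d i) F x) fun i => posOp_hM (d i)

theorem lqBdd_hMs {q : ℝ} (hq : 1 < q) (d : ι → ℝ × ℝ) (s : Finset ι) :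
    LqBdd (hMs d s) q (s.card * maxC q) :=
  LqBdd.iSup_finset (by linarith) s (fun i => posOp_hM (d i)) fun i => lqBdd_hM hq (d i)

theorem hM_le_hMs {i : ι} (hi : i ∈ s) (F : ℝ × ℝ → ℝ≥0∞) (x : ℝ × ℝ) : hM (d i) F x ≤ hMs d s F x :=
  le_iSup (fun i : s => hM (d i) F x) ⟨i, hi⟩

theorem A1.of_hMs {V : ℝ × ℝ → ℝ≥0∞} (hV : Measurable V) {K : ℝ≥0∞}
    (h : ∀ x, hMs d s V x ≤ K * V x) {i : ι} (hi : i ∈ s) : A1 (d i) (2 * K) V := fun _ hv x =>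
  (heatL_le_hM hv _ hV x).trans (by
    rw [mul_assoc]
    exact mul_le_mul_right ((hM_le_hMs hi V x).trans (h x)) 2)

theorem Wt.one : Wt fun _ => (1 : ℝ≥0∞) :=
  ⟨measurable_const, 1, 1, one_pos, fun _ => by simp, fun _ => by simp⟩

theorem A1.one (e : ℝ × ℝ) : A1 e 1 fun _ => (1 : ℝ≥0∞) := fun v _ x => by
  rw [heatL_const, mul_one]

noncomputable def sectorC (a : ℝ) (K : ℝ≥0∞) : ℝ≥0∞ :=
  ENNReal.ofReal (32 / (3 * √3)) ^ 2 * (secC a K * 2 ^ a * negC a * posC a K)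

theorem sectorC_ne_top {a : ℝ} (ha : 0 < a) (ha1 : a < 1) {K : ℝ≥0∞} (hK : K ≠ ⊤) :
    sectorC a K ≠ ⊤ := by
  refine ENNReal.mul_ne_top (ENNReal.pow_ne_top ofReal_ne_top) (ENNReal.mul_ne_top
    (ENNReal.mul_ne_top (ENNReal.mul_ne_top (secC_ne_top ha ha1 hK) ?_) (negC_ne_top ha ha1))
    (posC_ne_top ha ha1 hK))
  exact ENNReal.rpow_ne_top_of_nonneg ha.le (by norm_num)

theorem lintegral_sum_sectOp_sq_le {a : ℝ} (ha : 0 < a) (ha1 : a < 1) {e e' : ℝ × ℝ}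
    {V : ℝ × ℝ → ℝ≥0∞} {K : ℝ≥0∞} (h : A1 e K V) (h' : A1 e' K V) (hV : Wt V) (hK : K ≠ ⊤)
    {g : ℝ × ℝ → ℂ} (hg : Integrable g) (s : Finset ℤ) :
    ∫⁻ x, (∑ j ∈ s, ‖sectOp e (sdir e' j) g x‖ₑ ^ 2) * V x ^ (-a) ≤
      sectorC a K * ∫⁻ x, ‖syn g x‖ₑ ^ 2 * V x ^ (-a) := by
  refine lintegral_sq_le_of_pairing s (fun j => BddM.sectOp hg) (hV.rpow (-a)) fun k hk hi => ?_
  simp_rw [← ENNReal.rpow_neg, neg_neg]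
  calc (∑ j ∈ s, ‖∫ x, sectOp e (sdir e' j) g x * k j x‖ₑ) ^ 2
      ≤ (∑ j ∈ s, ENNReal.ofReal (32 / (3 * √3)) * ∫⁻ t : ℝ, ∫⁻ x,
          ‖derC (sdir e' j) (4 * Real.exp t)
            (sqB (sdir e' j) (Real.exp t) (sqB e (Real.exp t) (syn g))) x‖ₑ *
          ‖sqB e (Real.exp t) (k j) x‖ₑ) ^ 2 :=
        pow_le_pow_left' (Finset.sum_le_sum fun j _ => enorm_sectOp_pair_le hg (hk j) (hi j)) 2
    _ ≤ ENNReal.ofReal (32 / (3 * √3)) ^ 2 *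
        ((secC a K * 2 ^ a * negC a * ∫⁻ x, ‖syn g x‖ₑ ^ 2 * V x ^ (-a)) *
          (posC a K * ∑ j ∈ s, ∫⁻ x, ‖k j x‖ₑ ^ 2 * V x ^ a)) := by
        rw [← Finset.mul_sum, mul_pow]
        exact mul_le_mul_right (bilinear_sector_le ha ha1 h h' hV hK (BddM.syn hg) hk s) _
    _ = _ := by rw [sectorC]; ring

theorem BddM.exists_enorm_le {F : ℝ × ℝ → ℂ} (hF : BddM F) : ∃ N : NNReal, ∀ x, ‖F x‖ₑ ≤ N := by
  obtain ⟨C, hC⟩ := hF.bdd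
  refine ⟨C.toNNReal, fun x => ?_⟩
  rw [← ofReal_norm]
  exact ENNReal.ofReal_le_ofReal (hC x)

/-- Square function estimate for the sector multipliers on `L^p`, `1 < p ≤ 2`. -/
theorem exists_lintegral_sum_sectOp_le (e e' : ℝ × ℝ) {p : ℝ} (hp : 1 < p) (hp2 : p ≤ 2) :
    ∃ C : ℝ≥0∞, C ≠ ⊤ ∧ ∀ (s : Finset ℤ) (g : ℝ × ℝ → ℂ), Integrable g →
      ∫⁻ x, (∑ j ∈ s, ‖sectOp e (sdir e' j) g x‖ₑ ^ 2) ^ (p / 2) ≤ C * ∫⁻ x, ‖syn g x‖ₑ ^ p := by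
  rcases hp2.lt_or_eq with hp2 | rfl
  · have ha : 0 < 1 / p := by positivity
    have ha1 : 1 / p < 1 := by rw [div_lt_one (by linarith)]; exact hp
    have hr : 1 / p * p / (2 - p) = 1 / (2 - p) := by field_simp
    have hr1 : 1 < 1 / p * p / (2 - p) := by
      rw [hr, lt_div_iff₀ (by linarith)]; linarith
    set d : Bool → ℝ × ℝ := fun b => cond b e e' with hd
    set D : ℝ≥0∞ := (Finset.univ : Finset Bool).card * maxC (1 / p * p / (2 - p)) with hDdef
    have hD : D ≠ ⊤ := ENNReal.mul_ne_top (natCast_ne_top _) (maxC_ne_top hr1)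
    set K : ℝ≥0∞ := 2 * rdfC (1 / p * p / (2 - p)) D with hK
    have hKt : K ≠ ⊤ := ENNReal.mul_ne_top (by norm_num) (rdfC_ne_top (by linarith) hD)
    have hCt : sectorC (1 / p) K + 1 ≠ ⊤ :=
      ENNReal.add_ne_top.2 ⟨sectorC_ne_top ha ha1 hKt, one_ne_top⟩
    refine ⟨(sectorC (1 / p) K + 1) ^ (p / 2) * (2 ^ (1 / p * p / (2 - p))) ^ (1 - p / 2),
      ENNReal.mul_ne_top (ENNReal.rpow_ne_top_of_nonneg (by positivity) hCt)
        (ENNReal.rpow_ne_top_of_nonneg (by linarith)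
          (ENNReal.rpow_ne_top_of_nonneg (by linarith) (by norm_num))), fun s g hg => ?_⟩
    obtain ⟨N, hN⟩ := (BddM.syn hg).exists_enorm_le
    have := extrapolation_low (posOp_hMs d Finset.univ) (by linarith : 0 < p) hp2 ha hr1.le
      (lqBdd_hMs hr1 d Finset.univ) hD (C := sectorC (1 / p) K + 1) (by simp) hCt
      (Φ := fun x => ∑ j ∈ s, ‖sectOp e (sdir e' j) g x‖ₑ ^ 2) (Ψ := fun x => ‖syn g x‖ₑ ^ 2)
      (Finset.measurable_sum _ fun j _ => (BddM.sectOp hg).meas.enorm.pow_const 2)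
      ((BddM.syn hg).meas.enorm.pow_const 2) (N := N ^ 2)
      (fun x => by push_cast; exact pow_le_pow_left' (hN x) 2) fun V hV h => by
        refine (lintegral_sum_sectOp_sq_le ha ha1 (A1.of_hMs hV.meas h (Finset.mem_univ true))
          (A1.of_hMs hV.meas h (Finset.mem_univ false)) hV hKt hg s).trans ?_
        exact mul_le_mul_left le_self_add _
    refine this.trans (le_of_eq ?_)
    simp_rw [← ENNReal.rpow_two, ← ENNReal.rpow_mul, mul_div_cancel₀ p (two_ne_zero (α := ℝ))]
  · refine ⟨sectorC (1 / 2) 1, sectorC_ne_top (by norm_num) (by norm_num) one_ne_top,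
      fun s g hg => ?_⟩
    have := lintegral_sum_sectOp_sq_le (a := 1 / 2) (by norm_num) (by norm_num) (A1.one e)
      (A1.one e') Wt.one one_ne_top hg s
    simpa using this

end LacunaryHalfPlane

namespace LacunaryHalfPlane

open ProbabilityTheory ENNReal

variable {e e' : ℝ × ℝ}

/-- The strong maximal operator attached to the directions `e` and `e'`. -/
noncomputable def hMst (e e' : ℝ × ℝ) (F : ℝ × ℝ → ℝ≥0∞) : ℝ × ℝ → ℝ≥0∞ := hM e (hM e' F)

theorem posOp_hMst (e e' : ℝ × ℝ) : PosOp (hMst e e') := (posOp_hM e).comp (posOp_hM e')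

theorem lqBdd_hMst {q : ℝ} (hq : 1 < q) (e e' : ℝ × ℝ) : LqBdd (hMst e e') q (maxC q * maxC q) :=
  (lqBdd_hM hq e).comp (lqBdd_hM hq e') (posOp_hM e')

theorem heatL_sdir_le_hMst {σ σ' : ℝ} (hσ : 0 < σ) (hσ' : 0 < σ') (j : ℤ) {F : ℝ × ℝ → ℝ≥0∞}
    (hF : Measurable F) (x : ℝ × ℝ) :
    heatL e σ (heatL (sdir e' j) σ' F) x ≤ 4 * hMst e e' F x := by
  have hm := (posOp_hM e').meas hF
  calc heatL e σ (heatL (sdir e' j) σ' F) x ≤ heatL e σ (fun y => 2 * hM e' F y) x := by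
        refine heatL_mono (fun y => ?_) x
        rw [heatL_sdir]
        exact heatL_le_hM (by positivity) e' hF y
    _ = 2 * heatL e σ (hM e' F) x := heatL_const_mul 2 hm x
    _ ≤ 2 * (2 * hM e (hM e' F) x) := mul_le_mul_right (heatL_le_hM hσ e hm x) 2
    _ = _ := by rw [← mul_assoc]; norm_num [hMst]

/-- The directional maximal function of a nonnegative band-sum is controlled by the strong maximal
function and by maximal functions of its sector projections. -/
theorem hM_enorm_syn_le {g : ℝ × ℝ → ℂ} (hg : Integrable g) (j : ℤ)
    (hpos : ∀ (d : ℝ × ℝ) (v : ℝ) (x : ℝ × ℝ),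
      heatL d v (fun y => ‖syn g y‖ₑ) x = ‖heatC d v (syn g) x‖ₑ) (x : ℝ × ℝ) :
    hM (e + sdir e' j) (fun y => ‖syn g y‖ₑ) x ≤
      (46657 * 4) * hMst e e' (fun y => ‖syn g y‖ₑ) x +
      2 * hM (e + sdir e' j) (fun y => ‖sectOp e (sdir e' j) g y‖ₑ) x +
      4 * hMst e e' (fun y => ‖sectOp e (sdir e' j) g y‖ₑ) x := by
  have m1 : Measurable fun y => ‖syn g y‖ₑ := (BddM.syn hg).meas.enorm
  have m2 : Measurable fun y => ‖sectOp e (sdir e' j) g y‖ₑ := (BddM.sectOp hg).meas.enorm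
  refine iSup_le fun k => ?_
  have hk : (0 : ℝ) < 4 ^ k := by positivity
  rw [hpos]
  refine (enorm_heatC_le_sect hg hk fun σ hσ => heatL_sdir_le_hMst hσ hσ j m1 x).trans ?_
  rw [mul_assoc]
  exact add_le_add (add_le_add le_rfl (heatL_le_hM hk _ m2 x))
    (heatL_sdir_le_hMst (by positivity) (by positivity) j m2 x)

/-- `ℓ²`-valued boundedness on `L^p`, uniformly in finite index sets. -/
def VVBdd (T : ℤ → (ℝ × ℝ → ℝ≥0∞) → ℝ × ℝ → ℝ≥0∞) (p : ℝ) : Prop :=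
  ∃ B : ℝ≥0∞, B ≠ ⊤ ∧ ∀ (s : Finset ℤ) (f : ℤ → ℝ × ℝ → ℝ≥0∞), (∀ j, Measurable (f j)) →
    (∀ j x, f j x ≠ ⊤) →
      ∫⁻ x, (∑ j ∈ s, T j (f j) x ^ 2) ^ (p / 2) ≤ B * ∫⁻ x, (∑ j ∈ s, f j x ^ 2) ^ (p / 2)

theorem vvBdd_two {T : ℤ → (ℝ × ℝ → ℝ≥0∞) → ℝ × ℝ → ℝ≥0∞} {B : ℝ≥0∞} (hB : B ≠ ⊤)
    (hT : ∀ j, PosOp (T j)) (h : ∀ j, LqBdd (T j) 2 B) : VVBdd T 2 := by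
  refine ⟨B, hB, fun s f hf _ => ?_⟩
  simp only [div_self (two_ne_zero (α := ℝ)), ENNReal.rpow_one]
  rw [lintegral_finsetSum _ fun j _ => ((hT j).meas (hf j)).pow_const 2,
    lintegral_finsetSum _ fun j _ => (hf j).pow_const 2, Finset.mul_sum]
  refine Finset.sum_le_sum fun j _ => ?_
  have := h j (hf j)
  simpa only [ENNReal.rpow_two] using this

/-- `L^p` boundedness of the lacunary directional maximal operators, uniformly in finite sets of
directions. -/
def UnifBdd (e e' : ℝ × ℝ) (p : ℝ) : Prop :=
  ∃ A : ℝ≥0∞, A ≠ ⊤ ∧ ∀ s : Finset ℤ, LqBdd (hMs (fun j => e + sdir e' j) s) p A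

theorem vvBdd_of_unifBdd {p q θ : ℝ} (hθ : 0 < θ) (hθ1 : θ < 1 / 2) (hq : 1 < q) (hp : 0 < p)
    (hpq : 1 / p = 1 / 2 + θ / q) (h : UnifBdd e e' q) :
    VVBdd (fun j => hM (e + sdir e' j)) p ∧ VVBdd (fun _ => hMst e e') p := by
  have hr : 1 < 2 * (1 - θ) := by linarith
  have h1 : 0 ≤ θ * p / q := by positivity
  have h2 : 0 ≤ p / 2 := by positivity
  constructor
  · obtain ⟨A, hA, hA'⟩ := h
    refine ⟨A ^ (θ * p / q) * maxC (2 * (1 - θ)) ^ (p / 2), ENNReal.mul_ne_top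
      (ENNReal.rpow_ne_top_of_nonneg h1 hA) (ENNReal.rpow_ne_top_of_nonneg h2 (maxC_ne_top hr)),
      fun s f hf hf' => ?_⟩
    exact vector_valued s (fun j _ => posOp_hM _) (posOp_hMs (fun j => e + sdir e' j) s)
      (fun j hj F x => hM_le_hMs (d := fun j => e + sdir e' j) hj F x) hθ (by linarith) (by linarith)
      hp hpq (hA' s) (fun j _ => lqBdd_hM hr _) hf hf'
  · have hq' := maxC_ne_top hq
    have hr' := maxC_ne_top hr
    refine ⟨_, ENNReal.mul_ne_top
      (ENNReal.rpow_ne_top_of_nonneg h1 (ENNReal.mul_ne_top hq' hq'))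
      (ENNReal.rpow_ne_top_of_nonneg h2 (ENNReal.mul_ne_top hr' hr')), fun s f hf hf' =>
      vector_valued s (fun j _ => posOp_hMst e e') (posOp_hMst e e') (fun _ _ _ _ => le_rfl) hθ
        (by linarith) (by linarith) hp hpq (lqBdd_hMst hq e e') (fun j _ => lqBdd_hMst hr e e')
        hf hf'⟩

theorem add_add_rpow_le (a b c : ℝ≥0∞) {p : ℝ} (hp : 0 ≤ p) :
    (a + b + c) ^ p ≤ 3 ^ p * (a ^ p + b ^ p + c ^ p) := by
  have key : a + b + c ≤ 3 * max (max a b) c := by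
    calc a + b + c ≤ max (max a b) c + max (max a b) c + max (max a b) c := by
          gcongr
          · exact le_max_of_le_left (le_max_left _ _)
          · exact le_max_of_le_left (le_max_right _ _)
          · exact le_max_right _ _
      _ = _ := by ring
  refine (ENNReal.rpow_le_rpow key hp).trans ?_
  rw [ENNReal.mul_rpow_of_nonneg _ _ hp]
  refine mul_le_mul_right ?_ _
  rcases max_choice (max a b) c with h | h <;> rw [h]
  · rcases max_choice a b with h | h <;> rw [h]
    · exact le_add_right le_self_add
    · exact le_add_right le_add_self
  · exact le_add_self

theorem lintegral_const_mul_add_add {f g h : ℝ × ℝ → ℝ≥0∞} (hf : Measurable f) (hg : Measurable g)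
    (hh : Measurable h) (a b c d : ℝ≥0∞) : ∫⁻ x, a * (b * f x + c * g x + d * h x) =
      a * (b * (∫⁻ x, f x) + c * (∫⁻ x, g x) + d * ∫⁻ x, h x) := by
  rw [lintegral_const_mul _ (by fun_prop), lintegral_add_left (by fun_prop),
    lintegral_add_left (by fun_prop), lintegral_const_mul _ hf, lintegral_const_mul _ hg,
    lintegral_const_mul _ hh]

theorem exists_hMs_syn_le {p : ℝ} (hp : 1 < p) (hp2 : p ≤ 2)
    (h1 : VVBdd (fun j => hM (e + sdir e' j)) p) (h2 : VVBdd (fun _ => hMst e e') p) :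
    ∃ A : ℝ≥0∞, A ≠ ⊤ ∧ ∀ (s : Finset ℤ) (g : ℝ × ℝ → ℂ), Integrable g →
      (∀ (d : ℝ × ℝ) (v : ℝ) (x : ℝ × ℝ),
        heatL d v (fun y => ‖syn g y‖ₑ) x = ‖heatC d v (syn g) x‖ₑ) →
      ∫⁻ x, hMs (fun j => e + sdir e' j) s (fun y => ‖syn g y‖ₑ) x ^ p ≤
        A * ∫⁻ x, ‖syn g x‖ₑ ^ p := by
  have hp0 : 0 < p := by linarith
  obtain ⟨B1, hB1, h1⟩ := h1
  obtain ⟨B2, hB2, h2⟩ := h2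
  obtain ⟨C, hC, hS⟩ := exists_lintegral_sum_sectOp_le e e' hp hp2
  have hm := maxC_ne_top hp
  have nt : ∀ n : ℕ, ((n : ℝ≥0∞)) ^ p ≠ ⊤ := fun n =>
    ENNReal.rpow_ne_top_of_nonneg hp0.le (natCast_ne_top n)
  refine ⟨3 ^ p * ((46657 * 4) ^ p * (maxC p * maxC p) + 2 ^ p * (B1 * C) + 4 ^ p * (B2 * C)), ?_,
    fun s g hg hpos => ?_⟩
  · refine ENNReal.mul_ne_top (by exact_mod_cast nt 3) (ENNReal.add_ne_top.2
      ⟨ENNReal.add_ne_top.2 ⟨ENNReal.mul_ne_top (by exact_mod_cast nt (46657 * 4))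
        (ENNReal.mul_ne_top hm hm), ENNReal.mul_ne_top (by exact_mod_cast nt 2)
          (ENNReal.mul_ne_top hB1 hC)⟩,
        ENNReal.mul_ne_top (by exact_mod_cast nt 4) (ENNReal.mul_ne_top hB2 hC)⟩)
  set w : ℝ × ℝ → ℝ≥0∞ := fun y => ‖syn g y‖ₑ with hw
  set S : ℤ → ℝ × ℝ → ℝ≥0∞ := fun j y => ‖sectOp e (sdir e' j) g y‖ₑ with hSdef
  have mw : Measurable w := (BddM.syn hg).meas.enorm
  have mS : ∀ j, Measurable (S j) := fun j => (BddM.sectOp hg).meas.enorm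
  have tS : ∀ j x, S j x ≠ ⊤ := fun j x => enorm_ne_top
  have sq_le : ∀ (u : ℤ → ℝ≥0∞) (j : ℤ), j ∈ s → u j ≤ (∑ j ∈ s, u j ^ 2) ^ (1 / 2 : ℝ) := by
    intro u j hj
    calc u j = (u j ^ 2) ^ (1 / 2 : ℝ) := by
          rw [← ENNReal.rpow_two, ← ENNReal.rpow_mul]; norm_num
      _ ≤ _ := ENNReal.rpow_le_rpow
          (Finset.single_le_sum (f := fun j => u j ^ 2) (fun _ _ => zero_le) hj) (by norm_num)
  have hpt : ∀ x, hMs (fun j => e + sdir e' j) s w x ^ p ≤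
      3 ^ p * ((46657 * 4) ^ p * hMst e e' w x ^ p +
        2 ^ p * (∑ j ∈ s, hM (e + sdir e' j) (S j) x ^ 2) ^ (p / 2) +
        4 ^ p * (∑ j ∈ s, hMst e e' (S j) x ^ 2) ^ (p / 2)) := by
    intro x
    have hle : hMs (fun j => e + sdir e' j) s w x ≤ (46657 * 4) * hMst e e' w x +
        2 * (∑ j ∈ s, hM (e + sdir e' j) (S j) x ^ 2) ^ (1 / 2 : ℝ) +
        4 * (∑ j ∈ s, hMst e e' (S j) x ^ 2) ^ (1 / 2 : ℝ) := by
      refine iSup_le fun j => (hM_enorm_syn_le hg j hpos x).trans ?_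
      exact add_le_add (add_le_add le_rfl
        (mul_le_mul_right (sq_le (fun j => hM (e + sdir e' j) (S j) x) j j.2) 2))
        (mul_le_mul_right (sq_le (fun j => hMst e e' (S j) x) j j.2) 4)
    refine (ENNReal.rpow_le_rpow hle hp0.le).trans ((add_add_rpow_le _ _ _ hp0.le).trans
      (le_of_eq ?_))
    simp only [ENNReal.mul_rpow_of_nonneg _ _ hp0.le, ← ENNReal.rpow_mul]
    rw [show 1 / 2 * p = p / 2 by ring]
  have m1 : Measurable fun x => hMst e e' w x ^ p := ((posOp_hMst e e').meas mw).pow_const p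
  have m2 : Measurable fun x => (∑ j ∈ s, hM (e + sdir e' j) (S j) x ^ 2) ^ (p / 2) :=
    (Finset.measurable_sum _ fun j _ => ((posOp_hM _).meas (mS j)).pow_const 2).pow_const _
  have m3 : Measurable fun x => (∑ j ∈ s, hMst e e' (S j) x ^ 2) ^ (p / 2) :=
    (Finset.measurable_sum _ fun j _ => ((posOp_hMst e e').meas (mS j)).pow_const 2).pow_const _
  have i1 : ∫⁻ x, hMst e e' w x ^ p ≤ maxC p * maxC p * ∫⁻ x, w x ^ p := lqBdd_hMst hp e e' mw
  have i2 : ∫⁻ x, (∑ j ∈ s, hM (e + sdir e' j) (S j) x ^ 2) ^ (p / 2) ≤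
      B1 * (C * ∫⁻ x, w x ^ p) := (h1 s S mS tS).trans (mul_le_mul_right (hS s g hg) _)
  have i3 : ∫⁻ x, (∑ j ∈ s, hMst e e' (S j) x ^ 2) ^ (p / 2) ≤
      B2 * (C * ∫⁻ x, w x ^ p) := (h2 s S mS tS).trans (mul_le_mul_right (hS s g hg) _)
  refine (lintegral_mono hpt).trans ?_
  rw [lintegral_const_mul_add_add m1 m2 m3]
  calc _ ≤ 3 ^ p * ((46657 * 4) ^ p * (maxC p * maxC p * ∫⁻ x, w x ^ p) +
        2 ^ p * (B1 * (C * ∫⁻ x, w x ^ p)) + 4 ^ p * (B2 * (C * ∫⁻ x, w x ^ p))) := by gcongr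
    _ = _ := by ring

end LacunaryHalfPlane

namespace LacunaryHalfPlane

open ProbabilityTheory ENNReal

variable {e e' : ℝ × ℝ}

theorem heatL_enorm_eq_enorm_heatC {F : ℝ × ℝ → ℂ} (hF : BddM F) {ρ : ℝ × ℝ → ℝ}
    (hρ : ∀ x, 0 ≤ ρ x) (h : ∀ x, F x = ρ x) (d : ℝ × ℝ) (v : ℝ) (x : ℝ × ℝ) :
    heatL d v (fun y => ‖F y‖ₑ) x = ‖heatC d v F x‖ₑ := by
  have hi := (integrable_heatC_aux (e := d) (v := v) hF x).re
  have hn : ∀ y, ‖F y‖ₑ = ENNReal.ofReal (ρ y) := fun y => by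
    rw [h, ← ofReal_norm, Complex.norm_real, Real.norm_eq_abs, abs_of_nonneg (hρ y)]
  simp only [h, Complex.ofReal_re, RCLike.re_to_complex] at hi
  unfold heatC heatL
  simp_rw [hn, h]
  rw [integral_complex_ofReal, ← ofReal_norm, Complex.norm_real, Real.norm_eq_abs,
    abs_of_nonneg (integral_nonneg fun s => hρ _), ofReal_integral_eq_lintegral_ofReal hi
      (Filter.Eventually.of_forall fun s => hρ _)]

theorem exists_schwartz_approx {p : ℝ} (hp : 1 ≤ p) {F : ℝ × ℝ → ℝ≥0∞} (hF : Measurable F)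
    (hFi : ∫⁻ x, F x ^ p ≠ ⊤) {η : ℝ} (hη : 0 < η) :
    ∃ (f : SchwartzMap (ℝ × ℝ) ℂ) (ψ : ℝ × ℝ → ℝ) (R : ℝ × ℝ → ℝ≥0∞),
      (∀ x, f x = ((ψ x ^ 2 : ℝ) : ℂ)) ∧ Measurable R ∧ (∀ x, F x ≤ 2 * ‖f x‖ₑ + R x) ∧
      (∀ x, ‖f x‖ₑ ≤ 2 * F x + R x) ∧ ∫⁻ x, R x ^ p ≤ ENNReal.ofReal η := by
  have hp0 : 0 < p := by linarith
  set u : ℝ × ℝ → ℝ := fun x => √(F x).toReal with hu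
  have mu : Measurable u := hF.ennreal_toReal.sqrt
  have hPt : (ENNReal.ofReal (2 * p)).toReal = 2 * p := toReal_ofReal (by linarith)
  have hP0 : ENNReal.ofReal (2 * p) ≠ 0 := by simpa using hp0
  have hP1 : 1 ≤ ENNReal.ofReal (2 * p) := by
    rw [← ENNReal.ofReal_one]; exact ENNReal.ofReal_le_ofReal (by linarith)
  have hFt : ∀ᵐ x, F x ≠ ⊤ := by
    filter_upwards [ae_lt_top (hF.pow_const p) hFi] with x hx h
    rw [h, ENNReal.top_rpow_of_pos hp0] at hx
    exact lt_irrefl _ hx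
  have husq : ∀ x, F x ≠ ⊤ → ENNReal.ofReal (u x ^ 2) = F x := fun x hx => by
    rw [hu]; simp only [Real.sq_sqrt ENNReal.toReal_nonneg, ofReal_toReal hx]
  have hpow : ∀ r : ℝ, ‖r‖ₑ ^ (2 * p) = ENNReal.ofReal (r ^ 2) ^ p := fun r => by
    rw [ENNReal.rpow_mul, ENNReal.rpow_two, ← ofReal_norm, ← ENNReal.ofReal_pow (norm_nonneg _),
      Real.norm_eq_abs, sq_abs]
  have hmem : MemLp u (ENNReal.ofReal (2 * p)) := by
    refine ⟨mu.aestronglyMeasurable, ?_⟩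
    rw [eLpNorm_lt_top_iff_lintegral_rpow_enorm_lt_top hP0 ofReal_ne_top, hPt]
    refine lt_of_eq_of_lt (lintegral_congr_ae ?_) hFi.lt_top
    filter_upwards [hFt] with x hx
    rw [hpow, husq x hx]
  set ε : ℝ := (η / 2 ^ p) ^ (1 / (2 * p)) with hε
  have hε0 : 0 < ε := by positivity
  obtain ⟨ψ, hψc, hψd, hψ⟩ := hmem.exist_eLpNorm_sub_le ofReal_ne_top hP1 hε0
  have hψi : ∫⁻ x, ENNReal.ofReal ((u x - ψ x) ^ 2) ^ p ≤ ENNReal.ofReal (η / 2 ^ p) := by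
    rw [eLpNorm_eq_lintegral_rpow_enorm_toReal hP0 ofReal_ne_top, hPt,
      one_div, ENNReal.rpow_inv_le_iff (by positivity), ENNReal.ofReal_rpow_of_pos hε0, hε,
      ← Real.rpow_mul (by positivity), one_div_mul_cancel (by positivity), Real.rpow_one] at hψ
    simpa only [hpow, Pi.sub_apply] using hψ
  have hdiff : ContDiff ℝ (⊤ : ℕ∞) fun x => ((ψ x ^ 2 : ℝ) : ℂ) :=
    Complex.ofRealCLM.contDiff.comp (hψd.pow 2)
  have hcomp : HasCompactSupport fun x => ((ψ x ^ 2 : ℝ) : ℂ) :=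
    hψc.comp_left (g := fun r : ℝ => ((r ^ 2 : ℝ) : ℂ)) (by simp)
  have mψ : Measurable ψ := hψd.continuous.measurable
  classical
  set R : ℝ × ℝ → ℝ≥0∞ := fun x => if F x = ⊤ then ⊤ else 2 * ENNReal.ofReal ((u x - ψ x) ^ 2) with hR
  have hn : ∀ x, ‖((ψ x ^ 2 : ℝ) : ℂ)‖ₑ = ENNReal.ofReal (ψ x ^ 2) := fun x => by
    rw [← ofReal_norm, Complex.norm_real, Real.norm_eq_abs, abs_of_nonneg (sq_nonneg _)]
  have two : (2 : ℝ≥0∞) = ENNReal.ofReal 2 := by simp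
  refine ⟨hcomp.toSchwartzMap hdiff, ψ, R, fun x => rfl, ?_, fun x => ?_, fun x => ?_, ?_⟩
  · exact Measurable.ite (hF (measurableSet_singleton ⊤)) measurable_const (by fun_prop)
  · change F x ≤ 2 * ‖((ψ x ^ 2 : ℝ) : ℂ)‖ₑ + R x
    by_cases hx : F x = ⊤
    · simp [hR, hx]
    · simp only [hR, if_neg hx, hn]
      rw [← husq x hx, two, ← ENNReal.ofReal_mul (by norm_num), ← ENNReal.ofReal_mul (by norm_num),
        ← ENNReal.ofReal_add (by positivity) (by positivity)]
      exact ENNReal.ofReal_le_ofReal (by nlinarith [sq_nonneg (u x - 2 * ψ x)])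
  · change ‖((ψ x ^ 2 : ℝ) : ℂ)‖ₑ ≤ 2 * F x + R x
    by_cases hx : F x = ⊤
    · simp [hR, hx]
    · simp only [hR, if_neg hx, hn]
      rw [← husq x hx, two, ← ENNReal.ofReal_mul (by norm_num), ← ENNReal.ofReal_mul (by norm_num),
        ← ENNReal.ofReal_add (by positivity) (by positivity)]
      exact ENNReal.ofReal_le_ofReal (by nlinarith [sq_nonneg (2 * u x - ψ x)])
  · calc ∫⁻ x, R x ^ p = ∫⁻ x, 2 ^ p * ENNReal.ofReal ((u x - ψ x) ^ 2) ^ p := by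
          refine lintegral_congr_ae ?_
          filter_upwards [hFt] with x hx
          simp only [hR, if_neg hx, ENNReal.mul_rpow_of_nonneg _ _ hp0.le]
      _ = 2 ^ p * ∫⁻ x, ENNReal.ofReal ((u x - ψ x) ^ 2) ^ p :=
          lintegral_const_mul _ (by fun_prop)
      _ ≤ 2 ^ p * ENNReal.ofReal (η / 2 ^ p) := mul_le_mul_right hψi _
      _ = ENNReal.ofReal η := by
          rw [two, ENNReal.ofReal_rpow_of_pos two_pos, ← ENNReal.ofReal_mul (by positivity)]
          congr 1
          field_simp

theorem unifBdd_of_vvBdd {p : ℝ} (hp : 1 < p) (hp2 : p ≤ 2)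
    (h1 : VVBdd (fun j => hM (e + sdir e' j)) p) (h2 : VVBdd (fun _ => hMst e e') p) :
    UnifBdd e e' p := by
  have hp0 : 0 < p := by linarith
  obtain ⟨A, hA, H⟩ := exists_hMs_syn_le hp hp2 h1 h2
  have c3 : (3 : ℝ≥0∞) ^ p ≠ ⊤ := ENNReal.rpow_ne_top_of_nonneg hp0.le (by norm_num)
  have c2 : (2 : ℝ≥0∞) ^ p ≠ ⊤ := ENNReal.rpow_ne_top_of_nonneg hp0.le (by norm_num)
  have addr : ∀ a b : ℝ≥0∞, (2 * a + b) ^ p ≤ 3 ^ p * (2 ^ p * a ^ p + b ^ p) := fun a b => by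
    have := add_add_rpow_le (2 * a) b 0 hp0.le
    rwa [add_zero, ENNReal.zero_rpow_of_pos hp0, add_zero, ENNReal.mul_rpow_of_nonneg _ _ hp0.le]
      at this
  have mint : ∀ {f g : ℝ × ℝ → ℝ≥0∞}, Measurable f → Measurable g →
      ∫⁻ x, 3 ^ p * (2 ^ p * f x ^ p + g x ^ p) =
        3 ^ p * (2 ^ p * (∫⁻ x, f x ^ p) + ∫⁻ x, g x ^ p) := fun {f g} hf hg => by
    rw [lintegral_const_mul _ (by fun_prop), lintegral_add_left (by fun_prop),
      lintegral_const_mul _ (by fun_prop)]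
  set A' : ℝ≥0∞ := 3 ^ p * (2 ^ p * (A * (3 ^ p * 2 ^ p))) + 1 with hA'
  have hA't : A' ≠ ⊤ := ENNReal.add_ne_top.2 ⟨ENNReal.mul_ne_top c3 (ENNReal.mul_ne_top c2
    (ENNReal.mul_ne_top hA (ENNReal.mul_ne_top c3 c2))), one_ne_top⟩
  refine ⟨A', hA't, fun s F hF => ?_⟩
  set T := hMs (fun j => e + sdir e' j) s with hT
  have pT : PosOp T := posOp_hMs _ s
  have bT : LqBdd T p (s.card * maxC p) := lqBdd_hMs hp _ s
  by_cases hFi : ∫⁻ x, F x ^ p = ⊤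
  · rw [hFi, ENNReal.mul_top (by simp [hA'])]
    exact le_top
  set D : ℝ≥0∞ := 3 ^ p * (2 ^ p * (A * 3 ^ p) + s.card * maxC p) with hD
  have hDt : D ≠ ⊤ := ENNReal.mul_ne_top c3 (ENNReal.add_ne_top.2
    ⟨ENNReal.mul_ne_top c2 (ENNReal.mul_ne_top hA c3),
      ENNReal.mul_ne_top (natCast_ne_top _) (maxC_ne_top hp)⟩)
  have key : ∀ η : ℝ, 0 < η → ∫⁻ x, T F x ^ p ≤ A' * (∫⁻ x, F x ^ p) + D * ENNReal.ofReal η := by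
    intro η hη
    obtain ⟨f, ψ, R, hf, mR, hFR, hfR, hRi⟩ := exists_schwartz_approx hp.le hF hFi hη
    set w : ℝ × ℝ → ℝ≥0∞ := fun y => ‖f y‖ₑ with hw
    have mw : Measurable w := f.continuous.measurable.enorm
    have hsyn : syn (fourier2 f) = f := funext (syn_fourier2 f)
    have hHw : ∫⁻ x, T w x ^ p ≤ A * ∫⁻ x, w x ^ p := by
      have := H s (fourier2 f) (integrable_fourier2 f) fun d v x =>
        heatL_enorm_eq_enorm_heatC (BddM.syn (integrable_fourier2 f)) (ρ := fun x => ψ x ^ 2)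
          (fun x => sq_nonneg _) (fun x => by rw [syn_fourier2, hf]) d v x
      simpa only [hsyn] using this
    have hwi : ∫⁻ x, w x ^ p ≤ 3 ^ p * (2 ^ p * (∫⁻ x, F x ^ p) + ENNReal.ofReal η) := by
      refine (lintegral_mono fun x => (ENNReal.rpow_le_rpow (hfR x) hp0.le).trans
        (addr (F x) (R x))).trans ?_
      rw [mint hF mR]
      gcongr
    calc ∫⁻ x, T F x ^ p ≤ ∫⁻ x, 3 ^ p * (2 ^ p * T w x ^ p + T R x ^ p) := by
          refine lintegral_mono fun x => ?_
          refine (ENNReal.rpow_le_rpow ?_ hp0.le).trans (addr (T w x) (T R x))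
          refine (pT.mono hFR x).trans ((pT.add (mw.const_mul 2) mR x).trans ?_)
          exact add_le_add (pT.const_mul 2 mw x) le_rfl
      _ = 3 ^ p * (2 ^ p * (∫⁻ x, T w x ^ p) + ∫⁻ x, T R x ^ p) := mint (pT.meas mw) (pT.meas mR)
      _ ≤ 3 ^ p * (2 ^ p * (A * (3 ^ p * (2 ^ p * (∫⁻ x, F x ^ p) + ENNReal.ofReal η))) +
          s.card * maxC p * ENNReal.ofReal η) := by
          refine mul_le_mul_right (add_le_add (mul_le_mul_right ?_ _) ?_) _
          · exact hHw.trans (mul_le_mul_right hwi _)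
          · exact (bT mR).trans (mul_le_mul_right hRi _)
      _ = 3 ^ p * (2 ^ p * (A * (3 ^ p * 2 ^ p))) * (∫⁻ x, F x ^ p) + D * ENNReal.ofReal η := by
          rw [hD]; ring
      _ ≤ _ := add_le_add (mul_le_mul_left le_self_add _) le_rfl
  have hlim : Filter.Tendsto (fun η : ℝ => A' * (∫⁻ x, F x ^ p) + D * ENNReal.ofReal η)
      (nhdsWithin 0 (Set.Ioi 0)) (nhds (A' * (∫⁻ x, F x ^ p) + D * ENNReal.ofReal 0)) := by
    refine Filter.Tendsto.const_add _ (ENNReal.Tendsto.const_mul ?_ (Or.inr hDt))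
    exact (ENNReal.continuous_ofReal.tendsto 0).mono_left nhdsWithin_le_nhds
  have := ge_of_tendsto hlim (by filter_upwards [self_mem_nhdsWithin] with η hη using key η hη)
  simpa using this

theorem unifBdd_two : UnifBdd e e' 2 :=
  unifBdd_of_vvBdd (by norm_num) le_rfl
    (vvBdd_two (maxC_ne_top (by norm_num)) (fun _ => posOp_hM _) fun _ => lqBdd_hM (by norm_num) _)
    (vvBdd_two (ENNReal.mul_ne_top (maxC_ne_top (by norm_num)) (maxC_ne_top (by norm_num)))
      (fun _ => posOp_hMst e e') fun _ => lqBdd_hMst (by norm_num) e e')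

theorem UnifBdd.mono {r q : ℝ} (hr : 0 < r) (hrq : r ≤ q) (h : UnifBdd e e' r) : UnifBdd e e' q := by
  obtain ⟨A, hA, h⟩ := h
  refine ⟨A, hA, fun s F hF => ?_⟩
  have hq : 0 < q := by linarith
  set T := hMs (fun j => e + sdir e' j) s with hT
  have pT : PosOp T := posOp_hMs _ s
  have h1 : r / q ≤ 1 := (div_le_one hq).2 hrq
  have hm : Measurable fun x => F x ^ (q / r) := hF.pow_const _
  have hpt : ∀ x, T F x ^ q ≤ T (fun y => F y ^ (q / r)) x ^ r := by
    intro x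
    have := pT.holder hm (measurable_const (a := (1 : ℝ≥0∞))) (a := r / q) (b := 1 - r / q)
      (by positivity) (by linarith) (by ring) x
    simp only [ENNReal.one_rpow, mul_one, ← ENNReal.rpow_mul] at this
    simp only [show q / r * (r / q) = 1 by field_simp, ENNReal.rpow_one] at this
    have hone : T (fun _ => 1) x ^ (1 - r / q) ≤ 1 :=
      ENNReal.rpow_le_one (pT.const 1 x) (by linarith)
    calc T F x ^ q ≤ (T (fun y => F y ^ (q / r)) x ^ (r / q)) ^ q :=
          ENNReal.rpow_le_rpow (this.trans (mul_le_of_le_one_right zero_le hone)) hq.le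
      _ = _ := by rw [← ENNReal.rpow_mul, div_mul_cancel₀ _ hq.ne']
  refine (lintegral_mono hpt).trans ((h s hm).trans (le_of_eq ?_))
  simp_rw [← ENNReal.rpow_mul, div_mul_cancel₀ q hr.ne']

/-- The lacunary directional maximal operators are bounded on `L^q` for all `q > 1`. -/
theorem unifBdd {q : ℝ} (hq : 1 < q) : UnifBdd e e' q := by
  have step : ∀ n : ℕ, UnifBdd e e' (1 / (1 - 1 / 2 * (3 / 4 : ℝ) ^ n)) := by
    intro n
    induction n with
    | zero =>
      have : (1 : ℝ) / (1 - 1 / 2 * (3 / 4 : ℝ) ^ 0) = 2 := by norm_num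
      rw [this]
      exact unifBdd_two
    | succ n ih =>
      set v : ℝ := 1 / 2 * (3 / 4 : ℝ) ^ n with hv
      have hv0 : 0 < v := by positivity
      have hv1 : v ≤ 1 / 2 := by
        have := pow_le_one₀ (n := n) (by norm_num : (0 : ℝ) ≤ 3 / 4) (by norm_num)
        rw [hv]; linarith
      have e1 : 1 / 2 * (3 / 4 : ℝ) ^ (n + 1) = 3 / 4 * v := by rw [hv, pow_succ]; ring
      rw [e1]
      have h1v : 0 < 1 - v := by linarith
      have h2v : 0 < 1 - 3 / 4 * v := by linarith
      have hp1 : 1 < 1 / (1 - 3 / 4 * v) := by rw [lt_div_iff₀ h2v]; linarith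
      have hp2 : 1 / (1 - 3 / 4 * v) ≤ 2 := by rw [div_le_iff₀ h2v]; linarith
      obtain ⟨a, b⟩ := vvBdd_of_unifBdd (p := 1 / (1 - 3 / 4 * v)) (q := 1 / (1 - v))
        (θ := (1 / 2 - 3 / 4 * v) / (1 - v)) (div_pos (by linarith) h1v)
        (by rw [div_lt_iff₀ h1v]; linarith) (by rw [lt_div_iff₀ h1v]; linarith) (by linarith)
        (by rw [one_div_one_div, div_div_eq_mul_div, div_mul_cancel₀ _ h1v.ne']; ring_nf) ih
      exact unifBdd_of_vvBdd hp1 hp2 a b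
  have hq0 : 0 < q := by linarith
  have hpos : 0 < 1 - 1 / q := by rw [sub_pos, div_lt_one hq0]; exact hq
  obtain ⟨n, hn⟩ := exists_pow_lt_of_lt_one hpos (by norm_num : (3 / 4 : ℝ) < 1)
  have h3 : (0 : ℝ) < (3 / 4 : ℝ) ^ n := by positivity
  have h4 : (3 / 4 : ℝ) ^ n ≤ 1 := pow_le_one₀ (by norm_num) (by norm_num)
  have h5 : 0 < 1 - 1 / 2 * (3 / 4 : ℝ) ^ n := by linarith
  refine (step n).mono (by positivity) ?_
  rw [div_le_iff₀ h5]
  have : q * (1 / q) = 1 := by field_simp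
  nlinarith

end LacunaryHalfPlane

namespace LacunaryHalfPlane

open ProbabilityTheory ENNReal

/-- The multiplier of the half plane `dotp e > 0`, applied to the function with frequency density
`g`. -/
noncomputable def hpOp (e : ℝ × ℝ) (g : ℝ × ℝ → ℂ) (x : ℝ × ℝ) : ℂ :=
  syn (fun ξ => (Set.Ioi (0 : ℝ)).indicator (fun _ => (1 : ℂ)) (dotp e ξ) * g ξ) x

section Single

variable {e : ℝ × ℝ} {g k : ℝ × ℝ → ℂ} {V : ℝ × ℝ → ℝ≥0∞} {K : ℝ≥0∞}

theorem integrable_indicator_mul (hg : Integrable g) :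
    Integrable fun ξ => (Set.Ioi (0 : ℝ)).indicator (fun _ => (1 : ℂ)) (dotp e ξ) * g ξ := by
  refine hg.bdd_mul (c := 1) ?_ (Filter.Eventually.of_forall fun ξ => ?_)
  · exact ((measurable_const.indicator measurableSet_Ioi).comp
      (continuous_dotp e).measurable).aestronglyMeasurable
  · by_cases h : dotp e ξ ∈ Set.Ioi (0 : ℝ)
    · simp [Set.indicator_of_mem h]
    · simp [Set.indicator_of_notMem h]

theorem integrable_sign_mul (hg : Integrable g) :
    Integrable fun ξ => ((SignType.sign (dotp e ξ) : ℝ) : ℂ) * g ξ := by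
  refine hg.bdd_mul (c := 1) ?_ (Filter.Eventually.of_forall fun ξ => ?_)
  · have : Measurable fun θ : ℝ => ((SignType.sign θ : ℝ) : ℂ) := by
      refine Complex.measurable_ofReal.comp ?_
      have : (fun θ : ℝ => (SignType.sign θ : ℝ)) =
          fun θ => if 0 < θ then 1 else if θ < 0 then -1 else 0 := by
        ext θ
        rw [sign_apply]
        split_ifs <;> simp
      rw [this]
      exact Measurable.ite measurableSet_Ioi measurable_const
        (Measurable.ite measurableSet_Iio measurable_const measurable_const)
    exact (this.comp (continuous_dotp e).measurable).aestronglyMeasurable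
  · rcases lt_trichotomy (dotp e ξ) 0 with h | h | h
    · simp [sign_neg h]
    · simp [h]
    · simp [sign_pos h]

theorem BddM.hpOp (hg : Integrable g) : BddM (hpOp e g) := BddM.syn (integrable_indicator_mul hg)

theorem ae_dotp_ne_zero (he : e ≠ 0) : ∀ᵐ ξ : ℝ × ℝ, dotp e ξ ≠ 0 := by
  let L : (ℝ × ℝ) →ₗ[ℝ] ℝ := e.1 • LinearMap.fst ℝ ℝ ℝ + e.2 • LinearMap.snd ℝ ℝ ℝ
  have hL : LinearMap.ker L ≠ ⊤ := by
    intro h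
    rw [LinearMap.ker_eq_top] at h
    have h1 : L (1, 0) = 0 := by rw [h]; rfl
    have h2 : L (0, 1) = 0 := by rw [h]; rfl
    simp [L] at h1 h2
    exact he (Prod.ext h1 h2)
  have := Measure.addHaar_submodule (volume : Measure (ℝ × ℝ)) (LinearMap.ker L) hL
  rw [ae_iff]
  refine measure_mono_null (fun ξ hξ => ?_) this
  simpa [L, dotp] using hξ

theorem hpOp_eq (he : e ≠ 0) (hg : Integrable g) (x : ℝ × ℝ) :
    hpOp e g x = (1 / 2) * (syn g x + syn (fun ξ => ((SignType.sign (dotp e ξ) : ℝ) : ℂ) * g ξ) x) := by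
  rw [← syn_add hg (integrable_sign_mul hg), ← syn_const_mul]
  unfold hpOp syn
  refine integral_congr_ae ?_
  filter_upwards [ae_dotp_ne_zero he] with ξ hξ
  congr 1
  rcases hξ.lt_or_gt with h | h
  · rw [Set.indicator_of_notMem (by simpa using h.le), sign_neg h]
    simp
  · rw [Set.indicator_of_mem (by simpa using h), sign_pos h]
    simp only [SignType.coe_one, Complex.ofReal_one]
    ring

theorem enorm_hpOp_pair_le (he : e ≠ 0) (hg : Integrable g) (hi : Integrable k) :
    ‖∫ x, hpOp e g x * k x‖ₑ ≤ (∫⁻ x, ‖syn g x‖ₑ * ‖k x‖ₑ) +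
      ENNReal.ofReal (1 / piC) * ∫⁻ t, ‖∫ x, heatC e (Real.exp t) (derC e (3 * Real.exp t)
        (derC e (Real.exp t) (sqB e (Real.exp t) (syn g)))) x * k x‖ₑ := by
  have mul_int : ∀ {h : ℝ × ℝ → ℂ}, Integrable h → Integrable fun x => syn h x * k x := by
    intro h hh
    obtain ⟨C, hC⟩ := (BddM.syn hh).bdd
    exact hi.bdd_mul (BddM.syn hh).meas.aestronglyMeasurable (Filter.Eventually.of_forall hC)
  have half : ‖(1 / 2 : ℂ)‖ₑ ≤ 1 := by
    rw [← ofReal_norm]; norm_num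
  have e1 : ∫ x, hpOp e g x * k x = (1 / 2) * ((∫ x, syn g x * k x) +
      ∫ x, syn (fun ξ => ((SignType.sign (dotp e ξ) : ℝ) : ℂ) * g ξ) x * k x) := by
    rw [← integral_add (mul_int hg) (mul_int (integrable_sign_mul hg)), ← integral_const_mul]
    refine integral_congr_ae (ae_of_all _ fun x => ?_)
    simp only [hpOp_eq he hg]
    ring
  rw [e1, enorm_mul]
  refine (mul_le_of_le_one_left zero_le half).trans ((enorm_add_le _ _).trans (add_le_add ?_ ?_))
  · refine (enorm_integral_le_lintegral_enorm _).trans (le_of_eq ?_)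
    simp_rw [enorm_mul]
  · exact enorm_sign_pair_le hg hi

noncomputable def halfC (a : ℝ) (K : ℝ≥0∞) : ℝ≥0∞ :=
  2 * (1 + ENNReal.ofReal (1 / piC) ^ 2 * (negC a * (3 * posC a K)))

theorem halfC_ne_top {a : ℝ} (ha : 0 < a) (ha1 : a < 1) (hK : K ≠ ⊤) : halfC a K ≠ ⊤ :=
  ENNReal.mul_ne_top (by norm_num) (ENNReal.add_ne_top.2 ⟨one_ne_top, ENNReal.mul_ne_top
    (ENNReal.pow_ne_top ofReal_ne_top) (ENNReal.mul_ne_top (negC_ne_top ha ha1)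
      (ENNReal.mul_ne_top (by norm_num) (posC_ne_top ha ha1 hK)))⟩)

theorem add_sq_le_two_mul (a b : ℝ≥0∞) : (a + b) ^ 2 ≤ 2 * (a ^ 2 + b ^ 2) := by
  have := ENNReal.rpow_add_le_mul_rpow_add_rpow a b (by norm_num : (1 : ℝ) ≤ 2)
  norm_num at this
  exact this

theorem hpOp_pair_sq_le_aux {W : ℝ × ℝ → ℝ≥0∞} (hW : Wt W) (he : e ≠ 0) (hg : Integrable g)
    (hk : BddM k) (hi : Integrable k) {B : ℝ≥0∞}
    (h : (∫⁻ t, ‖∫ x, heatC e (Real.exp t) (derC e (3 * Real.exp t)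
        (derC e (Real.exp t) (sqB e (Real.exp t) (syn g)))) x * k x‖ₑ) ^ 2 ≤
      B * ((∫⁻ x, ‖syn g x‖ₑ ^ 2 * W x) * ∫⁻ x, ‖k x‖ₑ ^ 2 * (W x)⁻¹)) :
    ‖∫ x, hpOp e g x * k x‖ₑ ^ 2 ≤ (2 * (1 + ENNReal.ofReal (1 / piC) ^ 2 * B) *
      ∫⁻ x, ‖syn g x‖ₑ ^ 2 * W x) * ∫⁻ x, ‖k x‖ₑ ^ 2 * (W x)⁻¹ := by
  have h1 := lintegral_mul_sq_le_weighted (μ := volume) (f := fun x => ‖syn g x‖ₑ)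
    (g := fun x => ‖k x‖ₑ) (BddM.syn hg).meas.enorm.aemeasurable hk.meas.enorm.aemeasurable
    hW.meas.aemeasurable hW.ne_zero hW.ne_top
  calc _ ≤ _ := pow_le_pow_left' (enorm_hpOp_pair_le he hg hi) 2
    _ ≤ _ := add_sq_le_two_mul _ _
    _ ≤ 2 * ((∫⁻ x, ‖syn g x‖ₑ ^ 2 * W x) * (∫⁻ x, ‖k x‖ₑ ^ 2 * (W x)⁻¹) +
        ENNReal.ofReal (1 / piC) ^ 2 *
          (B * ((∫⁻ x, ‖syn g x‖ₑ ^ 2 * W x) * ∫⁻ x, ‖k x‖ₑ ^ 2 * (W x)⁻¹))) := by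
        rw [mul_pow]
        exact mul_le_mul_right (add_le_add h1 (mul_le_mul_right h _)) _
    _ = _ := by ring

theorem hpOp_pair_sq_le_neg {a : ℝ} (ha : 0 < a) (ha1 : a < 1) (h : A1 e K V) (hV : Wt V)
    (hK : K ≠ ⊤) (he : e ≠ 0) (hg : Integrable g) (hk : BddM k) (hi : Integrable k) :
    ‖∫ x, hpOp e g x * k x‖ₑ ^ 2 ≤ (halfC a K * ∫⁻ x, ‖syn g x‖ₑ ^ 2 * V x ^ (-a)) *
      ∫⁻ x, ‖k x‖ₑ ^ 2 * (V x ^ (-a))⁻¹ := by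
  refine hpOp_pair_sq_le_aux (hV.rpow (-a)) he hg hk hi ?_
  simp_rw [← ENNReal.rpow_neg, neg_neg]
  have hf := BddM.syn hg
  refine (pow_le_pow_left' (lintegral_mono fun t => ?_) 2).trans
    ((bilinear_sqB_le ha ha1 h hV hK hf hk).trans (le_of_eq (by ring)))
  rw [integral_pi_mul' (Real.exp_pos t) hf hk hi]
  refine (enorm_integral_le_lintegral_enorm _).trans (le_of_eq ?_)
  simp_rw [enorm_mul]

theorem hpOp_pair_sq_le_pos {a : ℝ} (ha : 0 < a) (ha1 : a < 1) (h : A1 e K V) (hV : Wt V)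
    (hK : K ≠ ⊤) (he : e ≠ 0) (hg : Integrable g) (hk : BddM k) (hi : Integrable k) :
    ‖∫ x, hpOp e g x * k x‖ₑ ^ 2 ≤ (halfC a K * ∫⁻ x, ‖syn g x‖ₑ ^ 2 * V x ^ a) *
      ∫⁻ x, ‖k x‖ₑ ^ 2 * (V x ^ a)⁻¹ := by
  refine hpOp_pair_sq_le_aux (hV.rpow a) he hg hk hi ?_
  simp_rw [← ENNReal.rpow_neg]
  have hf := BddM.syn hg
  refine (pow_le_pow_left' (lintegral_mono fun t => ?_) 2).trans
    ((bilinear_sqB_le ha ha1 h hV hK hk hf).trans (le_of_eq (by ring)))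
  rw [integral_pi_mul hf hk hi, enorm_neg]
  refine (enorm_integral_le_lintegral_enorm _).trans (le_of_eq ?_)
  simp_rw [enorm_mul, mul_comm]

end Single

variable {e : ℤ → ℝ × ℝ} {g : ℤ → ℝ × ℝ → ℂ}

theorem lintegral_sum_hpOp_sq_le {W : ℝ × ℝ → ℝ≥0∞} (hW : Wt W) (hg : ∀ j, Integrable (g j))
    {C : ℝ≥0∞} (s : Finset ℤ)
    (H : ∀ j ∈ s, ∀ k, BddM k → Integrable k → ‖∫ x, hpOp (e j) (g j) x * k x‖ₑ ^ 2 ≤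
      (C * ∫⁻ x, ‖syn (g j) x‖ₑ ^ 2 * W x) * ∫⁻ x, ‖k x‖ₑ ^ 2 * (W x)⁻¹) :
    ∫⁻ x, (∑ j ∈ s, ‖hpOp (e j) (g j) x‖ₑ ^ 2) * W x ≤
      C * ∫⁻ x, (∑ j ∈ s, ‖syn (g j) x‖ₑ ^ 2) * W x := by
  have e1 : ∫⁻ x, (∑ j ∈ s, ‖syn (g j) x‖ₑ ^ 2) * W x =
      ∑ j ∈ s, ∫⁻ x, ‖syn (g j) x‖ₑ ^ 2 * W x := by
    simp_rw [Finset.sum_mul]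
    exact lintegral_finsetSum _ fun j _ => ((BddM.syn (hg j)).meas.enorm.pow_const 2).mul hW.meas
  rw [e1, Finset.mul_sum]
  exact lintegral_sq_le_of_pairing s (fun j => BddM.hpOp (hg j)) hW fun k hk hi =>
    finset_sum_mul_sq_le s fun j hj => H j hj (k j) (hk j) (hi j)

theorem exists_lintegral_sum_hpOp_le {p : ℝ} (hp : 1 < p) (he : ∀ j, e j ≠ 0)
    (hM : ∀ q : ℝ, 1 < q → ∃ A : ℝ≥0∞, A ≠ ⊤ ∧ ∀ s : Finset ℤ, LqBdd (hMs e s) q A) :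
    ∃ C : ℝ≥0∞, C ≠ ⊤ ∧ ∀ (s : Finset ℤ) (g : ℤ → ℝ × ℝ → ℂ), (∀ j, Integrable (g j)) →
      (∀ j, ∫⁻ x, ‖syn (g j) x‖ₑ ^ 2 ≠ ⊤) →
      ∫⁻ x, (∑ j ∈ s, ‖hpOp (e j) (g j) x‖ₑ ^ 2) ^ (p / 2) ≤
        C * ∫⁻ x, (∑ j ∈ s, ‖syn (g j) x‖ₑ ^ 2) ^ (p / 2) := by
  have sum_bdd : ∀ (s : Finset ℤ) {u : ℤ → ℝ × ℝ → ℂ}, (∀ j, BddM (u j)) →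
      ∃ N : NNReal, ∀ x, ∑ j ∈ s, ‖u j x‖ₑ ^ 2 ≤ N := by
    intro s u hu
    choose N hN using fun j => (hu j).exists_enorm_le
    refine ⟨∑ j ∈ s, N j ^ 2, fun x => ?_⟩
    push_cast
    exact Finset.sum_le_sum fun j _ => pow_le_pow_left' (hN j x) 2
  have sum_meas : ∀ (s : Finset ℤ) {u : ℤ → ℝ × ℝ → ℂ}, (∀ j, BddM (u j)) →
      Measurable fun x => ∑ j ∈ s, ‖u j x‖ₑ ^ 2 := fun s u hu =>
    Finset.measurable_sum _ fun j _ => (hu j).meas.enorm.pow_const 2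
  rcases lt_trichotomy p 2 with hp2 | rfl | hp2
  · have ha : 0 < 1 / p := by positivity
    have ha1 : 1 / p < 1 := by rw [div_lt_one (by linarith)]; exact hp
    have hr : 1 / p * p / (2 - p) = 1 / (2 - p) := by field_simp
    have hr1 : 1 < 1 / p * p / (2 - p) := by
      rw [hr, lt_div_iff₀ (by linarith)]; linarith
    obtain ⟨D, hD, hMD⟩ := hM _ hr1
    set K : ℝ≥0∞ := 2 * rdfC (1 / p * p / (2 - p)) D with hK
    have hKt : K ≠ ⊤ := ENNReal.mul_ne_top (by norm_num) (rdfC_ne_top (by linarith) hD)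
    have hC0 : halfC (1 / p) K ≠ 0 := by simp [halfC]
    have hCt : halfC (1 / p) K ≠ ⊤ := halfC_ne_top ha ha1 hKt
    refine ⟨halfC (1 / p) K ^ (p / 2) * (2 ^ (1 / p * p / (2 - p))) ^ (1 - p / 2),
      ENNReal.mul_ne_top (ENNReal.rpow_ne_top_of_nonneg (by positivity) hCt)
        (ENNReal.rpow_ne_top_of_nonneg (by linarith)
          (ENNReal.rpow_ne_top_of_nonneg (by linarith) (by norm_num))), fun s g hg _ => ?_⟩
    obtain ⟨N, hN⟩ := sum_bdd s fun j => BddM.syn (hg j)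
    exact extrapolation_low (posOp_hMs e s) (by linarith : 0 < p) hp2 ha hr1.le
      (hMD s) hD hC0 hCt (sum_meas s fun j => BddM.hpOp (hg j)) (sum_meas s fun j => BddM.syn (hg j))
      hN fun V hV h => lintegral_sum_hpOp_sq_le (hV.rpow _) hg s fun j hj k hk hi =>
        hpOp_pair_sq_le_neg ha ha1 (A1.of_hMs hV.meas h hj) hV hKt (he j) (hg j) hk hi
  · refine ⟨halfC (1 / 2) 1, halfC_ne_top (by norm_num) (by norm_num) one_ne_top,
      fun s g hg _ => ?_⟩
    have := lintegral_sum_hpOp_sq_le (e := e) (Wt.one.rpow (1 / 2)) hg s fun j _ k hk hi =>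
      hpOp_pair_sq_le_pos (a := 1 / 2) (by norm_num) (by norm_num) (A1.one (e j)) Wt.one one_ne_top
        (he j) (hg j) hk hi
    simpa using this
  · have hp0 : 0 < p := by linarith
    have ha : 0 < (p - 1) / p := div_pos (by linarith) hp0
    have ha1 : (p - 1) / p < 1 := by rw [div_lt_one hp0]; linarith
    have hr1 : 1 < (p - 1) / p * p / (p - 2) := by
      rw [div_mul_cancel₀ _ hp0.ne', lt_div_iff₀ (by linarith)]; linarith
    obtain ⟨D, hD, hMD⟩ := hM _ hr1
    set K : ℝ≥0∞ := 2 * rdfC ((p - 1) / p * p / (p - 2)) D with hK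
    have hKt : K ≠ ⊤ := ENNReal.mul_ne_top (by norm_num) (rdfC_ne_top (by linarith) hD)
    have hCt : halfC ((p - 1) / p) K ≠ ⊤ := halfC_ne_top ha ha1 hKt
    refine ⟨_, ENNReal.rpow_ne_top_of_nonneg (by positivity : 0 ≤ p / 2) (ENNReal.mul_ne_top hCt
      (ENNReal.rpow_ne_top_of_nonneg (div_nonneg (by linarith) (by linarith) :
          0 ≤ (p / 2 - 1) / (p / 2))
        (ENNReal.rpow_ne_top_of_nonneg (by linarith : 0 ≤ (p - 1) / p * p / (p - 2))
          (by norm_num : (2 : ℝ≥0∞) ≠ ⊤)))), fun s g hg hfin => ?_⟩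
    obtain ⟨N, hN⟩ := sum_bdd s fun j => BddM.hpOp (e := e j) (hg j)
    refine extrapolation_high (posOp_hMs e s) hp2 ha ha1.le hr1.le
      (hMD s) hD hCt (sum_meas s fun j => BddM.hpOp (hg j)) (sum_meas s fun j => BddM.syn (hg j))
      hN ?_ fun V hV h => lintegral_sum_hpOp_sq_le (hV.rpow _) hg s fun j hj k hk hi =>
        hpOp_pair_sq_le_pos ha ha1 (A1.of_hMs hV.meas h hj) hV hKt (he j) (hg j) hk hi
    rw [lintegral_finsetSum _ fun j _ => (BddM.syn (hg j)).meas.enorm.pow_const 2]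
    exact ENNReal.sum_ne_top.2 fun j _ => hfin j

end LacunaryHalfPlane

namespace LacunaryHalfPlane

open ProbabilityTheory ENNReal

section Translate

variable (f : SchwartzMap (ℝ × ℝ) ℂ) (τ : ℝ)

theorem enorm_ch (x ξ : ℝ × ℝ) : ‖ch x ξ‖ₑ = 1 := by
  rw [← ofReal_norm, norm_ch, ofReal_one]

theorem syn_translate (h : ℝ × ℝ → ℂ) (a x : ℝ × ℝ) :
    syn h x = ch x a * syn (fun ξ => h (ξ + a)) x := by
  unfold syn
  rw [← integral_add_right_eq_self (fun ξ => h ξ * ch x ξ) a, ← integral_const_mul]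
  congr 1; ext ξ
  rw [ch_comm x (ξ + a), ch_add, ch_comm ξ, ch_comm a]
  ring

theorem enorm_syn_translate (h : ℝ × ℝ → ℂ) (a x : ℝ × ℝ) :
    ‖syn (fun ξ => h (ξ + a)) x‖ₑ = ‖syn h x‖ₑ := by
  rw [syn_translate h a x, enorm_mul, enorm_ch, one_mul]

theorem dotp_lacunary (j : ℤ) (ξ : ℝ × ℝ) :
    dotp ((1, 0) + sdir (0, 1) j) ξ = ξ.1 + ξ.2 * (2 : ℝ) ^ (-j) := by
  simp [dotp, sdir, mul_comm]

theorem enorm_halfPlaneOp (j : ℤ) (x : ℝ × ℝ) :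
    ‖halfPlaneOp τ j f x‖ₑ =
      ‖hpOp ((1, 0) + sdir (0, 1) j) (fun ξ => fourier2 f (ξ + (τ, 0))) x‖ₑ := by
  have h : halfPlaneOp τ j f x = syn (fun w => fourier2 f w *
      (Set.Ioi τ).indicator (fun _ => (1 : ℂ)) (w.1 + w.2 * (2 : ℝ) ^ (-j))) x := by
    unfold halfPlaneOp syn ch
    congr 1; ext w
    congr 2
    push_cast
    ring
  rw [h, ← enorm_syn_translate _ (τ, 0)]
  unfold hpOp
  congr 2
  ext ξ
  rw [dotp_lacunary, mul_comm]
  congr 1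
  simp only [Set.indicator_apply, Set.mem_Ioi, Prod.fst_add, Prod.snd_add, add_zero]
  congr 1
  rw [eq_iff_iff]
  constructor <;> intro h <;> linarith

end Translate

theorem enorm_sqrt_sum_sq_rpow {ι : Type*} (s : Finset ι) (u : ι → ℂ) (p : ℝ) :
    ‖√(∑ j ∈ s, ‖u j‖ ^ 2)‖ₑ ^ p = (∑ j ∈ s, ‖u j‖ₑ ^ 2) ^ (p / 2) := by
  have h0 : 0 ≤ ∑ j ∈ s, ‖u j‖ ^ 2 := Finset.sum_nonneg fun j _ => by positivity
  have h1 : ∑ j ∈ s, ‖u j‖ₑ ^ 2 = ENNReal.ofReal (∑ j ∈ s, ‖u j‖ ^ 2) := by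
    rw [ENNReal.ofReal_sum_of_nonneg fun j _ => by positivity]
    exact Finset.sum_congr rfl fun j _ => by
      rw [← ofReal_norm, ENNReal.ofReal_pow (norm_nonneg _)]
  rw [h1, Real.enorm_of_nonneg (Real.sqrt_nonneg _), Real.sqrt_eq_rpow,
    ← ENNReal.ofReal_rpow_of_nonneg h0 (by norm_num), ← ENNReal.rpow_mul]
  congr 1
  ring

theorem lacunary_dir_ne_zero (j : ℤ) : ((1, 0) : ℝ × ℝ) + sdir (0, 1) j ≠ 0 := by
  intro h
  simpa [sdir] using congrArg Prod.fst h

theorem lintegral_enorm_sq_ne_top (f : SchwartzMap (ℝ × ℝ) ℂ) : ∫⁻ x, ‖f x‖ₑ ^ 2 ≠ ⊤ := by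
  have := (f.memLp 2 volume).eLpNorm_lt_top
  rw [eLpNorm_lt_top_iff_lintegral_rpow_enorm_lt_top (by norm_num) (by norm_num)] at this
  simpa using this.ne

end LacunaryHalfPlane

open LacunaryHalfPlane

/-- Córdoba–Fefferman vector-valued inequality for lacunary directions: for `1 < p < ∞`
there is `C_p` such that for every `|τ| ≤ 10`, every finite `F ⊂ ℤ`, and all Schwartz
functions `(f_j)_{j ∈ F}` on `ℝ²`,
`‖(Σ_j |H_{τ,j} f_j|²)^{1/2}‖_p ≤ C_p ‖(Σ_j |f_j|²)^{1/2}‖_p`. -/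
theorem stmt_17 (p : ℝ) (hp : 1 < p) :
    ∃ C : ℝ, 0 < C ∧
      ∀ τ : ℝ, |τ| ≤ 10 →
      ∀ F : Finset ℤ, ∀ f : ℤ → SchwartzMap (ℝ × ℝ) ℂ,
        eLpNorm
          (fun q : ℝ × ℝ =>
            Real.sqrt (∑ j ∈ F, ‖halfPlaneOp τ j (fun z => f j z) q‖ ^ 2))
          (ENNReal.ofReal p) volume ≤
        ENNReal.ofReal C *
          eLpNorm (fun q : ℝ × ℝ => Real.sqrt (∑ j ∈ F, ‖f j q‖ ^ 2))
            (ENNReal.ofReal p) volume := by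
  obtain ⟨C, hC, H⟩ := exists_lintegral_sum_hpOp_le (e := fun j => (1, 0) + sdir (0, 1) j) hp
    lacunary_dir_ne_zero fun q hq => unifBdd hq
  have hp0 : 0 < p := by linarith
  have hC' : C ^ (1 / p) ≠ ⊤ := ENNReal.rpow_ne_top_of_nonneg (by positivity) hC
  refine ⟨(C ^ (1 / p)).toReal + 1, by positivity, fun τ _ F f => ?_⟩
  have hsyn : ∀ j x, ‖syn (fun ξ => fourier2 (f j) (ξ + (τ, 0))) x‖ₑ = ‖f j x‖ₑ := fun j x => by
    rw [enorm_syn_translate, syn_fourier2]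
  have key := H F (fun j ξ => fourier2 (f j) (ξ + (τ, 0)))
    (fun j => (integrable_fourier2 (f j)).comp_add_right _)
    (fun j => by simpa only [hsyn] using lintegral_enorm_sq_ne_top (f j))
  simp only [hsyn, ← enorm_halfPlaneOp] at key
  rw [eLpNorm_eq_lintegral_rpow_enorm_toReal (by simpa using hp0) ENNReal.ofReal_ne_top,
    eLpNorm_eq_lintegral_rpow_enorm_toReal (by simpa using hp0) ENNReal.ofReal_ne_top,
    ENNReal.toReal_ofReal hp0.le]
  simp only [enorm_sqrt_sum_sq_rpow]
  calc _ ≤ (C * ∫⁻ x, (∑ j ∈ F, ‖f j x‖ₑ ^ 2) ^ (p / 2)) ^ (1 / p) :=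
        ENNReal.rpow_le_rpow key (by positivity)
    _ = C ^ (1 / p) * (∫⁻ x, (∑ j ∈ F, ‖f j x‖ₑ ^ 2) ^ (p / 2)) ^ (1 / p) :=
        ENNReal.mul_rpow_of_nonneg _ _ (by positivity)
    _ ≤ _ := by
        gcongr
        exact (ENNReal.le_ofReal_iff_toReal_le hC' (by positivity)).2 (by linarith)
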